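/- There exists a constant C depending only on T, q, C₀ and on the initial data ρ₀,u₀,w₀,b₀,θ₀ — specifically on upper bounds for their H²((0,1))-norms, an upper bound for ∫₀¹ ρ₀(|ln ρ₀| + |ln θ₀|) dx, and a positive lower bound for ∫₀¹ ρ₀ dx — but not on the pointwise lower bounds of ρ₀ and θ₀, such that every smooth solution (ρ,u,w,b,θ) of the planar compressible MHD system on Q_T satisfies sup_{t∈[0,T]} ∫₀¹ (u_x² + |w_x|² + |b_x|² + (ρθ)² + ρ θ^{q+2})(x,t) dx + ∬_{Q_T} (ρ u_t² + ρ |w_t|² + |b_t|² + |b_{xx}|² + κ(θ)² θ_x²) dx dt ≤ C. -/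

import Mathlib

open Real MeasureTheory Set

noncomputable section

/-- Partial derivative in the first (spatial) variable of `f : ℝ → ℝ → ℝ`, `f x t`. -/
def pdx (f : ℝ → ℝ → ℝ) : ℝ → ℝ → ℝ := fun x t => deriv (fun y => f y t) x

/-- Partial derivative in the second (time) variable. -/
def pdt (f : ℝ → ℝ → ℝ) : ℝ → ℝ → ℝ := fun x t => deriv (fun s => f x s) t

/-- The `L²(0,1)` norm of a function. -/
def L2norm (f : ℝ → ℝ) : ℝ := Real.sqrt (∫ x in (0:ℝ)..1, (f x) ^ 2)

/-- The `H²(0,1)` norm of a (smooth) function. -/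
def H2norm (f : ℝ → ℝ) : ℝ :=
  Real.sqrt (∫ x in (0:ℝ)..1, (f x) ^ 2 + (deriv f x) ^ 2 + (deriv (deriv f) x) ^ 2)

/-- A smooth solution of the planar compressible MHD system (all physical constants
normalized to `1`, perfect-gas pressure `P = ρθ`, heat conductivity `κ`) on
`Q_T = [0,1] × [0,T]`:  `ρ, u, θ` are scalar fields, `w, b` are `ℝ²`-valued fields
(given by their two components), everything is smooth, `ρ > 0` and `θ > 0` on `Q_T`,
the five PDEs hold on `Q_T`, and the boundary conditions
`u = 0`, `w = 0`, `b = 0`, `θ_x = 0` hold at `x = 0` and `x = 1`. -/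
structure MHDSol (T : ℝ) (κ : ℝ → ℝ) where
  ρ : ℝ → ℝ → ℝ
  u : ℝ → ℝ → ℝ
  θ : ℝ → ℝ → ℝ
  w : Fin 2 → ℝ → ℝ → ℝ
  b : Fin 2 → ℝ → ℝ → ℝ
  smooth_ρ : ContDiff ℝ (⊤ : ℕ∞) (Function.uncurry ρ)
  smooth_u : ContDiff ℝ (⊤ : ℕ∞) (Function.uncurry u)
  smooth_θ : ContDiff ℝ (⊤ : ℕ∞) (Function.uncurry θ)
  smooth_w : ∀ i, ContDiff ℝ (⊤ : ℕ∞) (Function.uncurry (w i))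
  smooth_b : ∀ i, ContDiff ℝ (⊤ : ℕ∞) (Function.uncurry (b i))
  ρ_pos : ∀ x ∈ Set.Icc (0:ℝ) 1, ∀ t ∈ Set.Icc (0:ℝ) T, 0 < ρ x t
  θ_pos : ∀ x ∈ Set.Icc (0:ℝ) 1, ∀ t ∈ Set.Icc (0:ℝ) T, 0 < θ x t
  eq_mass : ∀ x ∈ Set.Icc (0:ℝ) 1, ∀ t ∈ Set.Icc (0:ℝ) T,
    pdt ρ x t + pdx (fun x t => ρ x t * u x t) x t = 0
  eq_mom : ∀ x ∈ Set.Icc (0:ℝ) 1, ∀ t ∈ Set.Icc (0:ℝ) T,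
    pdt (fun x t => ρ x t * u x t) x t
      + pdx (fun x t =>
          ρ x t * (u x t) ^ 2 + ρ x t * θ x t + (∑ i, (b i x t) ^ 2) / 2) x t
      = pdx (pdx u) x t
  eq_w : ∀ i, ∀ x ∈ Set.Icc (0:ℝ) 1, ∀ t ∈ Set.Icc (0:ℝ) T,
    pdt (fun x t => ρ x t * w i x t) x t
      + pdx (fun x t => ρ x t * u x t * w i x t - b i x t) x t
      = pdx (pdx (w i)) x t
  eq_b : ∀ i, ∀ x ∈ Set.Icc (0:ℝ) 1, ∀ t ∈ Set.Icc (0:ℝ) T,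
    pdt (b i) x t + pdx (fun x t => u x t * b i x t - w i x t) x t
      = pdx (pdx (b i)) x t
  eq_θ : ∀ x ∈ Set.Icc (0:ℝ) 1, ∀ t ∈ Set.Icc (0:ℝ) T,
    pdt (fun x t => ρ x t * θ x t) x t
      + pdx (fun x t => ρ x t * u x t * θ x t) x t
      - pdx (fun x t => κ (θ x t) * pdx θ x t) x t
      = (pdx u x t) ^ 2 + (∑ i, (pdx (w i) x t) ^ 2) + (∑ i, (pdx (b i) x t) ^ 2)
        - ρ x t * θ x t * pdx u x t
  bc_u : ∀ t ∈ Set.Icc (0:ℝ) T, u 0 t = 0 ∧ u 1 t = 0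
  bc_w : ∀ i, ∀ t ∈ Set.Icc (0:ℝ) T, w i 0 t = 0 ∧ w i 1 t = 0
  bc_b : ∀ i, ∀ t ∈ Set.Icc (0:ℝ) T, b i 0 t = 0 ∧ b i 1 t = 0
  bc_θ : ∀ t ∈ Set.Icc (0:ℝ) T, pdx θ 0 t = 0 ∧ pdx θ 1 t = 0

/-- The heat conductivity `κ` is `C²` on `[0,∞)` and satisfies
`C₀⁻¹ (1 + s^q) ≤ κ(s) ≤ C₀ (1 + s^q)` there. -/
def KappaHyp (q C₀ : ℝ) (κ : ℝ → ℝ) : Prop :=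
  ContDiffOn ℝ 2 κ (Set.Ici 0) ∧
  (∀ s : ℝ, 0 ≤ s → C₀⁻¹ * (1 + s ^ q) ≤ κ s) ∧
  (∀ s : ℝ, 0 ≤ s → κ s ≤ C₀ * (1 + s ^ q))

/-- Bounds on the initial data: `A` is an upper bound for the `H²(0,1)` norms of
`ρ₀, u₀, w₀, b₀, θ₀`, `B` is an upper bound for `∫₀¹ ρ₀ (|ln ρ₀| + |ln θ₀|) dx`, and
`M` is a (positive) lower bound for the total mass `∫₀¹ ρ₀ dx`. -/
def InitBounds {T : ℝ} {κ : ℝ → ℝ} (sol : MHDSol T κ) (A B M : ℝ) : Prop :=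
  H2norm (fun x => sol.ρ x 0) ≤ A ∧ H2norm (fun x => sol.u x 0) ≤ A ∧
  H2norm (fun x => sol.θ x 0) ≤ A ∧
  (∀ i, H2norm (fun x => sol.w i x 0) ≤ A) ∧
  (∀ i, H2norm (fun x => sol.b i x 0) ≤ A) ∧
  (∫ x in (0:ℝ)..1, sol.ρ x 0 * (|Real.log (sol.ρ x 0)| + |Real.log (sol.θ x 0)|)) ≤ B ∧
  M ≤ ∫ x in (0:ℝ)..1, sol.ρ x 0

/-- `G` is an upper bound for the `L²(0,1)` norms of the compatibility functions
`g₁ = (∂ₓ²u₀ − ∂ₓ(ρ₀θ₀ + |b₀|²/2))/√ρ₀`, `g₂ = (∂ₓ²w₀ − ∂ₓb₀)/√ρ₀`,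
`g₃ = (∂ₓ(κ(θ₀)∂ₓθ₀) + (∂ₓu₀)² + |∂ₓw₀|² + |∂ₓb₀|²)/√ρ₀`. -/
def CompatBounds {T : ℝ} {κ : ℝ → ℝ} (sol : MHDSol T κ) (G : ℝ) : Prop :=
  L2norm (fun x =>
      (pdx (pdx sol.u) x 0
        - pdx (fun x t => sol.ρ x t * sol.θ x t + (∑ i, (sol.b i x t) ^ 2) / 2) x 0)
      / Real.sqrt (sol.ρ x 0)) ≤ G ∧
  (∀ i, L2norm (fun x =>
      (pdx (pdx (sol.w i)) x 0 - pdx (sol.b i) x 0) / Real.sqrt (sol.ρ x 0)) ≤ G) ∧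
  L2norm (fun x =>
      (pdx (fun x t => κ (sol.θ x t) * pdx sol.θ x t) x 0
        + (pdx sol.u x 0) ^ 2 + (∑ i, (pdx (sol.w i) x 0) ^ 2)
        + (∑ i, (pdx (sol.b i) x 0) ^ 2))
      / Real.sqrt (sol.ρ x 0)) ≤ G


/-! ### Smooth functions of two variables -/

/-- Smooth functions on the plane. -/
def Sm (f : ℝ → ℝ → ℝ) : Prop := ContDiff ℝ (⊤ : ℕ∞) (Function.uncurry f)

theorem Sm.pdx_eq {f : ℝ → ℝ → ℝ} (hf : Sm f) (x t : ℝ) :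
    HasDerivAt (fun y => f y t) (fderiv ℝ (Function.uncurry f) (x, t) (1, 0)) x := by
  have h1 : HasFDerivAt (Function.uncurry f) (fderiv ℝ (Function.uncurry f) (x, t)) (x, t) :=
    (hf.differentiable (by simp) (x, t)).hasFDerivAt
  have h2 : HasDerivAt (fun y : ℝ => (y, t)) ((1 : ℝ), (0 : ℝ)) x :=
    (hasDerivAt_id x).prodMk (hasDerivAt_const x t)
  exact h1.comp_hasDerivAt x h2

theorem Sm.pdt_eq {f : ℝ → ℝ → ℝ} (hf : Sm f) (x t : ℝ) :
    HasDerivAt (fun s => f x s) (fderiv ℝ (Function.uncurry f) (x, t) (0, 1)) t := by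
  have h1 : HasFDerivAt (Function.uncurry f) (fderiv ℝ (Function.uncurry f) (x, t)) (x, t) :=
    (hf.differentiable (by simp) (x, t)).hasFDerivAt
  have h2 : HasDerivAt (fun s : ℝ => (x, s)) ((0 : ℝ), (1 : ℝ)) t :=
    (hasDerivAt_const t x).prodMk (hasDerivAt_id t)
  exact h1.comp_hasDerivAt t h2

theorem Sm.hx {f : ℝ → ℝ → ℝ} (hf : Sm f) (x t : ℝ) :
    HasDerivAt (fun y => f y t) (pdx f x t) x := by
  have := hf.pdx_eq x t
  unfold pdx
  rw [this.deriv]; exact this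

theorem Sm.ht {f : ℝ → ℝ → ℝ} (hf : Sm f) (x t : ℝ) :
    HasDerivAt (fun s => f x s) (pdt f x t) t := by
  have := hf.pdt_eq x t
  unfold pdt
  rw [this.deriv]; exact this

theorem Sm.pdx {f : ℝ → ℝ → ℝ} (hf : Sm f) : Sm (pdx f) := by
  have h : Function.uncurry (_root_.pdx f)
      = fun p => fderiv ℝ (Function.uncurry f) p (1, 0) := by
    ext ⟨x, t⟩
    exact (hf.pdx_eq x t).deriv
  unfold Sm
  rw [h]
  have h2 : ContDiff ℝ (⊤ : ℕ∞) (fderiv ℝ (Function.uncurry f)) :=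
    ContDiff.fderiv_right (m := (⊤ : ℕ∞)) hf (by simp)
  exact h2.clm_apply contDiff_const

theorem Sm.pdt {f : ℝ → ℝ → ℝ} (hf : Sm f) : Sm (pdt f) := by
  have h : Function.uncurry (_root_.pdt f)
      = fun p => fderiv ℝ (Function.uncurry f) p (0, 1) := by
    ext ⟨x, t⟩
    exact (hf.pdt_eq x t).deriv
  unfold Sm
  rw [h]
  have h2 : ContDiff ℝ (⊤ : ℕ∞) (fderiv ℝ (Function.uncurry f)) :=
    ContDiff.fderiv_right (m := (⊤ : ℕ∞)) hf (by simp)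
  exact h2.clm_apply contDiff_const

theorem Sm.comm {f : ℝ → ℝ → ℝ} (hf : Sm f) (x t : ℝ) :
    _root_.pdt (_root_.pdx f) x t = _root_.pdx (_root_.pdt f) x t := by
  set F := Function.uncurry f with hF
  have hx : _root_.pdx f = fun x t => fderiv ℝ F (x, t) (1, 0) := by
    ext x t; exact (hf.pdx_eq x t).deriv
  have ht : _root_.pdt f = fun x t => fderiv ℝ F (x, t) (0, 1) := by
    ext x t; exact (hf.pdt_eq x t).deriv
  have h2 : ContDiff ℝ (⊤ : ℕ∞) (fderiv ℝ F) :=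
    ContDiff.fderiv_right (m := (⊤ : ℕ∞)) hf (by simp)
  have h3 : HasFDerivAt (fderiv ℝ F) (fderiv ℝ (fderiv ℝ F) (x, t)) (x, t) :=
    (h2.differentiable (by simp) (x, t)).hasFDerivAt
  have hsym : IsSymmSndFDerivAt ℝ F (x, t) :=
    ContDiffAt.isSymmSndFDerivAt (n := (⊤ : ℕ∞)) (hf.contDiffAt) (by
      rw [minSmoothness_of_isRCLikeNormedField]
      exact WithTop.coe_le_coe.2 le_top)
  have e1 : HasDerivAt (fun s => fderiv ℝ F (x, s) (1, 0))
      (fderiv ℝ (fderiv ℝ F) (x, t) (0, 1) (1, 0)) t := by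
    have h4 : HasDerivAt (fun s : ℝ => (x, s)) ((0 : ℝ), (1 : ℝ)) t :=
      (hasDerivAt_const t x).prodMk (hasDerivAt_id t)
    have h5 := h3.comp_hasDerivAt t h4
    simpa using h5.clm_apply (hasDerivAt_const t ((1 : ℝ), (0 : ℝ)))
  have e2 : HasDerivAt (fun y => fderiv ℝ F (y, t) (0, 1))
      (fderiv ℝ (fderiv ℝ F) (x, t) (1, 0) (0, 1)) x := by
    have h4 : HasDerivAt (fun s : ℝ => (s, t)) ((1 : ℝ), (0 : ℝ)) x :=
      (hasDerivAt_id x).prodMk (hasDerivAt_const x t)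
    have h5 := h3.comp_hasDerivAt x h4
    simpa using h5.clm_apply (hasDerivAt_const x ((0 : ℝ), (1 : ℝ)))
  rw [hx, ht]
  change deriv (fun s => fderiv ℝ F (x, s) (1, 0)) t = deriv (fun y => fderiv ℝ F (y, t) (0, 1)) x
  rw [e1.deriv, e2.deriv]
  exact hsym (0, 1) (1, 0)

theorem Sm.cont {f : ℝ → ℝ → ℝ} (hf : Sm f) : Continuous (fun p : ℝ × ℝ => f p.1 p.2) :=
  hf.continuous

/-! ### Continuity on the rectangle and slices -/

/-- Continuity on `[0,1] × [0,T]`. -/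
def CQ (T : ℝ) (f : ℝ → ℝ → ℝ) : Prop :=
  ContinuousOn (fun p : ℝ × ℝ => f p.1 p.2) (Icc 0 1 ×ˢ Icc 0 T)

/-- Slice integral. -/
def SI (f : ℝ → ℝ → ℝ) (t : ℝ) : ℝ := ∫ x in (0:ℝ)..1, f x t

theorem Sm.cq {f : ℝ → ℝ → ℝ} (hf : Sm f) (T : ℝ) : CQ T f := hf.cont.continuousOn

section cqalg
variable {T : ℝ} {f g : ℝ → ℝ → ℝ}

theorem CQ.add (hf : CQ T f) (hg : CQ T g) : CQ T (fun x t => f x t + g x t) :=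
  ContinuousOn.add hf hg
theorem CQ.sub (hf : CQ T f) (hg : CQ T g) : CQ T (fun x t => f x t - g x t) :=
  ContinuousOn.sub hf hg
theorem CQ.mul (hf : CQ T f) (hg : CQ T g) : CQ T (fun x t => f x t * g x t) :=
  ContinuousOn.mul hf hg
theorem CQ.neg (hf : CQ T f) : CQ T (fun x t => - f x t) :=
  ContinuousOn.neg hf
theorem CQ.pow (hf : CQ T f) (n : ℕ) : CQ T (fun x t => f x t ^ n) :=
  ContinuousOn.pow hf n
theorem CQ.cst (T c : ℝ) : CQ T (fun _ _ => c) := continuousOn_const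
theorem CQ.divc (hf : CQ T f) (c : ℝ) : CQ T (fun x t => f x t / c) :=
  ContinuousOn.div_const hf c
theorem CQ.rpow (hf : CQ T f) (c : ℝ)
    (h : ∀ x ∈ Icc (0:ℝ) 1, ∀ t ∈ Icc (0:ℝ) T, 0 < f x t) : CQ T (fun x t => f x t ^ c) :=
  ContinuousOn.rpow_const hf (fun p hp => Or.inl (h p.1 hp.1 p.2 hp.2).ne')
theorem CQ.congr (hf : CQ T f) (h : ∀ x ∈ Icc (0:ℝ) 1, ∀ t ∈ Icc (0:ℝ) T, g x t = f x t) :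
    CQ T g := ContinuousOn.congr hf (fun p hp => h p.1 hp.1 p.2 hp.2)

theorem CQ.slice (hf : CQ T f) {t : ℝ} (ht : t ∈ Icc (0:ℝ) T) :
    ContinuousOn (fun x => f x t) (Icc 0 1) := by
  have : ContinuousOn (fun x : ℝ => (x, t)) (Icc 0 1) := by fun_prop
  exact ContinuousOn.comp hf this (fun x hx => ⟨hx, ht⟩)

theorem CQ.slicet (hf : CQ T f) {x : ℝ} (hx : x ∈ Icc (0:ℝ) 1) :
    ContinuousOn (fun t => f x t) (Icc 0 T) := by
  have : ContinuousOn (fun t : ℝ => (x, t)) (Icc 0 T) := by fun_prop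
  exact ContinuousOn.comp (g := fun p : ℝ × ℝ => f p.1 p.2) hf this (fun t ht => ⟨hx, ht⟩)

/-- Clamped extension. -/
def clampQ (T : ℝ) (f : ℝ → ℝ → ℝ) : ℝ → ℝ → ℝ :=
  fun x t => f (max 0 (min x 1)) (max 0 (min t T))

theorem clampQ_cont (hT : 0 ≤ T) (hf : CQ T f) :
    Continuous (fun p : ℝ × ℝ => clampQ T f p.1 p.2) := by
  have h : Continuous (fun p : ℝ × ℝ => ((max 0 (min p.1 1) : ℝ), (max 0 (min p.2 T) : ℝ))) := by
    fun_prop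
  exact ContinuousOn.comp_continuous hf h (fun p => by
    constructor
    · exact ⟨le_max_left _ _, max_le zero_le_one (min_le_right _ _)⟩
    · exact ⟨le_max_left _ _, max_le hT (min_le_right _ _)⟩)

theorem clampQ_eq {x t : ℝ} (hx : x ∈ Icc (0:ℝ) 1) (ht : t ∈ Icc (0:ℝ) T) :
    clampQ T f x t = f x t := by
  unfold clampQ
  rw [min_eq_left hx.2, max_eq_right hx.1, min_eq_left ht.2, max_eq_right ht.1]

theorem SI_congr {t : ℝ} (h : ∀ x ∈ Icc (0:ℝ) 1, f x t = g x t) : SI f t = SI g t := by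
  unfold SI
  apply intervalIntegral.integral_congr
  intro x hx
  rw [uIcc_of_le zero_le_one] at hx
  exact h x hx

theorem CQ.si_cont (hT : 0 ≤ T) (hf : CQ T f) : ContinuousOn (SI f) (Icc 0 T) := by
  have h := clampQ_cont hT hf
  have h2 : Continuous (fun t => ∫ x in (0:ℝ)..1, clampQ T f x t) := by
    apply intervalIntegral.continuous_parametric_intervalIntegral_of_continuous'
    exact h.comp continuous_swap
  refine h2.continuousOn.congr (fun t ht => ?_)
  exact SI_congr (f := f) (g := clampQ T f) (fun x hx => (clampQ_eq hx ht).symm)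

theorem CQ.ftc (hT : 0 ≤ T) {f' : ℝ → ℝ → ℝ} (hf : CQ T f) (hf' : CQ T f')
    (hd : ∀ x ∈ Icc (0:ℝ) 1, ∀ t ∈ Icc (0:ℝ) T, HasDerivAt (fun s => f x s) (f' x t) t)
    {t : ℝ} (ht : t ∈ Icc (0:ℝ) T) :
    SI f t = SI f 0 + ∫ s in (0:ℝ)..t, SI f' s := by
  have h := clampQ_cont hT hf'
  have h0 : (0:ℝ) ∈ Icc (0:ℝ) T := ⟨le_refl _, hT⟩
  have e1 : ∀ s ∈ Icc (0:ℝ) T, SI f' s = SI (clampQ T f') s := fun s hs =>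
    SI_congr (fun x hx => (clampQ_eq hx hs).symm)
  have e2 : (∫ s in (0:ℝ)..t, SI f' s) = ∫ s in (0:ℝ)..t, ∫ x in (0:ℝ)..1, clampQ T f' x s := by
    apply intervalIntegral.integral_congr
    intro s hs
    rw [uIcc_of_le ht.1] at hs
    exact e1 s ⟨hs.1, hs.2.trans ht.2⟩
  have e3 : (∫ s in (0:ℝ)..t, ∫ x in (0:ℝ)..1, clampQ T f' x s)
      = ∫ x in (0:ℝ)..1, ∫ s in (0:ℝ)..t, clampQ T f' x s := by
    apply intervalIntegral_intervalIntegral_swap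
    have hc : Continuous (Function.uncurry fun s x => clampQ T f' x s) := h.comp continuous_swap
    have : IntegrableOn (Function.uncurry fun s x => clampQ T f' x s) ((uIcc 0 t) ×ˢ (uIcc 0 1)) :=
      hc.continuousOn.integrableOn_compact (isCompact_uIcc.prod isCompact_uIcc)
    exact this.mono_set (prod_mono uIoc_subset_uIcc uIoc_subset_uIcc)
  have e4 : ∀ x ∈ Icc (0:ℝ) 1, (∫ s in (0:ℝ)..t, clampQ T f' x s) = f x t - f x 0 := by
    intro x hx
    rw [← intervalIntegral.integral_eq_sub_of_hasDerivAt (f := fun s => f x s) (f' := fun s => f' x s)]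
    · apply intervalIntegral.integral_congr
      intro s hs
      rw [uIcc_of_le ht.1] at hs
      exact clampQ_eq hx ⟨hs.1, hs.2.trans ht.2⟩
    · intro s hs
      rw [uIcc_of_le ht.1] at hs
      exact hd x hx s ⟨hs.1, hs.2.trans ht.2⟩
    · apply ContinuousOn.intervalIntegrable
      rw [uIcc_of_le ht.1]
      exact (hf'.slicet hx).mono (Icc_subset_Icc_right ht.2)
  have e5 : (∫ x in (0:ℝ)..1, ∫ s in (0:ℝ)..t, clampQ T f' x s)
      = ∫ x in (0:ℝ)..1, (f x t - f x 0) := by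
    apply intervalIntegral.integral_congr
    intro x hx
    rw [uIcc_of_le zero_le_one] at hx
    exact e4 x hx
  rw [e2, e3, e5, intervalIntegral.integral_sub]
  · unfold SI; ring
  · apply ContinuousOn.intervalIntegrable
    rw [uIcc_of_le zero_le_one]; exact hf.slice ht
  · apply ContinuousOn.intervalIntegrable
    rw [uIcc_of_le zero_le_one]; exact hf.slice h0

end cqalg

/-! ### Integrals over `[0,1]` -/

theorem ii01 {f : ℝ → ℝ} (hf : ContinuousOn f (Icc 0 1)) : IntervalIntegrable f volume 0 1 := by
  apply ContinuousOn.intervalIntegrable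
  rwa [uIcc_of_le zero_le_one]

theorem int_le {f g : ℝ → ℝ} (hf : ContinuousOn f (Icc 0 1)) (hg : ContinuousOn g (Icc 0 1))
    (h : ∀ x ∈ Icc (0:ℝ) 1, f x ≤ g x) : (∫ x in (0:ℝ)..1, f x) ≤ ∫ x in (0:ℝ)..1, g x :=
  intervalIntegral.integral_mono_on zero_le_one (ii01 hf) (ii01 hg) h

theorem int_nonneg {f : ℝ → ℝ} (h : ∀ x ∈ Icc (0:ℝ) 1, 0 ≤ f x) : 0 ≤ ∫ x in (0:ℝ)..1, f x :=
  intervalIntegral.integral_nonneg zero_le_one h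

theorem int_lin {n : ℕ} {f : ℝ → ℝ} (g : Fin n → ℝ → ℝ) (c : Fin n → ℝ) (c0 : ℝ)
    (hf : ContinuousOn f (Icc 0 1)) (hg : ∀ i, ContinuousOn (g i) (Icc 0 1))
    (h : ∀ x ∈ Icc (0:ℝ) 1, f x ≤ (∑ i, c i * g i x) + c0) :
    (∫ x in (0:ℝ)..1, f x) ≤ (∑ i, c i * ∫ x in (0:ℝ)..1, g i x) + c0 := by
  have hc : ContinuousOn (fun x => (∑ i, c i * g i x) + c0) (Icc 0 1) := by
    apply ContinuousOn.add _ continuousOn_const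
    apply continuousOn_finsetSum
    intro i _
    exact continuousOn_const.mul (hg i)
  refine (int_le hf hc h).trans (le_of_eq ?_)
  rw [intervalIntegral.integral_add, intervalIntegral.integral_finsetSum]
  · simp
  · intro i _
    exact (ii01 (hg i)).const_mul _
  · apply ii01
    apply continuousOn_finsetSum
    intro i _
    exact continuousOn_const.mul (hg i)
  · simp

theorem int_lin1 {f g1 : ℝ → ℝ} (c1 c0 : ℝ)
    (hf : ContinuousOn f (Icc 0 1)) (h1 : ContinuousOn g1 (Icc 0 1))
    (h : ∀ x ∈ Icc (0:ℝ) 1, f x ≤ c1 * g1 x + c0) :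
    (∫ x in (0:ℝ)..1, f x) ≤ c1 * (∫ x in (0:ℝ)..1, g1 x) + c0 := by
  have := int_lin ![g1] ![c1] c0 hf (by intro i; fin_cases i; simpa)
    (by simpa [Fin.sum_univ_succ] using h)
  simpa [Fin.sum_univ_succ] using this

theorem int_lin2 {f g1 g2 : ℝ → ℝ} (c1 c2 c0 : ℝ)
    (hf : ContinuousOn f (Icc 0 1)) (h1 : ContinuousOn g1 (Icc 0 1))
    (h2 : ContinuousOn g2 (Icc 0 1))
    (h : ∀ x ∈ Icc (0:ℝ) 1, f x ≤ c1 * g1 x + c2 * g2 x + c0) :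
    (∫ x in (0:ℝ)..1, f x) ≤ c1 * (∫ x in (0:ℝ)..1, g1 x) + c2 * (∫ x in (0:ℝ)..1, g2 x) + c0 := by
  have := int_lin ![g1, g2] ![c1, c2] c0 hf (by intro i; fin_cases i <;> simpa)
    (by simpa [Fin.sum_univ_succ, add_assoc] using h)
  simpa [Fin.sum_univ_succ, add_assoc] using this

theorem int_lin3 {f g1 g2 g3 : ℝ → ℝ} (c1 c2 c3 c0 : ℝ)
    (hf : ContinuousOn f (Icc 0 1)) (h1 : ContinuousOn g1 (Icc 0 1))
    (h2 : ContinuousOn g2 (Icc 0 1)) (h3 : ContinuousOn g3 (Icc 0 1))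
    (h : ∀ x ∈ Icc (0:ℝ) 1, f x ≤ c1 * g1 x + c2 * g2 x + c3 * g3 x + c0) :
    (∫ x in (0:ℝ)..1, f x) ≤ c1 * (∫ x in (0:ℝ)..1, g1 x) + c2 * (∫ x in (0:ℝ)..1, g2 x)
      + c3 * (∫ x in (0:ℝ)..1, g3 x) + c0 := by
  have := int_lin ![g1, g2, g3] ![c1, c2, c3] c0 hf (by intro i; fin_cases i <;> simpa)
    (by simpa [Fin.sum_univ_succ, add_assoc] using h)
  simpa [Fin.sum_univ_succ, add_assoc] using this

theorem int_lin5 {f g1 g2 g3 g4 g5 : ℝ → ℝ} (c1 c2 c3 c4 c5 c0 : ℝ)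
    (hf : ContinuousOn f (Icc 0 1)) (h1 : ContinuousOn g1 (Icc 0 1))
    (h2 : ContinuousOn g2 (Icc 0 1)) (h3 : ContinuousOn g3 (Icc 0 1))
    (h4 : ContinuousOn g4 (Icc 0 1)) (h5 : ContinuousOn g5 (Icc 0 1))
    (h : ∀ x ∈ Icc (0:ℝ) 1, f x ≤ c1 * g1 x + c2 * g2 x + c3 * g3 x + c4 * g4 x + c5 * g5 x + c0) :
    (∫ x in (0:ℝ)..1, f x) ≤ c1 * (∫ x in (0:ℝ)..1, g1 x) + c2 * (∫ x in (0:ℝ)..1, g2 x)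
      + c3 * (∫ x in (0:ℝ)..1, g3 x) + c4 * (∫ x in (0:ℝ)..1, g4 x)
      + c5 * (∫ x in (0:ℝ)..1, g5 x) + c0 := by
  have := int_lin ![g1, g2, g3, g4, g5] ![c1, c2, c3, c4, c5] c0 hf
    (by intro i; fin_cases i <;> simpa)
    (by simpa [Fin.sum_univ_succ, add_assoc] using h)
  simpa [Fin.sum_univ_succ, add_assoc] using this

theorem int_lin7 {f g1 g2 g3 g4 g5 g6 g7 : ℝ → ℝ} (c1 c2 c3 c4 c5 c6 c7 c0 : ℝ)
    (hf : ContinuousOn f (Icc 0 1)) (h1 : ContinuousOn g1 (Icc 0 1))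
    (h2 : ContinuousOn g2 (Icc 0 1)) (h3 : ContinuousOn g3 (Icc 0 1))
    (h4 : ContinuousOn g4 (Icc 0 1)) (h5 : ContinuousOn g5 (Icc 0 1))
    (h6 : ContinuousOn g6 (Icc 0 1)) (h7 : ContinuousOn g7 (Icc 0 1))
    (h : ∀ x ∈ Icc (0:ℝ) 1, f x ≤ c1 * g1 x + c2 * g2 x + c3 * g3 x + c4 * g4 x + c5 * g5 x
      + c6 * g6 x + c7 * g7 x + c0) :
    (∫ x in (0:ℝ)..1, f x) ≤ c1 * (∫ x in (0:ℝ)..1, g1 x) + c2 * (∫ x in (0:ℝ)..1, g2 x)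
      + c3 * (∫ x in (0:ℝ)..1, g3 x) + c4 * (∫ x in (0:ℝ)..1, g4 x)
      + c5 * (∫ x in (0:ℝ)..1, g5 x) + c6 * (∫ x in (0:ℝ)..1, g6 x)
      + c7 * (∫ x in (0:ℝ)..1, g7 x) + c0 := by
  have := int_lin ![g1, g2, g3, g4, g5, g6, g7] ![c1, c2, c3, c4, c5, c6, c7] c0 hf
    (by intro i; fin_cases i <;> simpa)
    (by simpa [Fin.sum_univ_succ, add_assoc] using h)
  simpa [Fin.sum_univ_succ, add_assoc] using this

theorem int_flux {G G' : ℝ → ℝ} (hG' : ContinuousOn G' (Icc 0 1))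
    (hd : ∀ x ∈ Icc (0:ℝ) 1, HasDerivAt G (G' x) x) (h0 : G 0 = 0) (h1 : G 1 = 0) :
    (∫ x in (0:ℝ)..1, G' x) = 0 := by
  rw [intervalIntegral.integral_eq_sub_of_hasDerivAt (f := G), h0, h1, sub_zero]
  · intro x hx
    rw [uIcc_of_le zero_le_one] at hx
    exact hd x hx
  · exact ii01 hG'

/-- Cauchy-Schwarz against the constant `1`. -/
theorem int_sq_le {f : ℝ → ℝ} (hf : ContinuousOn f (Icc 0 1)) :
    (∫ x in (0:ℝ)..1, f x) ^ 2 ≤ ∫ x in (0:ℝ)..1, f x ^ 2 := by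
  set m := ∫ x in (0:ℝ)..1, f x with hm
  have h := int_lin1 (f := f) (g1 := fun x => f x ^ 2) 1 1 hf (hf.pow 2)
    (fun x _ => by nlinarith [sq_nonneg (f x - 1)])
  have h2 := int_lin2 (f := fun _ => (0:ℝ)) (g1 := fun x => f x ^ 2) (g2 := f) 1 (-2 * m) (m ^ 2)
    continuousOn_const (hf.pow 2) hf (fun x _ => by nlinarith [sq_nonneg (f x - m)])
  simp only [intervalIntegral.integral_zero] at h2
  rw [← hm] at h2
  nlinarith

theorem sob_sub {f f' : ℝ → ℝ} (hf' : ContinuousOn f' (Icc 0 1))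
    (hd : ∀ x ∈ Icc (0:ℝ) 1, HasDerivAt f (f' x) x) {x y : ℝ} (hx : x ∈ Icc (0:ℝ) 1)
    (hy : y ∈ Icc (0:ℝ) 1) : (f x - f y) ^ 2 ≤ ∫ x in (0:ℝ)..1, f' x ^ 2 := by
  wlog hxy : y ≤ x generalizing x y
  · have := this hy hx (le_of_not_ge hxy)
    nlinarith
  have e : f x - f y = ∫ z in y..x, f' z := by
    rw [intervalIntegral.integral_eq_sub_of_hasDerivAt (f := f)]
    · intro z hz
      rw [uIcc_of_le hxy] at hz
      exact hd z ⟨hy.1.trans hz.1, hz.2.trans hx.2⟩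
    · apply ContinuousOn.intervalIntegrable
      rw [uIcc_of_le hxy]
      exact hf'.mono (Icc_subset_Icc hy.1 hx.2)
  have h1 : |f x - f y| ≤ ∫ z in (0:ℝ)..1, |f' z| := by
    rw [e]
    refine (intervalIntegral.abs_integral_le_integral_abs hxy).trans ?_
    apply intervalIntegral.integral_mono_interval hy.1 hxy hx.2
    · exact Filter.Eventually.of_forall (fun z => abs_nonneg _)
    · exact ii01 hf'.abs
  have h2 := int_sq_le (f := fun x => |f' x|) hf'.abs
  simp only [sq_abs] at h2
  calc (f x - f y) ^ 2 = |f x - f y| ^ 2 := (sq_abs _).symm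
    _ ≤ (∫ z in (0:ℝ)..1, |f' z|) ^ 2 := by gcongr
    _ ≤ _ := h2

theorem exists_le_int {f : ℝ → ℝ} (hf : ContinuousOn f (Icc 0 1)) :
    ∃ y ∈ Icc (0:ℝ) 1, f y ≤ ∫ x in (0:ℝ)..1, f x := by
  obtain ⟨y, hy, hmin⟩ := isCompact_Icc.exists_isMinOn (nonempty_Icc.2 zero_le_one) hf
  refine ⟨y, hy, ?_⟩
  have := int_le (f := fun _ => f y) continuousOn_const hf (fun x hx => hmin hx)
  simpa using this

theorem sob {f f' : ℝ → ℝ} (hf' : ContinuousOn f' (Icc 0 1))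
    (hd : ∀ x ∈ Icc (0:ℝ) 1, HasDerivAt f (f' x) x) {x : ℝ} (hx : x ∈ Icc (0:ℝ) 1) :
    f x ^ 2 ≤ 2 * (∫ x in (0:ℝ)..1, f x ^ 2) + 2 * ∫ x in (0:ℝ)..1, f' x ^ 2 := by
  have hf : ContinuousOn f (Icc 0 1) := fun x hx => (hd x hx).continuousAt.continuousWithinAt
  obtain ⟨y, hy, h⟩ := exists_le_int (f := fun x => f x ^ 2) (hf.pow 2)
  have := sob_sub hf' hd hx hy
  nlinarith [sq_nonneg (f x - 2 * f y)]

theorem sob0 {f f' : ℝ → ℝ} (hf' : ContinuousOn f' (Icc 0 1))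
    (hd : ∀ x ∈ Icc (0:ℝ) 1, HasDerivAt f (f' x) x) (h0 : f 0 = 0) {x : ℝ}
    (hx : x ∈ Icc (0:ℝ) 1) :
    f x ^ 2 ≤ ∫ x in (0:ℝ)..1, f' x ^ 2 := by
  have := sob_sub hf' hd hx (y := 0) (by simp)
  rwa [h0, sub_zero] at this


/-! ### Gronwall and the maximum principle -/

theorem iit {T : ℝ} (_hT : 0 ≤ T) {f : ℝ → ℝ} (hf : ContinuousOn f (Icc 0 T)) {t : ℝ}
    (ht : t ∈ Icc (0:ℝ) T) : IntervalIntegrable f volume 0 t := by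
  apply ContinuousOn.intervalIntegrable
  rw [uIcc_of_le ht.1]
  exact hf.mono (Icc_subset_Icc_right ht.2)

theorem prim_cont {T : ℝ} (hT : 0 ≤ T) {f : ℝ → ℝ} (hf : ContinuousOn f (Icc 0 T)) :
    ContinuousOn (fun t => ∫ s in (0:ℝ)..t, f s) (Icc 0 T) := by
  rw [← uIcc_of_le hT] at hf ⊢
  apply intervalIntegral.continuousOn_primitive_interval
  rw [uIcc_of_le hT] at hf ⊢
  exact hf.integrableOn_compact isCompact_Icc

theorem prim_deriv {T : ℝ} (hT : 0 ≤ T) {f : ℝ → ℝ} (hf : ContinuousOn f (Icc 0 T)) {t : ℝ}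
    (ht : t ∈ Ioo (0:ℝ) T) : HasDerivAt (fun t => ∫ s in (0:ℝ)..t, f s) (f t) t := by
  have hn : Icc 0 T ∈ nhds t := Icc_mem_nhds ht.1 ht.2
  apply intervalIntegral.integral_hasDerivAt_right (iit hT hf ⟨ht.1.le, ht.2.le⟩)
  · exact hf.stronglyMeasurableAtFilter_nhdsWithin measurableSet_Icc t |>.filter_mono (by
      rw [nhdsWithin_eq_nhds.2 hn])
  · exact hf.continuousAt hn

theorem prim_mono {T : ℝ} (hT : 0 ≤ T) {f : ℝ → ℝ} (hf : ContinuousOn f (Icc 0 T))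
    (h0 : ∀ t ∈ Icc (0:ℝ) T, 0 ≤ f t) {t : ℝ} (ht : t ∈ Icc (0:ℝ) T) :
    (0 ≤ ∫ s in (0:ℝ)..t, f s) ∧ (∫ s in (0:ℝ)..t, f s) ≤ ∫ s in (0:ℝ)..T, f s := by
  have hTT : T ∈ Icc (0:ℝ) T := ⟨hT, le_rfl⟩
  have h1 : IntervalIntegrable f volume t T := by
    apply ContinuousOn.intervalIntegrable
    rw [uIcc_of_le ht.2]
    exact hf.mono (Icc_subset_Icc_left ht.1)
  constructor
  · exact intervalIntegral.integral_nonneg ht.1 (fun s hs => h0 s ⟨hs.1, hs.2.trans ht.2⟩)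
  · rw [← intervalIntegral.integral_add_adjacent_intervals (iit hT hf ht) h1]
    have := intervalIntegral.integral_nonneg (μ := volume) ht.2
      (fun s hs => h0 s ⟨ht.1.trans hs.1, hs.2⟩)
    linarith

theorem gronwall {T : ℝ} (hT : 0 < T) {y y' g h d : ℝ → ℝ} {K Y0 Γ H : ℝ}
    (hy' : ContinuousOn y' (Icc 0 T))
    (hy : ∀ t ∈ Icc (0:ℝ) T, y t = y 0 + ∫ s in (0:ℝ)..t, y' s)
    (hg : ContinuousOn g (Icc 0 T)) (hh : ContinuousOn h (Icc 0 T))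
    (hd : ContinuousOn d (Icc 0 T))
    (g0 : ∀ t ∈ Icc (0:ℝ) T, 0 ≤ g t) (h0 : ∀ t ∈ Icc (0:ℝ) T, 0 ≤ h t)
    (d0 : ∀ t ∈ Icc (0:ℝ) T, 0 ≤ d t)
    (hK : ∀ t ∈ Icc (0:ℝ) T, 0 ≤ y t + K)
    (hin : ∀ t ∈ Icc (0:ℝ) T, y' t + d t ≤ g t * (y t + K) + h t)
    (hY0 : y 0 + K ≤ Y0) (hΓ : (∫ s in (0:ℝ)..T, g s) ≤ Γ) (hH : (∫ s in (0:ℝ)..T, h s) ≤ H) :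
    (∀ t ∈ Icc (0:ℝ) T, y t + K ≤ (Y0 + H) * exp Γ) ∧
    (∫ s in (0:ℝ)..T, d s) ≤ Y0 + H + Γ * ((Y0 + H) * exp Γ) := by
  have hT0 := hT.le
  have hTT : T ∈ Icc (0:ℝ) T := ⟨hT0, le_rfl⟩
  have h00 : (0:ℝ) ∈ Icc (0:ℝ) T := ⟨le_rfl, hT0⟩
  have ycont : ContinuousOn y (Icc 0 T) := by
    refine ContinuousOn.congr (continuousOn_const.add (prim_cont hT0 hy')) hy
  set P : ℝ → ℝ := fun t => ∫ s in (0:ℝ)..t, g s with hP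
  set S : ℝ → ℝ := fun t => ∫ s in (0:ℝ)..t, h s with hS
  have P0 : ∀ t ∈ Icc (0:ℝ) T, 0 ≤ P t ∧ P t ≤ Γ := fun t ht =>
    ⟨(prim_mono hT0 hg g0 ht).1, (prim_mono hT0 hg g0 ht).2.trans hΓ⟩
  have S0 : ∀ t ∈ Icc (0:ℝ) T, 0 ≤ S t ∧ S t ≤ H := fun t ht =>
    ⟨(prim_mono hT0 hh h0 ht).1, (prim_mono hT0 hh h0 ht).2.trans hH⟩
  have yder : ∀ t ∈ Ioo (0:ℝ) T, HasDerivAt y (y' t) t := by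
    intro t ht
    have h1 := (prim_deriv hT0 hy' ht).const_add (y 0)
    refine h1.congr_of_eventuallyEq ?_
    filter_upwards [Icc_mem_nhds ht.1 ht.2] with s hs using hy s hs
  set z : ℝ → ℝ := fun t => (y t + K) * exp (-(P t)) - S t with hz
  have zanti : AntitoneOn z (Icc 0 T) := by
    have zd : ∀ t ∈ Ioo (0:ℝ) T, HasDerivAt z
        (y' t * exp (-(P t)) + (y t + K) * (exp (-(P t)) * (-(g t))) - h t) t := by
      intro t ht
      exact (((yder t ht).add_const K).mul ((prim_deriv hT0 hg ht).neg.exp)).sub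
        (prim_deriv hT0 hh ht)
    apply antitoneOn_of_deriv_nonpos (convex_Icc 0 T)
    · exact ((ycont.add continuousOn_const).mul
        (Real.continuous_exp.comp_continuousOn (prim_cont hT0 hg).neg)).sub (prim_cont hT0 hh)
    · rw [interior_Icc]
      exact fun t ht => (zd t ht).differentiableAt.differentiableWithinAt
    · rw [interior_Icc]
      intro t ht
      rw [(zd t ht).deriv]
      have ht' : t ∈ Icc (0:ℝ) T := ⟨ht.1.le, ht.2.le⟩
      have e1 : exp (-(P t)) ≤ 1 := by
        rw [Real.exp_le_one_iff]; linarith [(P0 t ht').1]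
      have e2 := exp_pos (-(P t))
      have e3 := hin t ht'
      have e4 := d0 t ht'
      have e5 := h0 t ht'
      have e6 : (y' t - g t * (y t + K)) * exp (-(P t)) ≤ h t * exp (-(P t)) := by
        apply mul_le_mul_of_nonneg_right _ e2.le
        linarith
      have e7 : h t * exp (-(P t)) ≤ h t := mul_le_of_le_one_right e5 e1
      linarith
  have main : ∀ t ∈ Icc (0:ℝ) T, y t + K ≤ (Y0 + H) * exp Γ := by
    intro t ht
    have h1 := zanti h00 ht ht.1
    have hz0 : z 0 = y 0 + K := by simp [hz, hP, hS]
    rw [hz0] at h1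
    have h2 : (y t + K) * exp (-(P t)) ≤ Y0 + H := by
      have := (S0 t ht).2
      simp only [hz] at h1
      linarith
    have h3 : y t + K = ((y t + K) * exp (-(P t))) * exp (P t) := by
      rw [mul_assoc, ← Real.exp_add]; simp
    have h4 : 0 ≤ Y0 + H := by
      have := (S0 t ht)
      have := hK 0 h00
      linarith
    rw [h3]
    calc _ ≤ (Y0 + H) * exp (P t) := by gcongr
      _ ≤ _ := by
        have := (P0 t ht).2
        gcongr
  refine ⟨main, ?_⟩
  have h1 : (∫ s in (0:ℝ)..T, d s) ≤ ∫ s in (0:ℝ)..T, (g s * ((Y0 + H) * exp Γ) + h s - y' s) := by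
    apply intervalIntegral.integral_mono_on hT0 (iit hT0 hd hTT)
    · exact iit hT0 (((hg.mul continuousOn_const).add hh).sub hy') hTT
    · intro s hs
      have e1 := hin s hs
      have e2 := mul_le_mul_of_nonneg_left (main s hs) (g0 s hs)
      linarith
  rw [intervalIntegral.integral_sub, intervalIntegral.integral_add,
    intervalIntegral.integral_mul_const] at h1
  · have e1 := hy T hTT
    have e2 := hK T hTT
    have e3 : 0 ≤ (Y0 + H) * exp Γ := (hK 0 h00).trans (main 0 h00)
    have e4 := mul_le_mul_of_nonneg_right hΓ e3
    linarith
  · exact iit hT0 (hg.mul continuousOn_const) hTT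
  · exact iit hT0 hh hTT
  · exact iit hT0 ((hg.mul continuousOn_const).add hh) hTT
  · exact iit hT0 hy' hTT

theorem max_principle {T : ℝ} (hT : 0 < T) {Z Zt Zx u : ℝ → ℝ → ℝ} {K Z0 : ℝ} (hZ : CQ T Z)
    (hZt : ∀ x ∈ Icc (0:ℝ) 1, ∀ t ∈ Icc (0:ℝ) T, HasDerivAt (fun s => Z x s) (Zt x t) t)
    (hZx : ∀ x ∈ Icc (0:ℝ) 1, ∀ t ∈ Icc (0:ℝ) T, HasDerivAt (fun y => Z y t) (Zx x t) x)
    (hu : ∀ t ∈ Icc (0:ℝ) T, u 0 t = 0 ∧ u 1 t = 0)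
    (hin : ∀ x ∈ Icc (0:ℝ) 1, ∀ t ∈ Icc (0:ℝ) T, Zt x t + u x t * Zx x t ≤ K) (hK : 0 ≤ K)
    (h0 : ∀ x ∈ Icc (0:ℝ) 1, Z x 0 ≤ Z0) :
    ∀ x ∈ Icc (0:ℝ) 1, ∀ t ∈ Icc (0:ℝ) T, Z x t ≤ Z0 + (K + 1) * T := by
  have hH : ContinuousOn (fun p : ℝ × ℝ => Z p.1 p.2 - (K + 1) * p.2) (Icc 0 1 ×ˢ Icc 0 T) :=
    ContinuousOn.sub hZ (by fun_prop)
  obtain ⟨⟨a, r⟩, ⟨ha, hr⟩, hmax⟩ := (isCompact_Icc.prod isCompact_Icc).exists_isMaxOn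
    ((nonempty_Icc.2 zero_le_one).prod (nonempty_Icc.2 hT.le)) hH
  simp only at ha hr
  have hm : ∀ x ∈ Icc (0:ℝ) 1, ∀ t ∈ Icc (0:ℝ) T,
      Z x t - (K + 1) * t ≤ Z a r - (K + 1) * r := fun x hx t ht => by
    have hp : ((x, t) : ℝ × ℝ) ∈ (Icc (0:ℝ) 1) ×ˢ (Icc (0:ℝ) T) := ⟨hx, ht⟩
    exact hmax hp
  have hr0 : r = 0 := by
    by_contra hne
    have hrpos : 0 < r := lt_of_le_of_ne hr.1 (Ne.symm hne)
    -- time derivative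
    have ht1 : K + 1 ≤ Zt a r := by
      have hd := hZt a ha r hr
      have hd2 : HasDerivAt (fun s => Z a s - (K + 1) * s) (Zt a r - (K + 1) * 1) r :=
        hd.sub ((hasDerivAt_id r).const_mul (K + 1))
      have hd3 := hd2.hasDerivWithinAt (s := Iio r)
      rw [hasDerivWithinAt_iff_tendsto_slope' (by simp)] at hd3
      have : 0 ≤ Zt a r - (K + 1) * 1 := by
        refine ge_of_tendsto hd3 ?_
        have : Ioo 0 r ∈ nhdsWithin r (Iio r) := Ioo_mem_nhdsLT hrpos
        filter_upwards [this] with s hs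
        rw [slope_def_field]
        have := hm a ha s ⟨hs.1.le, hs.2.le.trans hr.2⟩
        apply div_nonneg_of_nonpos <;> linarith [hs.2]
      linarith
    have hx1 : u a r * Zx a r = 0 := by
      rcases eq_or_lt_of_le ha.1 with h | h
      · rw [← h, (hu r hr).1, zero_mul]
      rcases eq_or_lt_of_le ha.2 with h' | h'
      · rw [h', (hu r hr).2, zero_mul]
      have : IsLocalMax (fun y => Z y r) a := by
        filter_upwards [Icc_mem_nhds h h'] with y hy
        have := hm y hy r hr
        linarith
      rw [this.hasDerivAt_eq_zero (hZx a ha r hr), mul_zero]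
    have := hin a ha r hr
    linarith
  intro x hx t ht
  have h1 := hm x hx t ht
  rw [hr0] at h1
  have h2 := h0 a ha
  have h3 : (K + 1) * t ≤ (K + 1) * T := by
    have := ht.2
    gcongr
  linarith


/-! ### Basic facts on solutions -/

theorem hd_sq {f : ℝ → ℝ} {f' x : ℝ} (h : HasDerivAt f f' x) :
    HasDerivAt (fun y => f y ^ 2) (2 * f x * f') x := by
  simpa using h.fun_pow 2

section solfacts
variable {T : ℝ} {κ : ℝ → ℝ} {α : Type*} [TopologicalSpace α]

theorem MHDSol.sm_ρ (s : MHDSol T κ) : Sm s.ρ := s.smooth_ρ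
theorem MHDSol.sm_u (s : MHDSol T κ) : Sm s.u := s.smooth_u
theorem MHDSol.sm_θ (s : MHDSol T κ) : Sm s.θ := s.smooth_θ
theorem MHDSol.sm_w (s : MHDSol T κ) (i : Fin 2) : Sm (s.w i) := s.smooth_w i
theorem MHDSol.sm_b (s : MHDSol T κ) (i : Fin 2) : Sm (s.b i) := s.smooth_b i

@[fun_prop] theorem MHDSol.c_ρ (s : MHDSol T κ) {f g : α → ℝ} (hf : Continuous f)
    (hg : Continuous g) : Continuous (fun a => s.ρ (f a) (g a)) :=
  (Sm.cont s.sm_ρ).comp (hf.prodMk hg)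

@[fun_prop] theorem MHDSol.c_ρx (s : MHDSol T κ) {f g : α → ℝ} (hf : Continuous f)
    (hg : Continuous g) : Continuous (fun a => pdx s.ρ (f a) (g a)) :=
  (Sm.cont s.sm_ρ.pdx).comp (hf.prodMk hg)

@[fun_prop] theorem MHDSol.c_ρt (s : MHDSol T κ) {f g : α → ℝ} (hf : Continuous f)
    (hg : Continuous g) : Continuous (fun a => pdt s.ρ (f a) (g a)) :=
  (Sm.cont s.sm_ρ.pdt).comp (hf.prodMk hg)

@[fun_prop] theorem MHDSol.c_u (s : MHDSol T κ) {f g : α → ℝ} (hf : Continuous f)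
    (hg : Continuous g) : Continuous (fun a => s.u (f a) (g a)) :=
  (Sm.cont s.sm_u).comp (hf.prodMk hg)

@[fun_prop] theorem MHDSol.c_ux (s : MHDSol T κ) {f g : α → ℝ} (hf : Continuous f)
    (hg : Continuous g) : Continuous (fun a => pdx s.u (f a) (g a)) :=
  (Sm.cont s.sm_u.pdx).comp (hf.prodMk hg)

@[fun_prop] theorem MHDSol.c_ut (s : MHDSol T κ) {f g : α → ℝ} (hf : Continuous f)
    (hg : Continuous g) : Continuous (fun a => pdt s.u (f a) (g a)) :=
  (Sm.cont s.sm_u.pdt).comp (hf.prodMk hg)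

@[fun_prop] theorem MHDSol.c_uxx (s : MHDSol T κ) {f g : α → ℝ} (hf : Continuous f)
    (hg : Continuous g) : Continuous (fun a => pdx (pdx s.u) (f a) (g a)) :=
  (Sm.cont s.sm_u.pdx.pdx).comp (hf.prodMk hg)

@[fun_prop] theorem MHDSol.c_uxt (s : MHDSol T κ) {f g : α → ℝ} (hf : Continuous f)
    (hg : Continuous g) : Continuous (fun a => pdt (pdx s.u) (f a) (g a)) :=
  (Sm.cont s.sm_u.pdx.pdt).comp (hf.prodMk hg)

@[fun_prop] theorem MHDSol.c_θ (s : MHDSol T κ) {f g : α → ℝ} (hf : Continuous f)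
    (hg : Continuous g) : Continuous (fun a => s.θ (f a) (g a)) :=
  (Sm.cont s.sm_θ).comp (hf.prodMk hg)

@[fun_prop] theorem MHDSol.c_θx (s : MHDSol T κ) {f g : α → ℝ} (hf : Continuous f)
    (hg : Continuous g) : Continuous (fun a => pdx s.θ (f a) (g a)) :=
  (Sm.cont s.sm_θ.pdx).comp (hf.prodMk hg)

@[fun_prop] theorem MHDSol.c_θt (s : MHDSol T κ) {f g : α → ℝ} (hf : Continuous f)
    (hg : Continuous g) : Continuous (fun a => pdt s.θ (f a) (g a)) :=
  (Sm.cont s.sm_θ.pdt).comp (hf.prodMk hg)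

@[fun_prop] theorem MHDSol.c_w (s : MHDSol T κ) (i : Fin 2) {f g : α → ℝ} (hf : Continuous f)
    (hg : Continuous g) : Continuous (fun a => s.w i (f a) (g a)) :=
  (Sm.cont (s.sm_w i)).comp (hf.prodMk hg)

@[fun_prop] theorem MHDSol.c_wx (s : MHDSol T κ) (i : Fin 2) {f g : α → ℝ} (hf : Continuous f)
    (hg : Continuous g) : Continuous (fun a => pdx (s.w i) (f a) (g a)) :=
  (Sm.cont (s.sm_w i).pdx).comp (hf.prodMk hg)

@[fun_prop] theorem MHDSol.c_wt (s : MHDSol T κ) (i : Fin 2) {f g : α → ℝ} (hf : Continuous f)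
    (hg : Continuous g) : Continuous (fun a => pdt (s.w i) (f a) (g a)) :=
  (Sm.cont (s.sm_w i).pdt).comp (hf.prodMk hg)

@[fun_prop] theorem MHDSol.c_wxx (s : MHDSol T κ) (i : Fin 2) {f g : α → ℝ} (hf : Continuous f)
    (hg : Continuous g) : Continuous (fun a => pdx (pdx (s.w i)) (f a) (g a)) :=
  (Sm.cont (s.sm_w i).pdx.pdx).comp (hf.prodMk hg)

@[fun_prop] theorem MHDSol.c_wxt (s : MHDSol T κ) (i : Fin 2) {f g : α → ℝ} (hf : Continuous f)
    (hg : Continuous g) : Continuous (fun a => pdt (pdx (s.w i)) (f a) (g a)) :=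
  (Sm.cont (s.sm_w i).pdx.pdt).comp (hf.prodMk hg)

@[fun_prop] theorem MHDSol.c_b (s : MHDSol T κ) (i : Fin 2) {f g : α → ℝ} (hf : Continuous f)
    (hg : Continuous g) : Continuous (fun a => s.b i (f a) (g a)) :=
  (Sm.cont (s.sm_b i)).comp (hf.prodMk hg)

@[fun_prop] theorem MHDSol.c_bx (s : MHDSol T κ) (i : Fin 2) {f g : α → ℝ} (hf : Continuous f)
    (hg : Continuous g) : Continuous (fun a => pdx (s.b i) (f a) (g a)) :=
  (Sm.cont (s.sm_b i).pdx).comp (hf.prodMk hg)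

@[fun_prop] theorem MHDSol.c_bt (s : MHDSol T κ) (i : Fin 2) {f g : α → ℝ} (hf : Continuous f)
    (hg : Continuous g) : Continuous (fun a => pdt (s.b i) (f a) (g a)) :=
  (Sm.cont (s.sm_b i).pdt).comp (hf.prodMk hg)

@[fun_prop] theorem MHDSol.c_bxx (s : MHDSol T κ) (i : Fin 2) {f g : α → ℝ} (hf : Continuous f)
    (hg : Continuous g) : Continuous (fun a => pdx (pdx (s.b i)) (f a) (g a)) :=
  (Sm.cont (s.sm_b i).pdx.pdx).comp (hf.prodMk hg)

@[fun_prop] theorem MHDSol.c_bxt (s : MHDSol T κ) (i : Fin 2) {f g : α → ℝ} (hf : Continuous f)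
    (hg : Continuous g) : Continuous (fun a => pdt (pdx (s.b i)) (f a) (g a)) :=
  (Sm.cont (s.sm_b i).pdx.pdt).comp (hf.prodMk hg)

theorem bdry_t {f : ℝ → ℝ → ℝ} (hf : Sm f) (hT : 0 < T) {a : ℝ}
    (h : ∀ t ∈ Icc (0:ℝ) T, f a t = 0) : ∀ t ∈ Icc (0:ℝ) T, pdt f a t = 0 := by
  intro t ht
  have h1 := (hf.ht a t).hasDerivWithinAt (s := Icc 0 T)
  have h2 : HasDerivWithinAt (fun s => f a s) 0 (Icc 0 T) t :=
    (hasDerivWithinAt_const t (Icc 0 T) (0:ℝ)).congr (fun s hs => h s hs) (h t ht)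
  exact ((uniqueDiffOn_Icc hT) t ht).eq_deriv _ h1 h2

/-- Heat flux. -/
def MHDSol.J (s : MHDSol T κ) (x t : ℝ) : ℝ := κ (s.θ x t) * pdx s.θ x t

/-- Dissipation. -/
def MHDSol.Q (s : MHDSol T κ) (x t : ℝ) : ℝ :=
  pdx s.u x t ^ 2 + (pdx (s.w 0) x t ^ 2 + pdx (s.w 1) x t ^ 2)
    + (pdx (s.b 0) x t ^ 2 + pdx (s.b 1) x t ^ 2)

/-- Derivative of the heat flux, through the equation. -/
def MHDSol.Jx (s : MHDSol T κ) (x t : ℝ) : ℝ :=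
  s.ρ x t * (pdt s.θ x t + s.u x t * pdx s.θ x t) - s.Q x t + s.ρ x t * s.θ x t * pdx s.u x t

theorem MHDSol.e_ρ (s : MHDSol T κ) {x t : ℝ} (hx : x ∈ Icc (0:ℝ) 1) (ht : t ∈ Icc (0:ℝ) T) :
    pdt s.ρ x t + (pdx s.ρ x t * s.u x t + s.ρ x t * pdx s.u x t) = 0 := by
  have h := s.eq_mass x hx t ht
  have e : pdx (fun x t => s.ρ x t * s.u x t) x t
      = pdx s.ρ x t * s.u x t + s.ρ x t * pdx s.u x t :=
    ((s.sm_ρ.hx x t).mul (s.sm_u.hx x t)).deriv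
  rwa [e] at h

theorem MHDSol.e_u (s : MHDSol T κ) {x t : ℝ} (hx : x ∈ Icc (0:ℝ) 1) (ht : t ∈ Icc (0:ℝ) T) :
    s.ρ x t * (pdt s.u x t + s.u x t * pdx s.u x t)
      + (pdx s.ρ x t * s.θ x t + s.ρ x t * pdx s.θ x t)
      + (s.b 0 x t * pdx (s.b 0) x t + s.b 1 x t * pdx (s.b 1) x t) = pdx (pdx s.u) x t := by
  have h := s.eq_mom x hx t ht
  have h0 := s.e_ρ hx ht
  have e1 : pdt (fun x t => s.ρ x t * s.u x t) x t
      = pdt s.ρ x t * s.u x t + s.ρ x t * pdt s.u x t :=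
    ((s.sm_ρ.ht x t).mul (s.sm_u.ht x t)).deriv
  have e2 : pdx (fun x t =>
          s.ρ x t * (s.u x t) ^ 2 + s.ρ x t * s.θ x t + (∑ i, (s.b i x t) ^ 2) / 2) x t
      = pdx s.ρ x t * s.u x t ^ 2 + s.ρ x t * (2 * s.u x t * pdx s.u x t)
        + (pdx s.ρ x t * s.θ x t + s.ρ x t * pdx s.θ x t)
        + (s.b 0 x t * pdx (s.b 0) x t + s.b 1 x t * pdx (s.b 1) x t) := by
    simp only [Fin.sum_univ_two]
    refine HasDerivAt.deriv ?_
    exact ((((s.sm_ρ.hx x t).fun_mul (hd_sq (s.sm_u.hx x t))).fun_add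
      ((s.sm_ρ.hx x t).fun_mul (s.sm_θ.hx x t))).fun_add
      (((hd_sq ((s.sm_b 0).hx x t)).fun_add (hd_sq ((s.sm_b 1).hx x t))).div_const 2)).congr_deriv
      (by ring)
  rw [e1, e2] at h
  linear_combination h - s.u x t * h0

theorem MHDSol.e_w (s : MHDSol T κ) (i : Fin 2) {x t : ℝ} (hx : x ∈ Icc (0:ℝ) 1)
    (ht : t ∈ Icc (0:ℝ) T) :
    s.ρ x t * (pdt (s.w i) x t + s.u x t * pdx (s.w i) x t) - pdx (s.b i) x t
      = pdx (pdx (s.w i)) x t := by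
  have h := s.eq_w i x hx t ht
  have h0 := s.e_ρ hx ht
  have e1 : pdt (fun x t => s.ρ x t * s.w i x t) x t
      = pdt s.ρ x t * s.w i x t + s.ρ x t * pdt (s.w i) x t :=
    ((s.sm_ρ.ht x t).mul ((s.sm_w i).ht x t)).deriv
  have e2 : pdx (fun x t => s.ρ x t * s.u x t * s.w i x t - s.b i x t) x t
      = (pdx s.ρ x t * s.u x t + s.ρ x t * pdx s.u x t) * s.w i x t
        + s.ρ x t * s.u x t * pdx (s.w i) x t - pdx (s.b i) x t :=
    ((((s.sm_ρ.hx x t).mul (s.sm_u.hx x t)).mul ((s.sm_w i).hx x t)).sub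
      ((s.sm_b i).hx x t)).deriv
  rw [e1, e2] at h
  linear_combination h - s.w i x t * h0

theorem MHDSol.e_b (s : MHDSol T κ) (i : Fin 2) {x t : ℝ} (hx : x ∈ Icc (0:ℝ) 1)
    (ht : t ∈ Icc (0:ℝ) T) :
    pdt (s.b i) x t + (pdx s.u x t * s.b i x t + s.u x t * pdx (s.b i) x t) - pdx (s.w i) x t
      = pdx (pdx (s.b i)) x t := by
  have h := s.eq_b i x hx t ht
  have e2 : pdx (fun x t => s.u x t * s.b i x t - s.w i x t) x t
      = pdx s.u x t * s.b i x t + s.u x t * pdx (s.b i) x t - pdx (s.w i) x t :=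
    (((s.sm_u.hx x t).mul ((s.sm_b i).hx x t)).sub ((s.sm_w i).hx x t)).deriv
  rw [e2] at h
  linear_combination h

theorem kappa_cd {q C₀ : ℝ} (hκ : KappaHyp q C₀ κ) {r : ℝ} (hr : 0 < r) : ContDiffAt ℝ 2 κ r :=
  (hκ.1 r hr.le).contDiffAt (Ici_mem_nhds hr)

theorem MHDSol.k_cq {q C₀ : ℝ} (s : MHDSol T κ) (hκ : KappaHyp q C₀ κ) :
    CQ T (fun x t => κ (s.θ x t)) := by
  have h2 : Continuous (fun p : ℝ × ℝ => s.θ p.1 p.2) := by fun_prop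
  exact hκ.1.continuousOn.comp h2.continuousOn
    (fun p hp => (s.θ_pos p.1 hp.1 p.2 hp.2).le)

theorem MHDSol.J_cq {q C₀ : ℝ} (s : MHDSol T κ) (hκ : KappaHyp q C₀ κ) : CQ T s.J :=
  (s.k_cq hκ).mul (s.sm_θ.pdx.cq T)

theorem MHDSol.Q_cq (s : MHDSol T κ) : CQ T s.Q := by
  unfold CQ MHDSol.Q; fun_prop

theorem MHDSol.Jx_cq (s : MHDSol T κ) : CQ T s.Jx := by
  unfold CQ MHDSol.Jx MHDSol.Q; fun_prop

theorem MHDSol.Q_nn (s : MHDSol T κ) (x t : ℝ) : 0 ≤ s.Q x t := by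
  unfold MHDSol.Q; positivity

theorem MHDSol.J_hx {q C₀ : ℝ} (s : MHDSol T κ) (hκ : KappaHyp q C₀ κ) {x t : ℝ}
    (hx : x ∈ Icc (0:ℝ) 1) (ht : t ∈ Icc (0:ℝ) T) :
    HasDerivAt (fun y => s.J y t) (s.Jx x t) x := by
  have h := s.eq_θ x hx t ht
  have h0 := s.e_ρ hx ht
  have e1 : pdt (fun x t => s.ρ x t * s.θ x t) x t
      = pdt s.ρ x t * s.θ x t + s.ρ x t * pdt s.θ x t :=
    ((s.sm_ρ.ht x t).mul (s.sm_θ.ht x t)).deriv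
  have e2 : pdx (fun x t => s.ρ x t * s.u x t * s.θ x t) x t
      = (pdx s.ρ x t * s.u x t + s.ρ x t * pdx s.u x t) * s.θ x t
        + s.ρ x t * s.u x t * pdx s.θ x t :=
    (((s.sm_ρ.hx x t).mul (s.sm_u.hx x t)).mul (s.sm_θ.hx x t)).deriv
  have hd : DifferentiableAt ℝ (fun y => s.J y t) x := by
    unfold MHDSol.J
    have hk : DifferentiableAt ℝ κ (s.θ x t) :=
      (kappa_cd hκ (s.θ_pos x hx t ht)).differentiableAt (by simp)
    exact (hk.comp x (s.sm_θ.hx x t).differentiableAt).mul (s.sm_θ.pdx.hx x t).differentiableAt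
  have e3 : pdx (fun x t => κ (s.θ x t) * pdx s.θ x t) x t = deriv (fun y => s.J y t) x := rfl
  rw [e1, e2, e3] at h
  simp only [Fin.sum_univ_two] at h
  have e4 : deriv (fun y => s.J y t) x = s.Jx x t := by
    unfold MHDSol.Jx MHDSol.Q
    linear_combination s.θ x t * h0 - h
  rw [← e4]
  exact hd.hasDerivAt

theorem MHDSol.J_bc (s : MHDSol T κ) {t : ℝ} (ht : t ∈ Icc (0:ℝ) T) :
    s.J 0 t = 0 ∧ s.J 1 t = 0 := by
  unfold MHDSol.J
  rw [(s.bc_θ t ht).1, (s.bc_θ t ht).2]; simp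

end solfacts

/-! ### Initial data -/

theorem init_one {f : ℝ → ℝ → ℝ} (hf : Sm f) {A : ℝ} (h : H2norm (fun x => f x 0) ≤ A) :
    (∫ x in (0:ℝ)..1, pdx f x 0 ^ 2) ≤ A ^ 2 ∧ (∀ x ∈ Icc (0:ℝ) 1, f x 0 ^ 2 ≤ 4 * A ^ 2) := by
  have hA : 0 ≤ A := (Real.sqrt_nonneg _).trans h
  have h1 := (Real.sqrt_le_left hA).1 h
  have c0 : ContinuousOn (fun x => f x 0) (Icc 0 1) := (hf.cq 1).slice ⟨le_rfl, zero_le_one⟩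
  have c1 : ContinuousOn (fun x => pdx f x 0) (Icc 0 1) :=
    (hf.pdx.cq 1).slice ⟨le_rfl, zero_le_one⟩
  have c2 : ContinuousOn (fun x => pdx (pdx f) x 0) (Icc 0 1) :=
    (hf.pdx.pdx.cq 1).slice ⟨le_rfl, zero_le_one⟩
  have h2 : (∫ x in (0:ℝ)..1, f x 0 ^ 2 + pdx f x 0 ^ 2 + pdx (pdx f) x 0 ^ 2) ≤ A ^ 2 := h1
  have a0 : (∫ x in (0:ℝ)..1, f x 0 ^ 2) ≤ A ^ 2 := by
    refine le_trans (int_le (c0.pow 2) (((c0.pow 2).add (c1.pow 2)).add (c2.pow 2)) ?_) h2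
    intro x _
    simp only [Pi.add_apply, Pi.pow_apply]
    nlinarith [sq_nonneg (pdx f x 0), sq_nonneg (pdx (pdx f) x 0)]
  have a1 : (∫ x in (0:ℝ)..1, pdx f x 0 ^ 2) ≤ A ^ 2 := by
    refine le_trans (int_le (c1.pow 2) (((c0.pow 2).add (c1.pow 2)).add (c2.pow 2)) ?_) h2
    intro x _
    simp only [Pi.add_apply, Pi.pow_apply]
    nlinarith [sq_nonneg (f x 0), sq_nonneg (pdx (pdx f) x 0)]
  refine ⟨a1, fun x hx => ?_⟩
  have := sob c1 (fun x _ => hf.hx x 0) hx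
  linarith


/-! ### Mass, energy and the upper bound of the density -/

section mass
variable {T : ℝ} {κ : ℝ → ℝ}

theorem init_all (s : MHDSol T κ) {A B M : ℝ} (hI : InitBounds s A B M) (hT : 0 < T) :
    0 ≤ A ∧ (∀ x ∈ Icc (0:ℝ) 1, s.ρ x 0 ≤ 2 * A ∧ s.θ x 0 ≤ 2 * A ∧ s.u x 0 ^ 2 ≤ 4 * A ^ 2 ∧
      (∀ i, s.w i x 0 ^ 2 ≤ 4 * A ^ 2) ∧ (∀ i, s.b i x 0 ^ 2 ≤ 4 * A ^ 2)) := by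
  obtain ⟨h1, h2, h3, h4, h5, -, -⟩ := hI
  have hA : 0 ≤ A := (Real.sqrt_nonneg _).trans h1
  refine ⟨hA, fun x hx => ⟨?_, ?_, (init_one s.sm_u h2).2 x hx,
    fun i => (init_one (s.sm_w i) (h4 i)).2 x hx, fun i => (init_one (s.sm_b i) (h5 i)).2 x hx⟩⟩
  · have := (init_one s.sm_ρ h1).2 x hx
    nlinarith
  · have := (init_one s.sm_θ h3).2 x hx
    nlinarith

theorem mass_eq (s : MHDSol T κ) (hT : 0 < T) {t : ℝ} (ht : t ∈ Icc (0:ℝ) T) :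
    SI s.ρ t = SI s.ρ 0 := by
  rw [CQ.ftc hT.le (s.sm_ρ.cq T) (s.sm_ρ.pdt.cq T) (fun x _ t _ => s.sm_ρ.ht x t) ht]
  have : ∀ r ∈ Icc (0:ℝ) T, SI (pdt s.ρ) r = 0 := by
    intro r hr
    unfold SI
    apply int_flux (G := fun x => -(s.ρ x r * s.u x r)) ((s.sm_ρ.pdt.cq T).slice hr)
    · intro x hx
      exact ((s.sm_ρ.hx x r).fun_mul (s.sm_u.hx x r)).fun_neg.congr_deriv
        (by linarith [s.e_ρ hx hr])
    · rw [(s.bc_u r hr).1]; simp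
    · rw [(s.bc_u r hr).2]; simp
  rw [intervalIntegral.integral_congr (g := fun _ => (0:ℝ))]
  · simp
  · intro r hr
    rw [uIcc_of_le ht.1] at hr
    exact this r ⟨hr.1, hr.2.trans ht.2⟩

theorem mass_bd (s : MHDSol T κ) (hT : 0 < T) {A B M : ℝ} (hI : InitBounds s A B M) {t : ℝ}
    (ht : t ∈ Icc (0:ℝ) T) : M ≤ SI s.ρ t ∧ SI s.ρ t ≤ 2 * A := by
  rw [mass_eq s hT ht]
  have h00 : (0:ℝ) ∈ Icc (0:ℝ) T := ⟨le_rfl, hT.le⟩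
  refine ⟨hI.2.2.2.2.2.2, ?_⟩
  have := int_le (g := fun _ => 2 * A) ((s.sm_ρ.cq T).slice h00) continuousOn_const
    (fun x hx => ((init_all s hI hT).2 x hx).1)
  simpa [SI] using this

/-- Energy density. -/
def MHDSol.en (s : MHDSol T κ) (x t : ℝ) : ℝ :=
  s.ρ x t * (s.θ x t + s.u x t ^ 2 / 2 + s.w 0 x t ^ 2 / 2 + s.w 1 x t ^ 2 / 2)
    + (s.b 0 x t ^ 2 / 2 + s.b 1 x t ^ 2 / 2)

/-- Its time derivative. -/
def MHDSol.ent (s : MHDSol T κ) (x t : ℝ) : ℝ :=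
  pdt s.ρ x t * (s.θ x t + s.u x t ^ 2 / 2 + s.w 0 x t ^ 2 / 2 + s.w 1 x t ^ 2 / 2)
    + s.ρ x t * (pdt s.θ x t + s.u x t * pdt s.u x t + s.w 0 x t * pdt (s.w 0) x t
      + s.w 1 x t * pdt (s.w 1) x t)
    + (s.b 0 x t * pdt (s.b 0) x t + s.b 1 x t * pdt (s.b 1) x t)

theorem en_int (s : MHDSol T κ) (hT : 0 < T) {q C₀ : ℝ} (hκ : KappaHyp q C₀ κ) {t : ℝ}
    (ht : t ∈ Icc (0:ℝ) T) : SI s.en t = SI s.en 0 := by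
  have c1 : CQ T s.en := by unfold CQ MHDSol.en; fun_prop
  have c2 : CQ T s.ent := by unfold CQ MHDSol.ent; fun_prop
  rw [CQ.ftc hT.le c1 c2 (fun x _ t _ => by
    unfold MHDSol.en MHDSol.ent
    exact (((s.sm_ρ.ht x t).fun_mul ((((s.sm_θ.ht x t).fun_add
      ((hd_sq (s.sm_u.ht x t)).div_const 2)).fun_add
      ((hd_sq ((s.sm_w 0).ht x t)).div_const 2)).fun_add
      ((hd_sq ((s.sm_w 1).ht x t)).div_const 2))).fun_add
      (((hd_sq ((s.sm_b 0).ht x t)).div_const 2).fun_add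
      ((hd_sq ((s.sm_b 1).ht x t)).div_const 2))).congr_deriv (by ring)) ht]
  have : ∀ r ∈ Icc (0:ℝ) T, SI s.ent r = 0 := by
    intro r hr
    unfold SI
    apply int_flux (G := fun x => -(s.ρ x r * s.u x r * (s.θ x r + s.u x r ^ 2 / 2
      + s.w 0 x r ^ 2 / 2 + s.w 1 x r ^ 2 / 2)) + s.J x r - s.u x r * (s.ρ x r * s.θ x r)
      + s.u x r * pdx s.u x r + (s.w 0 x r * pdx (s.w 0) x r + s.w 1 x r * pdx (s.w 1) x r)
      + (s.b 0 x r * pdx (s.b 0) x r + s.b 1 x r * pdx (s.b 1) x r)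
      - s.u x r * (s.b 0 x r ^ 2 + s.b 1 x r ^ 2)
      + (s.w 0 x r * s.b 0 x r + s.w 1 x r * s.b 1 x r)) (c2.slice hr)
    · intro x hx
      refine (((((((((((s.sm_ρ.hx x r).fun_mul (s.sm_u.hx x r)).fun_mul
        ((((s.sm_θ.hx x r).fun_add
        ((hd_sq (s.sm_u.hx x r)).div_const 2)).fun_add
        ((hd_sq ((s.sm_w 0).hx x r)).div_const 2)).fun_add
        ((hd_sq ((s.sm_w 1).hx x r)).div_const 2))).fun_neg).fun_add (s.J_hx hκ hx hr)).fun_sub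
        ((s.sm_u.hx x r).fun_mul ((s.sm_ρ.hx x r).fun_mul (s.sm_θ.hx x r)))).fun_add
        ((s.sm_u.hx x r).fun_mul (s.sm_u.pdx.hx x r))).fun_add
        ((((s.sm_w 0).hx x r).fun_mul ((s.sm_w 0).pdx.hx x r)).fun_add
        (((s.sm_w 1).hx x r).fun_mul ((s.sm_w 1).pdx.hx x r)))).fun_add
        ((((s.sm_b 0).hx x r).fun_mul ((s.sm_b 0).pdx.hx x r)).fun_add
        (((s.sm_b 1).hx x r).fun_mul ((s.sm_b 1).pdx.hx x r)))).fun_sub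
        ((s.sm_u.hx x r).fun_mul ((hd_sq ((s.sm_b 0).hx x r)).fun_add
        (hd_sq ((s.sm_b 1).hx x r))))).fun_add
        ((((s.sm_w 0).hx x r).fun_mul ((s.sm_b 0).hx x r)).fun_add
        (((s.sm_w 1).hx x r).fun_mul ((s.sm_b 1).hx x r)))).congr_deriv ?_
      unfold MHDSol.ent MHDSol.Jx MHDSol.Q
      linear_combination (-(s.θ x r + s.u x r ^ 2 / 2 + s.w 0 x r ^ 2 / 2 + s.w 1 x r ^ 2 / 2))
        * s.e_ρ hx hr - s.u x r * s.e_u hx hr - s.w 0 x r * s.e_w 0 hx hr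
        - s.w 1 x r * s.e_w 1 hx hr - s.b 0 x r * s.e_b 0 hx hr - s.b 1 x r * s.e_b 1 hx hr
    · simp [(s.bc_u r hr).1, (s.bc_w 0 r hr).1, (s.bc_w 1 r hr).1, (s.bc_b 0 r hr).1,
        (s.bc_b 1 r hr).1, (s.J_bc hr).1]
    · simp [(s.bc_u r hr).2, (s.bc_w 0 r hr).2, (s.bc_w 1 r hr).2, (s.bc_b 0 r hr).2,
        (s.bc_b 1 r hr).2, (s.J_bc hr).2]
  rw [intervalIntegral.integral_congr (g := fun _ => (0:ℝ))]
  · simp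
  · intro r hr
    rw [uIcc_of_le ht.1] at hr
    exact this r ⟨hr.1, hr.2.trans ht.2⟩

/-- The energy bound. -/
def EE (A : ℝ) : ℝ := 2 * A * (2 * A + 6 * A ^ 2) + 4 * A ^ 2 + 1

theorem en_bd (s : MHDSol T κ) (hT : 0 < T) {q C₀ : ℝ} (hκ : KappaHyp q C₀ κ) {A B M : ℝ}
    (hI : InitBounds s A B M) {t : ℝ} (ht : t ∈ Icc (0:ℝ) T) : SI s.en t ≤ EE A := by
  rw [en_int s hT hκ ht]
  have h00 : (0:ℝ) ∈ Icc (0:ℝ) T := ⟨le_rfl, hT.le⟩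
  have c1 : CQ T s.en := by unfold CQ MHDSol.en; fun_prop
  obtain ⟨hA, h⟩ := init_all s hI hT
  have := int_le (g := fun _ => EE A) (c1.slice h00) continuousOn_const
    (fun x hx => by
      obtain ⟨a1, a2, a3, a4, a5⟩ := h x hx
      have p1 := s.ρ_pos x hx 0 h00
      have p2 := s.θ_pos x hx 0 h00
      have w0 := a4 0
      have w1 := a4 1
      have b0 := a5 0
      have b1 := a5 1
      unfold MHDSol.en EE
      have : s.ρ x 0 * (s.θ x 0 + s.u x 0 ^ 2 / 2 + s.w 0 x 0 ^ 2 / 2 + s.w 1 x 0 ^ 2 / 2)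
        ≤ 2 * A * (2 * A + 6 * A ^ 2) := by
        apply mul_le_mul a1 (by linarith) (by positivity) (by positivity)
      linarith)
  simpa [SI] using this

theorem EE_pos {A : ℝ} (hA : 0 ≤ A) : 1 ≤ EE A := by
  unfold EE
  have : 0 ≤ 2 * A * (2 * A + 6 * A ^ 2) + 4 * A ^ 2 := by positivity
  linarith

theorem en_cons (s : MHDSol T κ) (hT : 0 < T) {q C₀ : ℝ} (hκ : KappaHyp q C₀ κ) {A B M : ℝ}
    (hI : InitBounds s A B M) {t : ℝ} (ht : t ∈ Icc (0:ℝ) T) :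
    SI (fun x t => s.ρ x t * s.θ x t) t ≤ EE A ∧ SI (fun x t => s.ρ x t * s.u x t ^ 2) t ≤ 2 * EE A
    ∧ SI (fun x t => s.b 0 x t ^ 2 + s.b 1 x t ^ 2) t ≤ 2 * EE A := by
  have hE := en_bd s hT hκ hI ht
  have c1 : CQ T s.en := by unfold CQ MHDSol.en; fun_prop
  have key : ∀ x ∈ Icc (0:ℝ) 1, 0 ≤ s.ρ x t * s.θ x t ∧ 0 ≤ s.ρ x t * s.u x t ^ 2 ∧
      0 ≤ s.ρ x t * s.w 0 x t ^ 2 ∧ 0 ≤ s.ρ x t * s.w 1 x t ^ 2 := by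
    intro x hx
    have p1 := s.ρ_pos x hx t ht
    have p2 := s.θ_pos x hx t ht
    refine ⟨?_, ?_, ?_, ?_⟩ <;> positivity
  have f1 : CQ T (fun x t => s.ρ x t * s.θ x t) := by unfold CQ; fun_prop
  have f2 : CQ T (fun x t => s.ρ x t * s.u x t ^ 2) := by unfold CQ; fun_prop
  have f3 : CQ T (fun x t => s.b 0 x t ^ 2 + s.b 1 x t ^ 2) := by unfold CQ; fun_prop
  have e : ∀ x, s.en x t = s.ρ x t * s.θ x t + s.ρ x t * s.u x t ^ 2 / 2
      + s.ρ x t * s.w 0 x t ^ 2 / 2 + s.ρ x t * s.w 1 x t ^ 2 / 2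
      + (s.b 0 x t ^ 2 / 2 + s.b 1 x t ^ 2 / 2) := fun x => by unfold MHDSol.en; ring
  refine ⟨?_, ?_, ?_⟩
  · refine le_trans (int_lin1 1 0 (f1.slice ht) (c1.slice ht) ?_) (by simpa [SI] using hE)
    intro x hx
    obtain ⟨k1, k2, k3, k4⟩ := key x hx
    rw [e x]
    linarith [sq_nonneg (s.b 0 x t), sq_nonneg (s.b 1 x t)]
  · refine le_trans (int_lin1 2 0 (f2.slice ht) (c1.slice ht) ?_) (by simpa [SI] using hE)
    intro x hx
    obtain ⟨k1, k2, k3, k4⟩ := key x hx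
    rw [e x]
    linarith [sq_nonneg (s.b 0 x t), sq_nonneg (s.b 1 x t)]
  · refine le_trans (int_lin1 2 0 (f3.slice ht) (c1.slice ht) ?_) (by simpa [SI] using hE)
    intro x hx
    obtain ⟨k1, k2, k3, k4⟩ := key x hx
    rw [e x]
    linarith [sq_nonneg (s.b 0 x t), sq_nonneg (s.b 1 x t)]

end mass


/-! ### Upper bound of the density -/

theorem Sm.prim_ht {f : ℝ → ℝ → ℝ} (hf : Sm f) (x t : ℝ) :
    HasDerivAt (fun s => ∫ y in (0:ℝ)..x, f y s) (∫ y in (0:ℝ)..x, _root_.pdt f y t) t := by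
  have hK : IsCompact (uIcc (0:ℝ) x ×ˢ Icc (t - 1) (t + 1)) :=
    isCompact_uIcc.prod isCompact_Icc
  obtain ⟨C, hC⟩ := hK.exists_bound_of_continuousOn (hf.pdt.cont.continuousOn)
  have hc : ∀ s, Continuous (fun y => f y s) := fun s =>
    hf.cont.comp (continuous_id.prodMk continuous_const)
  have hc' : ∀ s, Continuous (fun y => _root_.pdt f y s) := fun s =>
    hf.pdt.cont.comp (continuous_id.prodMk continuous_const)
  refine (intervalIntegral.hasDerivAt_integral_of_dominated_loc_of_deriv_le
    (F := fun s y => f y s) (F' := fun s y => _root_.pdt f y s) (bound := fun _ => C)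
    (s := Icc (t - 1) (t + 1)) ?_ ?_ ?_ ?_ ?_ ?_ ?_).2
  · exact Icc_mem_nhds (by linarith) (by linarith)
  · exact Filter.Eventually.of_forall (fun s => (hc s).aestronglyMeasurable)
  · exact (hc t).intervalIntegrable _ _
  · exact (hc' t).aestronglyMeasurable
  · exact Filter.Eventually.of_forall (fun y hy s hs => hC (y, s) ⟨uIoc_subset_uIcc hy, hs⟩)
  · exact intervalIntegrable_const
  · exact Filter.Eventually.of_forall (fun y _ s _ => hf.ht y s)

theorem Sm.prim_cont {f : ℝ → ℝ → ℝ} (hf : Sm f) :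
    Continuous (fun p : ℝ × ℝ => ∫ y in (0:ℝ)..p.1, f y p.2) := by
  apply intervalIntegral.continuous_parametric_intervalIntegral_of_continuous
    (f := fun (p : ℝ × ℝ) (y : ℝ) => f y p.2)
  · exact hf.cont.comp (continuous_snd.prodMk (continuous_snd.comp continuous_fst))
  · exact continuous_fst

theorem Sm.prim_hx {f : ℝ → ℝ → ℝ} (hf : Sm f) (x t : ℝ) :
    HasDerivAt (fun z => ∫ y in (0:ℝ)..z, f y t) (f x t) x := by
  have hc : Continuous (fun y => f y t) :=
    hf.cont.comp (continuous_id.prodMk continuous_const)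
  exact intervalIntegral.integral_hasDerivAt_right (hc.intervalIntegrable _ _)
    (hc.stronglyMeasurableAtFilter _ _) hc.continuousAt

section dens
variable {T : ℝ} {κ : ℝ → ℝ}

/-- Momentum. -/
def MHDSol.m (s : MHDSol T κ) (x t : ℝ) : ℝ := s.ρ x t * s.u x t

/-- Weighted momentum. -/
def MHDSol.m1 (s : MHDSol T κ) (x t : ℝ) : ℝ := (1 - x) * s.m x t

theorem MHDSol.sm_m (s : MHDSol T κ) : Sm s.m := s.smooth_ρ.mul s.smooth_u

theorem MHDSol.sm_m1 (s : MHDSol T κ) : Sm s.m1 :=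
  (contDiff_const.sub contDiff_fst).mul s.sm_m

/-- Total stress. -/
def MHDSol.σ (s : MHDSol T κ) (x t : ℝ) : ℝ :=
  pdx s.u x t - s.ρ x t * s.u x t ^ 2 - s.ρ x t * s.θ x t - (s.b 0 x t ^ 2 + s.b 1 x t ^ 2) / 2

theorem MHDSol.σ_hx (s : MHDSol T κ) {x t : ℝ} (hx : x ∈ Icc (0:ℝ) 1) (ht : t ∈ Icc (0:ℝ) T) :
    HasDerivAt (fun y => s.σ y t) (pdt s.m x t) x := by
  have e : pdt s.m x t = pdt s.ρ x t * s.u x t + s.ρ x t * pdt s.u x t :=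
    ((s.sm_ρ.ht x t).mul (s.sm_u.ht x t)).deriv
  rw [e]
  unfold MHDSol.σ
  refine (((((s.sm_u.pdx.hx x t)).fun_sub
    ((s.sm_ρ.hx x t).fun_mul (hd_sq (s.sm_u.hx x t)))).fun_sub
    ((s.sm_ρ.hx x t).fun_mul (s.sm_θ.hx x t))).fun_sub
    (((hd_sq ((s.sm_b 0).hx x t)).fun_add (hd_sq ((s.sm_b 1).hx x t))).div_const 2)).congr_deriv ?_
  linear_combination -s.u x t * s.e_ρ hx ht - s.e_u hx ht

theorem MHDSol.σ_cq (s : MHDSol T κ) : CQ T s.σ := by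
  unfold CQ MHDSol.σ; fun_prop

theorem MHDSol.pdt_m1 (s : MHDSol T κ) (x t : ℝ) : pdt s.m1 x t = (1 - x) * pdt s.m x t :=
  ((s.sm_m.ht x t).const_mul (1 - x)).deriv

theorem MHDSol.int_m (s : MHDSol T κ) {x t : ℝ} (hx : x ∈ Icc (0:ℝ) 1) (ht : t ∈ Icc (0:ℝ) T) :
    (∫ y in (0:ℝ)..x, pdt s.m y t) = s.σ x t - s.σ 0 t := by
  rw [intervalIntegral.integral_eq_sub_of_hasDerivAt (f := fun y => s.σ y t)]
  · intro y hy
    rw [uIcc_of_le hx.1] at hy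
    exact s.σ_hx ⟨hy.1, hy.2.trans hx.2⟩ ht
  · exact (s.sm_m.pdt.cont.comp (continuous_id.prodMk continuous_const)).intervalIntegrable _ _

theorem MHDSol.int_m1 (s : MHDSol T κ) {t : ℝ} (ht : t ∈ Icc (0:ℝ) T) :
    (∫ y in (0:ℝ)..1, pdt s.m1 y t) = SI s.σ t - s.σ 0 t := by
  have c1 : ContinuousOn (fun y => pdt s.m1 y t) (Icc 0 1) := (s.sm_m1.pdt.cq T).slice ht
  have c2 := s.σ_cq.slice ht
  have h : (∫ y in (0:ℝ)..1, (pdt s.m1 y t - s.σ y t)) = 0 - s.σ 0 t := by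
    rw [intervalIntegral.integral_eq_sub_of_hasDerivAt (f := fun y => (1 - y) * s.σ y t)]
    · simp
    · intro y hy
      rw [uIcc_of_le zero_le_one] at hy
      rw [s.pdt_m1]
      exact ((((hasDerivAt_id y).const_sub 1).fun_mul (s.σ_hx hy ht))).congr_deriv
        (by simp only [id]; ring)
    · exact ii01 (c1.sub c2)
  rw [intervalIntegral.integral_sub (ii01 c1) (ii01 c2)] at h
  unfold SI
  linarith

/-- The effective potential. -/
def MHDSol.ψ (s : MHDSol T κ) (x t : ℝ) : ℝ := (∫ y in (0:ℝ)..x, s.m y t) - ∫ y in (0:ℝ)..1, s.m1 y t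

theorem MHDSol.abs_m (s : MHDSol T κ) {x t : ℝ} (hx : x ∈ Icc (0:ℝ) 1) (ht : t ∈ Icc (0:ℝ) T) :
    |s.m x t| ≤ (s.ρ x t + s.ρ x t * s.u x t ^ 2) / 2 := by
  have p := s.ρ_pos x hx t ht
  unfold MHDSol.m
  rw [abs_le]
  constructor <;> nlinarith [mul_nonneg p.le (sq_nonneg (s.u x t - 1)),
    mul_nonneg p.le (sq_nonneg (s.u x t + 1))]

theorem MHDSol.ψ_bd (s : MHDSol T κ) (hT : 0 < T) {q C₀ : ℝ} (hκ : KappaHyp q C₀ κ) {A B M : ℝ}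
    (hI : InitBounds s A B M) {x t : ℝ} (hx : x ∈ Icc (0:ℝ) 1) (ht : t ∈ Icc (0:ℝ) T) :
    |s.ψ x t| ≤ 2 * (A + EE A) := by
  obtain ⟨-, h2, -⟩ := en_cons s hT hκ hI ht
  have h1 := (mass_bd s hT hI ht).2
  have cρ := (s.sm_ρ.cq T).slice ht
  have cρu : ContinuousOn (fun x => s.ρ x t * s.u x t ^ 2) (Icc 0 1) := by fun_prop
  have cm : ContinuousOn (fun x => s.m x t) (Icc 0 1) := (s.sm_m.cq T).slice ht
  have cm1 : ContinuousOn (fun x => s.m1 x t) (Icc 0 1) := (s.sm_m1.cq T).slice ht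
  have hb : (∫ y in (0:ℝ)..1, |s.m y t|) ≤ A + EE A := by
    have := int_lin2 (f := fun y => |s.m y t|) (1/2) (1/2) 0 cm.abs cρ cρu
      (fun x hx => by have := s.abs_m hx ht; linarith)
    unfold SI at h1 h2
    linarith
  have k1 : |∫ y in (0:ℝ)..x, s.m y t| ≤ A + EE A := by
    refine (intervalIntegral.abs_integral_le_integral_abs hx.1).trans (le_trans ?_ hb)
    apply intervalIntegral.integral_mono_interval le_rfl hx.1 hx.2
    · exact Filter.Eventually.of_forall (fun y => abs_nonneg _)
    · exact ii01 cm.abs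
  have k2 : |∫ y in (0:ℝ)..1, s.m1 y t| ≤ A + EE A := by
    refine (intervalIntegral.abs_integral_le_integral_abs zero_le_one).trans (le_trans ?_ hb)
    apply int_le cm1.abs cm.abs
    intro y hy
    unfold MHDSol.m1
    rw [abs_mul]
    have : |1 - y| ≤ 1 := by rw [abs_le]; constructor <;> linarith [hy.1, hy.2]
    exact mul_le_of_le_one_left (abs_nonneg _) this
  unfold MHDSol.ψ
  have := abs_sub (∫ y in (0:ℝ)..x, s.m y t) (∫ y in (0:ℝ)..1, s.m1 y t)
  linarith

/-- Density bound. -/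
def RR (T A : ℝ) : ℝ := exp (2 * A + 4 * (A + EE A) + (4 * EE A + 1) * T)

theorem RR_one {T A : ℝ} (hT : 0 < T) (hA : 0 ≤ A) : 1 ≤ RR T A := by
  unfold RR
  have := EE_pos hA
  apply one_le_exp
  positivity

theorem dens_bd (s : MHDSol T κ) (hT : 0 < T) {q C₀ : ℝ} (hκ : KappaHyp q C₀ κ) {A B M : ℝ}
    (hI : InitBounds s A B M) {x t : ℝ} (hx : x ∈ Icc (0:ℝ) 1) (ht : t ∈ Icc (0:ℝ) T) :
    s.ρ x t ≤ RR T A := by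
  have h00 : (0:ℝ) ∈ Icc (0:ℝ) T := ⟨le_rfl, hT.le⟩
  obtain ⟨hA, hi⟩ := init_all s hI hT
  have hE := EE_pos hA
  have hm := max_principle hT (Z := fun x t => log (s.ρ x t) + s.ψ x t)
    (Zt := fun x t => pdt s.ρ x t / s.ρ x t + (s.σ x t - SI s.σ t))
    (Zx := fun x t => pdx s.ρ x t / s.ρ x t + s.m x t)
    (u := s.u) (K := 4 * EE A) (Z0 := 2 * A + 2 * (A + EE A)) ?_ ?_ ?_ ?_ ?_ (by linarith) ?_ x hx t ht
  · have h1 := (abs_le.1 (s.ψ_bd hT hκ hI hx ht)).1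
    have h2 : log (s.ρ x t) ≤ 2 * A + 4 * (A + EE A) + (4 * EE A + 1) * T := by
      linarith
    exact (log_le_iff_le_exp (s.ρ_pos x hx t ht)).1 h2
  · have c1 : ContinuousOn (fun p : ℝ × ℝ => log (s.ρ p.1 p.2)) (Icc 0 1 ×ˢ Icc 0 T) := by
      apply ContinuousOn.log
      · exact s.sm_ρ.cont.continuousOn
      · intro p hp
        exact (s.ρ_pos p.1 hp.1 p.2 hp.2).ne'
    have c2 : Continuous (fun p : ℝ × ℝ => s.ψ p.1 p.2) := by
      unfold MHDSol.ψ
      refine s.sm_m.prim_cont.sub ?_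
      exact s.sm_m1.prim_cont.comp (g := fun p : ℝ × ℝ => ∫ y in (0:ℝ)..p.1, s.m1 y p.2)
        (f := fun p : ℝ × ℝ => ((1:ℝ), p.2)) (by fun_prop)
    exact c1.add c2.continuousOn
  · intro x hx t ht
    have h1 := s.sm_m.prim_ht x t
    have h2 := s.sm_m1.prim_ht 1 t
    rw [s.int_m hx ht] at h1
    rw [s.int_m1 ht] at h2
    unfold MHDSol.ψ
    exact (((s.sm_ρ.ht x t).log (s.ρ_pos x hx t ht).ne').fun_add (h1.fun_sub h2)).congr_deriv
      (by ring)
  · intro x hx t ht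
    unfold MHDSol.ψ
    exact (((s.sm_ρ.hx x t).log (s.ρ_pos x hx t ht).ne').fun_add
      ((s.sm_m.prim_hx x t).sub_const _))
  · exact s.bc_u
  · intro x hx t ht
    have p := s.ρ_pos x hx t ht
    have p2 := s.θ_pos x hx t ht
    have e : pdt s.ρ x t / s.ρ x t + s.u x t * (pdx s.ρ x t / s.ρ x t) = - pdx s.u x t := by
      have := s.e_ρ hx ht
      field_simp
      linarith
    obtain ⟨k1, k2, k3⟩ := en_cons s hT hκ hI ht
    have hux : (∫ x in (0:ℝ)..1, pdx s.u x t) = 0 :=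
      int_flux (G := fun y => s.u y t) ((s.sm_u.pdx.cq T).slice ht) (fun x _ => s.sm_u.hx x t)
        (s.bc_u t ht).1 (s.bc_u t ht).2
    have hs : - SI s.σ t ≤ 4 * EE A := by
      have := int_lin (n := 4) (f := fun x => - s.σ x t)
        ![fun x => pdx s.u x t, fun x => s.ρ x t * s.u x t ^ 2, fun x => s.ρ x t * s.θ x t,
          fun x => s.b 0 x t ^ 2 + s.b 1 x t ^ 2] ![-1, 1, 1, 1/2] 0
        (s.σ_cq.slice ht).neg (by
          intro i; fin_cases i <;> simp <;> fun_prop) (by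
          intro x _
          simp [Fin.sum_univ_succ, MHDSol.σ]
          linarith)
      simp only [Fin.sum_univ_succ, intervalIntegral.integral_neg] at this
      simp [hux] at this
      unfold SI at *
      linarith
    have hb : 0 ≤ s.ρ x t * s.θ x t := by positivity
    have e2 : pdt s.ρ x t / s.ρ x t + (s.σ x t - SI s.σ t)
        + s.u x t * (pdx s.ρ x t / s.ρ x t + s.m x t) = - pdx s.u x t + (s.σ x t - SI s.σ t)
        + s.u x t * s.m x t := by rw [← e]; ring
    rw [e2]
    unfold MHDSol.m
    have : s.σ x t = pdx s.u x t - s.ρ x t * s.u x t ^ 2 - s.ρ x t * s.θ x t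
      - (s.b 0 x t ^ 2 + s.b 1 x t ^ 2) / 2 := rfl
    nlinarith [sq_nonneg (s.b 0 x t), sq_nonneg (s.b 1 x t)]
  · intro x hx
    have h1 := (abs_le.1 (s.ψ_bd hT hκ hI hx h00)).2
    have h2 := (hi x hx).1
    have h3 := log_le_sub_one_of_pos (s.ρ_pos x hx 0 h00)
    linarith

end dens


/-! ### Temperature estimates -/

theorem flux_eq {f' G e : ℝ → ℝ} (hf : ContinuousOn f' (Icc 0 1)) (he : ContinuousOn e (Icc 0 1))
    (hd : ∀ x ∈ Icc (0:ℝ) 1, HasDerivAt G (f' x - e x) x) (h0 : G 0 = 0) (h1 : G 1 = 0) :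
    (∫ x in (0:ℝ)..1, f' x) = ∫ x in (0:ℝ)..1, e x := by
  have := int_flux (hf.sub he) hd h0 h1
  simp only [Pi.sub_apply] at this
  rw [intervalIntegral.integral_sub (ii01 hf) (ii01 he)] at this
  linarith

theorem hd_rpow {f : ℝ → ℝ} {f' x r r' : ℝ} (h : HasDerivAt f f' x) (hp : 0 < f x)
    (hr : r - 1 = r') : HasDerivAt (fun y => f y ^ r) (r * f x ^ r' * f') x := by
  subst hr
  exact (h.rpow_const (Or.inl hp.ne')).congr_deriv (by ring)

theorem rpow_le_one_add {x r p : ℝ} (hx : 0 < x) (hr : 0 ≤ r) (hrp : r ≤ p) :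
    x ^ r ≤ 1 + x ^ p := by
  have := rpow_pos_of_pos hx p
  rcases le_total x 1 with h | h
  · have := rpow_le_one hx.le h hr
    linarith
  · have := rpow_le_rpow_of_exponent_le h hrp
    linarith

section temp
variable {T : ℝ} {κ : ℝ → ℝ}

theorem exists_cold (s : MHDSol T κ) (hT : 0 < T) {q C₀ : ℝ} (hκ : KappaHyp q C₀ κ) {A B M : ℝ}
    (hM : 0 < M) (hI : InitBounds s A B M) {t : ℝ} (ht : t ∈ Icc (0:ℝ) T) :
    ∃ x ∈ Icc (0:ℝ) 1, s.θ x t ≤ EE A / M := by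
  have c : ContinuousOn (fun x => s.ρ x t * s.θ x t - EE A / M * s.ρ x t) (Icc 0 1) := by fun_prop
  obtain ⟨y, hy, h⟩ := exists_le_int c
  refine ⟨y, hy, ?_⟩
  have k1 := (en_cons s hT hκ hI ht).1
  have k2 := (mass_bd s hT hI ht).1
  have hA := (init_all s hI hT).1
  have hE := EE_pos hA
  rw [intervalIntegral.integral_sub (ii01 (by fun_prop)) (ii01 (by fun_prop)),
    intervalIntegral.integral_const_mul] at h
  have h3 : EE A / M * M ≤ EE A / M * SI s.ρ t := by
    apply mul_le_mul_of_nonneg_left k2; positivity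
  rw [div_mul_cancel₀ _ hM.ne'] at h3
  unfold SI at k1 h3
  have h4 : s.ρ y t * (s.θ y t - EE A / M) ≤ 0 := by linarith
  have := s.ρ_pos y hy t ht
  by_contra hc
  push Not at hc
  have : 0 < s.ρ y t * (s.θ y t - EE A / M) := mul_pos this (by linarith)
  linarith

/-- Weighted temperature dissipation. -/
def MHDSol.v (s : MHDSol T κ) (α x t : ℝ) : ℝ :=
  κ (s.θ x t) * pdx s.θ x t ^ 2 * s.θ x t ^ (-1 - α)

theorem MHDSol.th_cq (s : MHDSol T κ) (r : ℝ) : CQ T (fun x t => s.θ x t ^ r) :=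
  (s.sm_θ.cq T).rpow r s.θ_pos

theorem MHDSol.v_cq {q C₀ : ℝ} (s : MHDSol T κ) (hκ : KappaHyp q C₀ κ) (α : ℝ) :
    CQ T (s.v α) :=
  ((s.k_cq hκ).mul ((s.sm_θ.pdx.cq T).pow 2)).mul (s.th_cq _)

theorem KappaHyp.lb {q C₀ : ℝ} (hκ : KappaHyp q C₀ κ) (hC : 1 ≤ C₀) {r : ℝ} (hr : 0 ≤ r) :
    1 + r ^ q ≤ C₀ * κ r := by
  have h := hκ.2.1 r hr
  rw [inv_mul_le_iff₀ (by linarith)] at h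
  exact h

theorem KappaHyp.pos {q C₀ : ℝ} (hκ : KappaHyp q C₀ κ) (hC : 1 ≤ C₀) {r : ℝ} (hr : 0 ≤ r) :
    0 < κ r := by
  have h := hκ.lb hC hr
  have := rpow_nonneg hr q
  by_contra hc
  push Not at hc
  have : C₀ * κ r ≤ 0 := mul_nonpos_of_nonneg_of_nonpos (by linarith) hc
  linarith

theorem MHDSol.v_nn {q C₀ : ℝ} (s : MHDSol T κ) (hκ : KappaHyp q C₀ κ) (hC : 1 ≤ C₀) (α : ℝ)
    {x t : ℝ} (hx : x ∈ Icc (0:ℝ) 1) (ht : t ∈ Icc (0:ℝ) T) : 0 ≤ s.v α x t := by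
  have p := s.θ_pos x hx t ht
  have := hκ.pos hC p.le
  unfold MHDSol.v
  positivity

theorem th_p_bd (s : MHDSol T κ) (hT : 0 < T) {q C₀ : ℝ} (hκ : KappaHyp q C₀ κ) (hC : 1 ≤ C₀)
    {A B M : ℝ} (hM : 0 < M) (hI : InitBounds s A B M) {α p : ℝ} (hp : p = q + 1 - α) (hp0 : 0 < p)
    {x t : ℝ} (hx : x ∈ Icc (0:ℝ) 1) (ht : t ∈ Icc (0:ℝ) T) :
    s.θ x t ^ p ≤ 2 * (EE A / M) ^ p + p ^ 2 * C₀ / 2 * SI (s.v α) t := by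
  obtain ⟨y, hy, hyN⟩ := exists_cold s hT hκ hM hI ht
  have hsq : ∀ z ∈ Icc (0:ℝ) 1, (s.θ z t ^ (p / 2)) ^ 2 = s.θ z t ^ p := fun z hz => by
    rw [← rpow_natCast, ← rpow_mul (s.θ_pos z hz t ht).le]
    norm_num
  have cf : ContinuousOn (fun z => p / 2 * s.θ z t ^ (p / 2 - 1) * pdx s.θ z t) (Icc 0 1) :=
    (continuousOn_const.mul ((s.th_cq _).slice ht)).mul ((s.sm_θ.pdx.cq T).slice ht)
  have h1 := sob_sub (f := fun z => s.θ z t ^ (p / 2)) cf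
    (fun z hz => hd_rpow (s.sm_θ.hx z t) (s.θ_pos z hz t ht) rfl) hx hy
  have h2 := int_lin1 (f := fun z => (p / 2 * s.θ z t ^ (p / 2 - 1) * pdx s.θ z t) ^ 2)
    (g1 := fun z => s.v α z t) (p ^ 2 * C₀ / 4) 0 (cf.pow 2) ((s.v_cq hκ α).slice ht) (by
    intro z hz
    have pz := s.θ_pos z hz t ht
    have e1 : (s.θ z t ^ (p / 2 - 1)) ^ 2 = s.θ z t ^ q * s.θ z t ^ (-1 - α) := by
      rw [← rpow_natCast, ← rpow_mul pz.le, ← rpow_add pz]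
      congr 1
      push_cast
      rw [hp]; ring
    have e2 := hκ.lb hC pz.le
    have e3 : 0 ≤ pdx s.θ z t ^ 2 * s.θ z t ^ (-1 - α) := by positivity
    have e4 := mul_le_mul_of_nonneg_right e2 e3
    have e5 : (p / 2 * s.θ z t ^ (p / 2 - 1) * pdx s.θ z t) ^ 2
      = p ^ 2 / 4 * (s.θ z t ^ q * (pdx s.θ z t ^ 2 * s.θ z t ^ (-1 - α))) := by
      rw [mul_pow, mul_pow, e1]; ring
    rw [e5]
    unfold MHDSol.v
    have e6 : p ^ 2 / 4 * (s.θ z t ^ q * (pdx s.θ z t ^ 2 * s.θ z t ^ (-1 - α)))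
      ≤ p ^ 2 / 4 * (C₀ * κ (s.θ z t) * (pdx s.θ z t ^ 2 * s.θ z t ^ (-1 - α))) := by
      apply mul_le_mul_of_nonneg_left _ (by positivity)
      linarith
    linarith)
  have h3 : s.θ y t ^ p ≤ (EE A / M) ^ p := rpow_le_rpow (s.θ_pos y hy t ht).le hyN hp0.le
  rw [← hsq x hx]
  rw [← hsq y hy] at h3
  unfold SI
  nlinarith [sq_nonneg (s.θ x t ^ (p / 2) - 2 * s.θ y t ^ (p / 2))]

theorem interp {z L α p q : ℝ} (hz : 0 < z) (hL : 0 < L) (hα : α < 1) (hq : 0 < q)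
    (hp : p = q + 1 - α) : z ^ (1 - α) ≤ L ^ (1 - α) + L ^ (-q) * z ^ p := by
  have p1 := rpow_pos_of_pos hL (1 - α)
  have p2 := rpow_pos_of_pos hL (-q)
  have p3 := rpow_pos_of_pos hz p
  rcases le_total z L with h | h
  · have := rpow_le_rpow hz.le h (by linarith : 0 ≤ 1 - α)
    nlinarith [mul_pos p2 p3]
  · have h1 : z ^ (-q) ≤ L ^ (-q) := rpow_le_rpow_of_nonpos hL h (by linarith)
    have h2 : z ^ (1 - α) = z ^ (-q) * z ^ p := by
      rw [← rpow_add hz, hp]; ring_nf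
    rw [h2]
    nlinarith

/-- Test density. -/
def MHDSol.tf (s : MHDSol T κ) (α x t : ℝ) : ℝ := -(s.ρ x t * (s.θ x t ^ (1 - α) / (1 - α)))

/-- Its derivative. -/
def MHDSol.tf' (s : MHDSol T κ) (α x t : ℝ) : ℝ :=
  -(pdt s.ρ x t * (s.θ x t ^ (1 - α) / (1 - α)) + s.ρ x t * (s.θ x t ^ (-α) * pdt s.θ x t))

theorem temp_test (s : MHDSol T κ) {q C₀ : ℝ} (hκ : KappaHyp q C₀ κ)
    {α : ℝ} (hα1 : α < 1) {t : ℝ} (ht : t ∈ Icc (0:ℝ) T) :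
    SI (s.tf' α) t + α * SI (s.v α) t
      ≤ 1 / 2 * ∫ x in (0:ℝ)..1, s.ρ x t * (s.ρ x t * s.θ x t) * s.θ x t ^ (1 - α) := by
  have hJ := s.J_cq hκ
  have hv := s.v_cq hκ α
  have k1 := s.th_cq (1 - α)
  have k2 := s.th_cq (-α)
  have cQ := s.Q_cq
  have c1 : CQ T (s.tf' α) := by
    unfold CQ MHDSol.tf' at *; fun_prop
  have c2 : CQ T (fun x t => -α * s.v α x t - s.Q x t * s.θ x t ^ (-α)
      + s.ρ x t * s.θ x t * s.θ x t ^ (-α) * pdx s.u x t) := by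
    unfold CQ at *; fun_prop
  have c3 : CQ T (fun x t => s.ρ x t * (s.ρ x t * s.θ x t) * s.θ x t ^ (1 - α)) := by
    unfold CQ at *; fun_prop
  have h1 := flux_eq (G := fun x => s.ρ x t * s.u x t * (s.θ x t ^ (1 - α) / (1 - α))
    - s.θ x t ^ (-α) * s.J x t) (c1.slice ht) (c2.slice ht) (by
    intro x hx
    have p := s.θ_pos x hx t ht
    refine ((((s.sm_ρ.hx x t).fun_mul (s.sm_u.hx x t)).fun_mul
      ((hd_rpow (r := 1 - α) (r' := -α) (s.sm_θ.hx x t) p (by ring)).div_const (1 - α))).fun_sub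
      ((hd_rpow (r := -α) (r' := -1-α) (s.sm_θ.hx x t) p (by ring)).fun_mul
        (s.J_hx hκ hx ht))).congr_deriv ?_
    have hne : 1 - α ≠ 0 := by linarith
    unfold MHDSol.tf' MHDSol.Jx MHDSol.v MHDSol.J
    field_simp
    linear_combination (s.θ x t ^ (1 - α)) * s.e_ρ hx ht)
    (by simp [(s.bc_u t ht).1, (s.J_bc ht).1]) (by simp [(s.bc_u t ht).2, (s.J_bc ht).2])
  have h2 := int_lin2 (-α) (1 / 2) 0 (c2.slice ht) (hv.slice ht) (c3.slice ht) (by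
    intro x hx
    have p := s.θ_pos x hx t ht
    have p2 := s.ρ_pos x hx t ht
    have e : s.θ x t ^ (1 - α) = s.θ x t * s.θ x t ^ (-α) := by
      rw [sub_eq_add_neg, rpow_add p, rpow_one]
    rw [e]
    have p3 := rpow_pos_of_pos p (-α)
    set a := s.θ x t ^ (-α)
    have hQ : pdx s.u x t ^ 2 ≤ s.Q x t := by
      unfold MHDSol.Q
      nlinarith [sq_nonneg (pdx (s.w 0) x t), sq_nonneg (pdx (s.w 1) x t),
        sq_nonneg (pdx (s.b 0) x t), sq_nonneg (pdx (s.b 1) x t)]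
    have h3 := mul_nonneg p3.le (sq_nonneg (pdx s.u x t - s.ρ x t * s.θ x t))
    have h4 := mul_le_mul_of_nonneg_right hQ p3.le
    have h5 := mul_nonneg p3.le (sq_nonneg (pdx s.u x t))
    nlinarith)
  unfold SI
  rw [h1]
  linarith

theorem temp_bd (T q C₀ : ℝ) (hT : 0 < T) (hq : 0 < q) (hC : 1 ≤ C₀)
    (κ : ℝ → ℝ) (hκ : KappaHyp q C₀ κ) (A M : ℝ) (hM : 0 < M) :
    ∃ C : ℝ, 0 ≤ C ∧ ∀ (s : MHDSol T κ) (B : ℝ), InitBounds s A B M →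
      ∃ V : ℝ → ℝ, ContinuousOn V (Icc 0 T) ∧ (∀ t ∈ Icc (0:ℝ) T, 0 ≤ V t) ∧
        (∫ t in (0:ℝ)..T, V t) ≤ C ∧
        ∀ x ∈ Icc (0:ℝ) 1, ∀ t ∈ Icc (0:ℝ) T, s.θ x t ≤ C * (1 + V t) := by
  by_cases hA : 0 ≤ A
  swap
  · exact ⟨0, le_rfl, fun s B hI => absurd (init_all s hI hT).1 hA⟩
  obtain ⟨α, hα⟩ : ∃ α, α = min q 1 / 2 := ⟨_, rfl⟩
  have m1 : 0 < min q 1 := lt_min hq one_pos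
  have hα0 : 0 < α := by linarith
  have hα1 : α ≤ 1 / 2 := by linarith [min_le_right q 1]
  have hαq : α ≤ q := by linarith [min_le_left q 1]
  obtain ⟨p, hp⟩ : ∃ p, p = q + 1 - α := ⟨_, rfl⟩
  have hp1 : 1 ≤ p := by linarith
  have hE := EE_pos hA
  obtain ⟨R, hR⟩ : ∃ R, R = RR T A := ⟨_, rfl⟩
  have hR1 : 1 ≤ R := by rw [hR]; exact RR_one hT hA
  obtain ⟨E, hE'⟩ : ∃ E, E = EE A := ⟨_, rfl⟩
  rw [← hE'] at hE
  obtain ⟨c1, hc1⟩ : ∃ c, c = 2 * (E / M) ^ p := ⟨_, rfl⟩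
  have hc10 : 0 ≤ c1 := by rw [hc1]; positivity
  obtain ⟨c2, hc2⟩ : ∃ c, c = p ^ 2 * C₀ / 2 := ⟨_, rfl⟩
  have hc20 : 0 < c2 := by rw [hc2]; positivity
  obtain ⟨L, hL⟩ : ∃ L, L = (R * E * c2 / α) ^ (1 / q) := ⟨_, rfl⟩
  have hL0 : 0 < L := by rw [hL]; positivity
  have hLq : L ^ (-q) * (R * E * c2) = α := by
    rw [hL, ← rpow_mul (by positivity)]
    rw [show 1 / q * -q = -1 by field_simp, rpow_neg_one]
    field_simp
  obtain ⟨h, hh⟩ : ∃ h, h = 1 / 2 * (R * E) * (L ^ (1 - α) + L ^ (-q) * c1) := ⟨_, rfl⟩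
  have hh0 : 0 ≤ h := by rw [hh]; positivity
  obtain ⟨K, hK⟩ : ∃ K, K = 2 * (2 * A + E) := ⟨_, rfl⟩
  have hK0 : 0 ≤ K := by rw [hK]; positivity
  refine ⟨2 / α * (K + h * T) + (1 + c1) + c2, by positivity, fun s B hI => ?_⟩
  refine ⟨SI (s.v α), (s.v_cq hκ α).si_cont hT.le,
    fun t ht => int_nonneg (fun x hx => s.v_nn hκ hC α hx ht), ?_, ?_⟩
  · have ctf : CQ T (s.tf α) := by
      have k1 := s.th_cq (1 - α)
      unfold CQ MHDSol.tf at *; fun_prop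
    have ctf' : CQ T (s.tf' α) := by
      have k1 := s.th_cq (1 - α)
      have k2 := s.th_cq (-α)
      unfold CQ MHDSol.tf' at *; fun_prop
    have hb : ∀ t ∈ Icc (0:ℝ) T, 0 ≤ SI (s.tf α) t + K ∧ SI (s.tf α) t ≤ 0 := by
      intro t ht
      obtain ⟨k1, -, -⟩ := en_cons s hT hκ hI ht
      have k2 := (mass_bd s hT hI ht).2
      have cρ := (s.sm_ρ.cq T).slice ht
      have cρθ : ContinuousOn (fun x => s.ρ x t * s.θ x t) (Icc 0 1) := by fun_prop
      have key : ∀ x ∈ Icc (0:ℝ) 1, 0 ≤ - s.tf α x t ∧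
          - s.tf α x t ≤ 2 * s.ρ x t + 2 * (s.ρ x t * s.θ x t) + 0 := by
        intro x hx
        have p1 := s.ρ_pos x hx t ht
        have p2 := s.θ_pos x hx t ht
        have e := rpow_le_one_add (r := 1 - α) (p := 1) p2 (by linarith) (by linarith)
        rw [rpow_one] at e
        have e0 := rpow_pos_of_pos p2 (1 - α)
        have e1 : s.θ x t ^ (1 - α) / (1 - α) ≤ 2 * (1 + s.θ x t) := by
          rw [div_le_iff₀ (by linarith)]
          nlinarith
        have e2 : 0 < 1 - α := by linarith
        unfold MHDSol.tf
        constructor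
        · rw [neg_neg]; positivity
        · nlinarith
      have h1 := int_lin2 (f := fun x => - s.tf α x t) 2 2 0 (ctf.slice ht).neg cρ cρθ
        (fun x hx => (key x hx).2)
      have h2 : 0 ≤ ∫ x in (0:ℝ)..1, - s.tf α x t := int_nonneg (fun x hx => (key x hx).1)
      rw [intervalIntegral.integral_neg] at h1 h2
      unfold SI at *
      rw [hK, hE']
      constructor <;> linarith
    have h00 : (0:ℝ) ∈ Icc (0:ℝ) T := ⟨le_rfl, hT.le⟩
    have hG := (gronwall hT (y := SI (s.tf α)) (y' := SI (s.tf' α)) (g := fun _ => 0)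
      (h := fun _ => h) (d := fun t => α / 2 * SI (s.v α) t) (K := K) (Y0 := K) (Γ := 0)
      (H := h * T) (ctf'.si_cont hT.le)
      (fun t ht => ctf.ftc hT.le ctf' (fun x hx t ht => ?_) ht) continuousOn_const
      continuousOn_const (((s.v_cq hκ α).si_cont hT.le).const_mul _) (fun _ _ => le_rfl)
      (fun _ _ => hh0) ?_ (fun t ht => (hb t ht).1) ?_ (by linarith [(hb 0 h00).2])
      (by simp) (by simp [mul_comm])).2
    · rw [intervalIntegral.integral_const_mul] at hG
      have : (∫ t in (0:ℝ)..T, SI (s.v α) t) ≤ 2 / α * (K + h * T) := by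
        rw [div_mul_eq_mul_div, le_div_iff₀ hα0]
        linarith
      linarith
    · have p := s.θ_pos x hx t ht
      unfold MHDSol.tf MHDSol.tf'
      refine ((s.sm_ρ.ht x t).fun_mul
        ((hd_rpow (r := 1 - α) (r' := -α) (s.sm_θ.ht x t) p (by ring)).div_const
        (1 - α))).fun_neg.congr_deriv ?_
      have hne : 1 - α ≠ 0 := by linarith
      field_simp
    · intro t ht
      have := int_nonneg (fun x hx => s.v_nn hκ hC α hx ht)
      unfold SI
      positivity
    · intro t ht
      have h1 := temp_test s hκ (α := α) (by linarith) ht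
      obtain ⟨k1, -, -⟩ := en_cons s hT hκ hI ht
      set V := SI (s.v α) t with hV
      have hV0 : 0 ≤ V := int_nonneg (fun x hx => s.v_nn hκ hC α hx ht)
      have k1' := s.th_cq (1 - α)
      have c3 : CQ T (fun x t => s.ρ x t * (s.ρ x t * s.θ x t) * s.θ x t ^ (1 - α)) := by
        unfold CQ at *; fun_prop
      have cρθ : ContinuousOn (fun x => s.ρ x t * s.θ x t) (Icc 0 1) := by fun_prop
      have h2 := int_lin1 (R * (L ^ (1 - α) + L ^ (-q) * (c1 + c2 * V))) 0 (c3.slice ht) cρθ (by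
        intro x hx
        have p1 := s.ρ_pos x hx t ht
        have p2 := s.θ_pos x hx t ht
        have e1 := interp (α := α) p2 hL0 (by linarith) hq hp
        have e2 := th_p_bd s hT hκ hC hM hI hp (by linarith) hx ht
        rw [← hE', ← hc1, ← hc2, ← hV] at e2
        have e3 := mul_le_mul_of_nonneg_left e2 (rpow_pos_of_pos hL0 (-q)).le
        have e4 : s.θ x t ^ (1 - α) ≤ L ^ (1 - α) + L ^ (-q) * (c1 + c2 * V) := by linarith
        have e5 : s.ρ x t ≤ R := by rw [hR]; exact dens_bd s hT hκ hI hx ht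
        have e6 := mul_le_mul e5 e4 (rpow_pos_of_pos p2 _).le (by linarith)
        have e7 : 0 ≤ s.ρ x t * s.θ x t := by positivity
        have e8 := mul_le_mul_of_nonneg_right e6 e7
        linarith)
      have h3 : (∫ x in (0:ℝ)..1, s.ρ x t * s.θ x t) ≤ E := by rw [hE']; exact k1
      have h4 : 0 ≤ R * (L ^ (1 - α) + L ^ (-q) * (c1 + c2 * V)) := by positivity
      have h5 := mul_le_mul_of_nonneg_left h3 h4
      have h6 : R * (L ^ (1 - α) + L ^ (-q) * (c1 + c2 * V)) * E = 2 * h + α * V := by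
        rw [hh, ← hLq]; ring
      linarith
  · intro x hx t ht
    have p2 := s.θ_pos x hx t ht
    have e1 := rpow_le_one_add (r := 1) p2 zero_le_one hp1
    rw [rpow_one] at e1
    have e2 := th_p_bd s hT hκ hC hM hI hp (by linarith) hx ht
    rw [← hE', ← hc1, ← hc2] at e2
    have hV0 : 0 ≤ SI (s.v α) t := int_nonneg (fun x hx => s.v_nn hκ hC α hx ht)
    have e3 : 0 ≤ 2 / α * (K + h * T) := by positivity
    have e4 := mul_nonneg e3 hV0
    have e5 := mul_nonneg hc10 hV0
    nlinarith

end temp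


/-! ### Dissipation, magnetic field and transverse velocity -/

theorem tlin3 {T : ℝ} (hT : 0 ≤ T) {f g1 g2 g3 : ℝ → ℝ} (c1 c2 c3 c0 : ℝ)
    (hf : ContinuousOn f (Icc 0 T)) (h1 : ContinuousOn g1 (Icc 0 T))
    (h2 : ContinuousOn g2 (Icc 0 T)) (h3 : ContinuousOn g3 (Icc 0 T))
    (h : ∀ t ∈ Icc (0:ℝ) T, f t ≤ c1 * g1 t + c2 * g2 t + c3 * g3 t + c0) :
    (∫ t in (0:ℝ)..T, f t) ≤ c1 * (∫ t in (0:ℝ)..T, g1 t) + c2 * (∫ t in (0:ℝ)..T, g2 t)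
      + c3 * (∫ t in (0:ℝ)..T, g3 t) + c0 * T := by
  have hTT : T ∈ Icc (0:ℝ) T := ⟨hT, le_rfl⟩
  have i1 := (iit hT h1 hTT).const_mul c1
  have i2 := (iit hT h2 hTT).const_mul c2
  have i3 := (iit hT h3 hTT).const_mul c3
  have i0 : IntervalIntegrable (fun _ : ℝ => c0) volume 0 T := intervalIntegrable_const
  have := intervalIntegral.integral_mono_on hT (iit hT hf hTT) (((i1.add i2).add i3).add i0) h
  rw [intervalIntegral.integral_add ((i1.add i2).add i3) i0,
    intervalIntegral.integral_add (i1.add i2) i3, intervalIntegral.integral_add i1 i2] at this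
  simp only [intervalIntegral.integral_const_mul, intervalIntegral.integral_const, sub_zero,
    smul_eq_mul] at this
  linarith

theorem tlin1 {T : ℝ} (hT : 0 ≤ T) {f g1 : ℝ → ℝ} (c1 c0 : ℝ)
    (hf : ContinuousOn f (Icc 0 T)) (h1 : ContinuousOn g1 (Icc 0 T))
    (h : ∀ t ∈ Icc (0:ℝ) T, f t ≤ c1 * g1 t + c0) :
    (∫ t in (0:ℝ)..T, f t) ≤ c1 * (∫ t in (0:ℝ)..T, g1 t) + c0 * T := by
  have := tlin3 hT c1 0 0 c0 hf h1 h1 h1 (fun t ht => by linarith [h t ht])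
  linarith

section est
variable {T : ℝ} {κ : ℝ → ℝ}

/-- Kinetic and magnetic energy. -/
def MHDSol.ke (s : MHDSol T κ) (x t : ℝ) : ℝ :=
  s.ρ x t * (s.u x t ^ 2 / 2 + s.w 0 x t ^ 2 / 2 + s.w 1 x t ^ 2 / 2)
    + (s.b 0 x t ^ 2 / 2 + s.b 1 x t ^ 2 / 2)

/-- Its time derivative. -/
def MHDSol.ket (s : MHDSol T κ) (x t : ℝ) : ℝ :=
  pdt s.ρ x t * (s.u x t ^ 2 / 2 + s.w 0 x t ^ 2 / 2 + s.w 1 x t ^ 2 / 2)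
    + s.ρ x t * (s.u x t * pdt s.u x t + s.w 0 x t * pdt (s.w 0) x t
      + s.w 1 x t * pdt (s.w 1) x t)
    + (s.b 0 x t * pdt (s.b 0) x t + s.b 1 x t * pdt (s.b 1) x t)

/-- Squared pressure. -/
def MHDSol.P2 (s : MHDSol T κ) (x t : ℝ) : ℝ := (s.ρ x t * s.θ x t) ^ 2

theorem MHDSol.P2_cq (s : MHDSol T κ) : CQ T s.P2 := by
  unfold CQ MHDSol.P2; fun_prop

theorem ke_int (s : MHDSol T κ) {r : ℝ} (hr : r ∈ Icc (0:ℝ) T) :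
    SI s.ket r + 1 / 2 * SI s.Q r ≤ 1 / 2 * SI s.P2 r := by
  have c1 : CQ T s.ket := by unfold CQ MHDSol.ket; fun_prop
  have cQ := s.Q_cq
  have c2 : CQ T (fun x t => s.ρ x t * s.θ x t * pdx s.u x t - s.Q x t) := by
    unfold CQ at *; fun_prop
  have h1 := flux_eq (G := fun x => -(s.ρ x r * s.u x r * (s.u x r ^ 2 / 2
      + s.w 0 x r ^ 2 / 2 + s.w 1 x r ^ 2 / 2)) - s.u x r * (s.ρ x r * s.θ x r)
      + s.u x r * pdx s.u x r + (s.w 0 x r * pdx (s.w 0) x r + s.w 1 x r * pdx (s.w 1) x r)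
      + (s.b 0 x r * pdx (s.b 0) x r + s.b 1 x r * pdx (s.b 1) x r)
      - s.u x r * (s.b 0 x r ^ 2 + s.b 1 x r ^ 2)
      + (s.w 0 x r * s.b 0 x r + s.w 1 x r * s.b 1 x r)) (c1.slice hr) (c2.slice hr) (by
      intro x hx
      refine ((((((((((s.sm_ρ.hx x r).fun_mul (s.sm_u.hx x r)).fun_mul
        (((
        ((hd_sq (s.sm_u.hx x r)).div_const 2)).fun_add
        ((hd_sq ((s.sm_w 0).hx x r)).div_const 2)).fun_add
        ((hd_sq ((s.sm_w 1).hx x r)).div_const 2))).fun_neg).fun_sub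
        ((s.sm_u.hx x r).fun_mul ((s.sm_ρ.hx x r).fun_mul (s.sm_θ.hx x r)))).fun_add
        ((s.sm_u.hx x r).fun_mul (s.sm_u.pdx.hx x r))).fun_add
        ((((s.sm_w 0).hx x r).fun_mul ((s.sm_w 0).pdx.hx x r)).fun_add
        (((s.sm_w 1).hx x r).fun_mul ((s.sm_w 1).pdx.hx x r)))).fun_add
        ((((s.sm_b 0).hx x r).fun_mul ((s.sm_b 0).pdx.hx x r)).fun_add
        (((s.sm_b 1).hx x r).fun_mul ((s.sm_b 1).pdx.hx x r)))).fun_sub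
        ((s.sm_u.hx x r).fun_mul ((hd_sq ((s.sm_b 0).hx x r)).fun_add
        (hd_sq ((s.sm_b 1).hx x r))))).fun_add
        ((((s.sm_w 0).hx x r).fun_mul ((s.sm_b 0).hx x r)).fun_add
        (((s.sm_w 1).hx x r).fun_mul ((s.sm_b 1).hx x r)))).congr_deriv ?_
      unfold MHDSol.ket MHDSol.Q
      linear_combination (-(s.u x r ^ 2 / 2 + s.w 0 x r ^ 2 / 2 + s.w 1 x r ^ 2 / 2))
        * s.e_ρ hx hr - s.u x r * s.e_u hx hr - s.w 0 x r * s.e_w 0 hx hr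
        - s.w 1 x r * s.e_w 1 hx hr - s.b 0 x r * s.e_b 0 hx hr - s.b 1 x r * s.e_b 1 hx hr)
      (by simp [(s.bc_u r hr).1, (s.bc_w 0 r hr).1, (s.bc_w 1 r hr).1, (s.bc_b 0 r hr).1,
        (s.bc_b 1 r hr).1])
      (by simp [(s.bc_u r hr).2, (s.bc_w 0 r hr).2, (s.bc_w 1 r hr).2, (s.bc_b 0 r hr).2,
        (s.bc_b 1 r hr).2])
  have h2 := int_lin2 (1 / 2) (-1 / 2) 0 (c2.slice hr) (s.P2_cq.slice hr) (cQ.slice hr) (by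
    intro x hx
    have hQ : pdx s.u x r ^ 2 ≤ s.Q x r := by
      unfold MHDSol.Q
      nlinarith [sq_nonneg (pdx (s.w 0) x r), sq_nonneg (pdx (s.w 1) x r),
        sq_nonneg (pdx (s.b 0) x r), sq_nonneg (pdx (s.b 1) x r)]
    unfold MHDSol.P2
    nlinarith [sq_nonneg (s.ρ x r * s.θ x r - pdx s.u x r)])
  unfold SI
  rw [h1]
  linarith

theorem diss_bd (T q C₀ : ℝ) (hT : 0 < T) (hq : 0 < q) (hC : 1 ≤ C₀)
    (κ : ℝ → ℝ) (hκ : KappaHyp q C₀ κ) (A M : ℝ) (hM : 0 < M) :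
    ∃ C : ℝ, 0 ≤ C ∧ ∀ (s : MHDSol T κ) (B : ℝ), InitBounds s A B M →
      (∫ t in (0:ℝ)..T, SI s.P2 t) ≤ C ∧ (∫ t in (0:ℝ)..T, SI s.Q t) ≤ C := by
  by_cases hA : 0 ≤ A
  swap
  · exact ⟨0, le_rfl, fun s B hI => absurd (init_all s hI hT).1 hA⟩
  have hE := EE_pos hA
  have hR1 := RR_one hT hA
  obtain ⟨C1, hC1, hV⟩ := temp_bd T q C₀ hT hq hC κ hκ A M hM
  obtain ⟨D, hD⟩ : ∃ D, D = RR T A * EE A * C1 := ⟨_, rfl⟩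
  have hD0 : 0 ≤ D := by rw [hD]; positivity
  have hT0 := hT.le
  refine ⟨D * C1 + D * T + 2 * EE A, by positivity, fun s B hI => ?_⟩
  obtain ⟨V, cV, V0, hVi, hθ⟩ := hV s B hI
  have hP : (∫ t in (0:ℝ)..T, SI s.P2 t) ≤ D * C1 + D * T := by
    have := tlin1 hT0 D D (s.P2_cq.si_cont hT0) cV (by
      intro t ht
      have k1 := (en_cons s hT hκ hI ht).1
      have := int_lin1 (f := fun x => s.P2 x t) (g1 := fun x => s.ρ x t * s.θ x t)
        (RR T A * (C1 * (1 + V t))) 0 (s.P2_cq.slice ht) (by fun_prop) (by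
        intro x hx
        have p1 := s.ρ_pos x hx t ht
        have p2 := s.θ_pos x hx t ht
        have e := mul_le_mul (dens_bd s hT hκ hI hx ht) (hθ x hx t ht) p2.le (by linarith)
        have e2 : 0 ≤ s.ρ x t * s.θ x t := by positivity
        have e3 := mul_le_mul_of_nonneg_right e e2
        unfold MHDSol.P2
        nlinarith)
      have hv0 := V0 t ht
      have e4 : 0 ≤ RR T A * (C1 * (1 + V t)) := by positivity
      have e5 := mul_le_mul_of_nonneg_left k1 e4
      unfold SI at *
      rw [hD]
      nlinarith)
    have e := mul_le_mul_of_nonneg_left hVi hD0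
    linarith
  refine ⟨by linarith, ?_⟩
  have h00 : (0:ℝ) ∈ Icc (0:ℝ) T := ⟨le_rfl, hT0⟩
  have c1 : CQ T s.ke := by unfold CQ MHDSol.ke; fun_prop
  have c2 : CQ T s.ket := by unfold CQ MHDSol.ket; fun_prop
  have nn : ∀ t ∈ Icc (0:ℝ) T, 0 ≤ SI s.ke t := fun t ht => int_nonneg (fun x hx => by
    have p1 := s.ρ_pos x hx t ht
    unfold MHDSol.ke; positivity)
  have hG := (gronwall hT (y := SI s.ke) (y' := SI s.ket) (g := fun _ => 0)
      (h := fun t => 1 / 2 * SI s.P2 t) (d := fun t => 1 / 2 * SI s.Q t) (K := 0) (Y0 := EE A)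
      (Γ := 0) (H := 1 / 2 * (D * C1 + D * T)) (c2.si_cont hT0)
      (fun t ht => c1.ftc hT0 c2 (fun x hx t ht => ?_) ht) continuousOn_const
      ((s.P2_cq.si_cont hT0).const_mul _) ((s.Q_cq.si_cont hT0).const_mul _) (fun _ _ => le_rfl)
      ?_ ?_ (fun t ht => by linarith [nn t ht]) ?_ ?_
      (by simp) ?_).2
  · rw [intervalIntegral.integral_const_mul] at hG
    linarith
  · unfold MHDSol.ke MHDSol.ket
    exact (((s.sm_ρ.ht x t).fun_mul (((
      ((hd_sq (s.sm_u.ht x t)).div_const 2)).fun_add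
      ((hd_sq ((s.sm_w 0).ht x t)).div_const 2)).fun_add
      ((hd_sq ((s.sm_w 1).ht x t)).div_const 2))).fun_add
      (((hd_sq ((s.sm_b 0).ht x t)).div_const 2).fun_add
      ((hd_sq ((s.sm_b 1).ht x t)).div_const 2))).congr_deriv (by ring)
  · intro t ht
    have : 0 ≤ SI s.P2 t := int_nonneg (fun x hx => by unfold MHDSol.P2; positivity)
    positivity
  · intro t ht
    have : 0 ≤ SI s.Q t := int_nonneg (fun x hx => s.Q_nn x t)
    positivity
  · intro t ht
    have := ke_int s ht
    linarith
  · have h1 := en_bd s hT hκ hI h00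
    have c3 : CQ T s.en := by unfold CQ MHDSol.en; fun_prop
    have h2 := int_le (c1.slice h00) (c3.slice h00) (fun x hx => by
      have p1 := s.ρ_pos x hx 0 h00
      have p2 := s.θ_pos x hx 0 h00
      have : 0 < s.ρ x 0 * s.θ x 0 := by positivity
      unfold MHDSol.ke MHDSol.en
      nlinarith)
    unfold SI at *
    linarith
  · rw [intervalIntegral.integral_const_mul]
    linarith

/-! #### The magnetic field -/

/-- Squares of derivatives. -/
def sqx (f : ℝ → ℝ → ℝ) (x t : ℝ) : ℝ := pdx f x t ^ 2

theorem sqx_cq {f : ℝ → ℝ → ℝ} (hf : Sm f) : CQ T (sqx f) := (hf.pdx.cq T).pow 2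

theorem sqx_nn (f : ℝ → ℝ → ℝ) (t : ℝ) : 0 ≤ SI (sqx f) t :=
  int_nonneg (fun x _ => by unfold sqx; positivity)

theorem sqx_sup {f : ℝ → ℝ → ℝ} (hf : Sm f) {t : ℝ} (h0 : f 0 t = 0) {x : ℝ}
    (hx : x ∈ Icc (0:ℝ) 1) : f x t ^ 2 ≤ SI (sqx f) t := by
  have c : ContinuousOn (fun y => pdx f y t) (Icc 0 1) :=
    (hf.pdx.cont.comp (continuous_id.prodMk continuous_const)).continuousOn
  exact sob0 c (fun x _ => hf.hx x t) h0 hx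

theorem sqx_le_Q (s : MHDSol T κ) {t : ℝ} (ht : t ∈ Icc (0:ℝ) T) :
    SI (sqx s.u) t ≤ SI s.Q t ∧ (∀ i, SI (sqx (s.w i)) t ≤ SI s.Q t) ∧
    (∀ i, SI (sqx (s.b i)) t ≤ SI s.Q t) := by
  have key : ∀ f : ℝ → ℝ → ℝ, Sm f → (∀ x, pdx f x t ^ 2 ≤ s.Q x t) →
      SI (sqx f) t ≤ SI s.Q t := fun f hf h =>
    int_le ((sqx_cq hf).slice ht) (s.Q_cq.slice ht) (fun x _ => h x)
  refine ⟨key _ s.sm_u fun x => ?_, fun i => key _ (s.sm_w i) fun x => ?_,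
    fun i => key _ (s.sm_b i) fun x => ?_⟩
  · unfold MHDSol.Q
    nlinarith [sq_nonneg (pdx (s.w 0) x t), sq_nonneg (pdx (s.w 1) x t),
        sq_nonneg (pdx (s.b 0) x t), sq_nonneg (pdx (s.b 1) x t)]
  · unfold MHDSol.Q
    fin_cases i <;> simp <;> nlinarith [sq_nonneg (pdx (s.w 0) x t), sq_nonneg (pdx (s.w 1) x t),
        sq_nonneg (pdx (s.b 0) x t), sq_nonneg (pdx (s.b 1) x t), sq_nonneg (pdx s.u x t)]
  · unfold MHDSol.Q
    fin_cases i <;> simp <;> nlinarith [sq_nonneg (pdx (s.w 0) x t), sq_nonneg (pdx (s.w 1) x t),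
        sq_nonneg (pdx (s.b 0) x t), sq_nonneg (pdx (s.b 1) x t), sq_nonneg (pdx s.u x t)]

/-- Square of the time derivative. -/
def sqt (f : ℝ → ℝ → ℝ) (x t : ℝ) : ℝ := pdt f x t ^ 2

theorem sqt_cq {f : ℝ → ℝ → ℝ} (hf : Sm f) : CQ T (sqt f) := (hf.pdt.cq T).pow 2

theorem sqt_nn (f : ℝ → ℝ → ℝ) (t : ℝ) : 0 ≤ SI (sqt f) t :=
  int_nonneg (fun x _ => by unfold sqt; positivity)

theorem b_ineq (s : MHDSol T κ) (hT : 0 < T) (i : Fin 2) {t : ℝ} (ht : t ∈ Icc (0:ℝ) T) :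
    SI (fun x t => pdx (s.b i) x t * pdt (pdx (s.b i)) x t) t + 1 / 2 * SI (sqx (pdx (s.b i))) t
      ≤ 3 / 2 * SI (sqx (s.w i)) t + 3 * SI (sqx s.u) t * SI (sqx (s.b i)) t := by
  have cu := (sqx_cq (T := T) s.sm_u).slice ht
  have cw := (sqx_cq (T := T) (s.sm_w i)).slice ht
  have cb := (sqx_cq (T := T) (s.sm_b i)).slice ht
  have cbb := (sqx_cq (T := T) (s.sm_b i).pdx).slice ht
  have h1 := flux_eq (f' := fun x => pdx (s.b i) x t * pdt (pdx (s.b i)) x t)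
    (e := fun x => - (pdx (pdx (s.b i)) x t * pdt (s.b i) x t))
    (G := fun x => pdx (s.b i) x t * pdt (s.b i) x t) (by fun_prop) (by fun_prop) (by
    intro x hx
    refine ((((s.sm_b i).pdx.hx x t)).fun_mul ((s.sm_b i).pdt.hx x t)).congr_deriv ?_
    rw [(s.sm_b i).comm]; ring)
    (by rw [bdry_t (s.sm_b i) hT (fun t ht => (s.bc_b i t ht).1) t ht]; simp)
    (by rw [bdry_t (s.sm_b i) hT (fun t ht => (s.bc_b i t ht).2) t ht]; simp)
  obtain ⟨a, ha⟩ : ∃ a, a = SI (sqx s.u) t := ⟨_, rfl⟩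
  obtain ⟨y, hy⟩ : ∃ y, y = SI (sqx (s.b i)) t := ⟨_, rfl⟩
  have h2 := int_lin (n := 4) (f := fun x => - (pdx (pdx (s.b i)) x t * pdt (s.b i) x t))
    ![fun x => sqx (pdx (s.b i)) x t, fun x => sqx (s.w i) x t, fun x => sqx s.u x t,
      fun x => sqx (s.b i) x t] ![-1 / 2, 3 / 2, 3 / 2 * y, 3 / 2 * a] 0 (by fun_prop)
      (by intro i; fin_cases i <;> simpa) (by
    intro x hx
    have e1 : s.u x t ^ 2 ≤ a := by rw [ha]; exact sqx_sup s.sm_u (s.bc_u t ht).1 hx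
    have e2 : s.b i x t ^ 2 ≤ y := by rw [hy]; exact sqx_sup (s.sm_b i) (s.bc_b i t ht).1 hx
    have e3 := s.e_b i hx ht
    have e4 := mul_le_mul_of_nonneg_right e1 (sq_nonneg (pdx (s.b i) x t))
    have e5 := mul_le_mul_of_nonneg_right e2 (sq_nonneg (pdx s.u x t))
    simp [Fin.sum_univ_succ, sqx]
    obtain ⟨X, hX⟩ : ∃ X, X = pdx (pdx (s.b i)) x t := ⟨_, rfl⟩
    obtain ⟨p1, hp1⟩ : ∃ X, X = pdx s.u x t * s.b i x t := ⟨_, rfl⟩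
    obtain ⟨p2, hp2⟩ : ∃ X, X = s.u x t * pdx (s.b i) x t := ⟨_, rfl⟩
    rw [← hX, ← hp1, ← hp2] at e3
    have e6 : pdt (s.b i) x t = X + pdx (s.w i) x t - p1 - p2 := by linarith
    rw [← hX, e6]
    have e4' : p2 ^ 2 ≤ a * pdx (s.b i) x t ^ 2 := by rw [hp2, mul_pow]; exact e4
    have e5' : p1 ^ 2 ≤ y * pdx s.u x t ^ 2 := by
      rw [hp1, mul_pow, mul_comm]; exact e5
    nlinarith [sq_nonneg (X + pdx (s.w i) x t - p1 - p2), sq_nonneg (pdx (s.w i) x t + p1),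
      sq_nonneg (pdx (s.w i) x t + p2), sq_nonneg (p1 - p2)])
  simp [Fin.sum_univ_succ] at h2
  unfold SI at *
  rw [h1]
  simp only [intervalIntegral.integral_neg]
  rw [ha, hy] at h2; linarith

theorem bt_ineq (s : MHDSol T κ) (i : Fin 2) {t : ℝ} (ht : t ∈ Icc (0:ℝ) T) :
    SI (sqt (s.b i)) t ≤ 4 * SI (sqx (pdx (s.b i))) t
      + 4 * SI (sqx (s.w i)) t + 8 * SI (sqx s.u) t * SI (sqx (s.b i)) t := by
  have cu := (sqx_cq (T := T) s.sm_u).slice ht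
  have cw := (sqx_cq (T := T) (s.sm_w i)).slice ht
  have cb := (sqx_cq (T := T) (s.sm_b i)).slice ht
  have cbb := (sqx_cq (T := T) (s.sm_b i).pdx).slice ht
  have ct := (sqt_cq (T := T) (s.sm_b i)).slice ht
  obtain ⟨a, ha⟩ : ∃ a, a = SI (sqx s.u) t := ⟨_, rfl⟩
  obtain ⟨y, hy⟩ : ∃ y, y = SI (sqx (s.b i)) t := ⟨_, rfl⟩
  have h2 := int_lin (n := 4) (f := fun x => sqt (s.b i) x t)
    ![fun x => sqx (pdx (s.b i)) x t, fun x => sqx (s.w i) x t, fun x => sqx s.u x t,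
      fun x => sqx (s.b i) x t] ![4, 4, 4 * y, 4 * a] 0 ct
      (by intro i; fin_cases i <;> simpa) (by
    intro x hx
    have e1 : s.u x t ^ 2 ≤ a := by rw [ha]; exact sqx_sup s.sm_u (s.bc_u t ht).1 hx
    have e2 : s.b i x t ^ 2 ≤ y := by rw [hy]; exact sqx_sup (s.sm_b i) (s.bc_b i t ht).1 hx
    have e3 := s.e_b i hx ht
    have e4 := mul_le_mul_of_nonneg_right e1 (sq_nonneg (pdx (s.b i) x t))
    have e5 := mul_le_mul_of_nonneg_right e2 (sq_nonneg (pdx s.u x t))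
    simp [Fin.sum_univ_succ, sqx, sqt]
    obtain ⟨X, hX⟩ : ∃ X, X = pdx (pdx (s.b i)) x t := ⟨_, rfl⟩
    obtain ⟨p1, hp1⟩ : ∃ X, X = pdx s.u x t * s.b i x t := ⟨_, rfl⟩
    obtain ⟨p2, hp2⟩ : ∃ X, X = s.u x t * pdx (s.b i) x t := ⟨_, rfl⟩
    rw [← hX, ← hp1, ← hp2] at e3
    have e6 : pdt (s.b i) x t = X + pdx (s.w i) x t - p1 - p2 := by linarith
    rw [← hX, e6]
    have e4' : p2 ^ 2 ≤ a * pdx (s.b i) x t ^ 2 := by rw [hp2, mul_pow]; exact e4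
    have e5' : p1 ^ 2 ≤ y * pdx s.u x t ^ 2 := by
      rw [hp1, mul_pow, mul_comm]; exact e5
    nlinarith [sq_nonneg (X - pdx (s.w i) x t), sq_nonneg (X + p1), sq_nonneg (X + p2),
      sq_nonneg (pdx (s.w i) x t + p1), sq_nonneg (pdx (s.w i) x t + p2), sq_nonneg (p1 - p2)])
  simp [Fin.sum_univ_succ] at h2
  unfold SI at *
  rw [ha, hy] at h2; linarith

theorem b_bd (T q C₀ : ℝ) (hT : 0 < T) (hq : 0 < q) (hC : 1 ≤ C₀)
    (κ : ℝ → ℝ) (hκ : KappaHyp q C₀ κ) (A M : ℝ) (hM : 0 < M) :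
    ∃ C : ℝ, 0 ≤ C ∧ ∀ (s : MHDSol T κ) (B : ℝ), InitBounds s A B M → ∀ i,
      (∀ t ∈ Icc (0:ℝ) T, SI (sqx (s.b i)) t ≤ C) ∧
      (∫ t in (0:ℝ)..T, SI (sqx (pdx (s.b i))) t) ≤ C ∧
      (∫ t in (0:ℝ)..T, SI (sqt (s.b i)) t) ≤ C := by
  obtain ⟨D, hD0, hD⟩ := diss_bd T q C₀ hT hq hC κ hκ A M hM
  have hT0 := hT.le
  have h00 : (0:ℝ) ∈ Icc (0:ℝ) T := ⟨le_rfl, hT0⟩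
  obtain ⟨Y, hY⟩ : ∃ Y, Y = 2 * ((A ^ 2 / 2 + 3 / 2 * D) * exp (6 * D)) := ⟨_, rfl⟩
  have hY0 : 0 ≤ Y := by rw [hY]; positivity
  obtain ⟨Z, hZ⟩ : ∃ Z, Z = 2 * (A ^ 2 / 2 + 3 / 2 * D + 6 * D * (Y / 2)) := ⟨_, rfl⟩
  have hZ0 : 0 ≤ Z := by rw [hZ]; positivity
  refine ⟨Y + (4 * Z + 4 * D + 8 * Y * D), by positivity, fun s B hI i => ?_⟩
  obtain ⟨-, hQ⟩ := hD s B hI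
  have cu := (sqx_cq (T := T) s.sm_u).si_cont hT0
  have cw := (sqx_cq (T := T) (s.sm_w i)).si_cont hT0
  have cb := (sqx_cq (T := T) (s.sm_b i)).si_cont hT0
  have cbb := (sqx_cq (T := T) (s.sm_b i).pdx).si_cont hT0
  have cbt := (sqt_cq (T := T) (s.sm_b i)).si_cont hT0
  have cQ := s.Q_cq.si_cont hT0
  have iu : (∫ t in (0:ℝ)..T, SI (sqx s.u) t) ≤ D := by
    have := tlin1 hT0 1 0 cu cQ (fun t ht => by linarith [(sqx_le_Q s ht).1])
    linarith
  have iw : (∫ t in (0:ℝ)..T, SI (sqx (s.w i)) t) ≤ D := by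
    have := tlin1 hT0 1 0 cw cQ (fun t ht => by linarith [(sqx_le_Q s ht).2.1 i])
    linarith
  have e : ∀ t, SI (fun x t => pdx (s.b i) x t ^ 2 / 2) t = SI (sqx (s.b i)) t / 2 := fun t => by
    unfold SI sqx
    rw [intervalIntegral.integral_div]
  have c1 : CQ T (fun x t => pdx (s.b i) x t ^ 2 / 2) := by unfold CQ; fun_prop
  have c2 : CQ T (fun x t => pdx (s.b i) x t * pdt (pdx (s.b i)) x t) := by unfold CQ; fun_prop
  have hG := gronwall hT (y := SI (fun x t => pdx (s.b i) x t ^ 2 / 2))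
    (y' := SI (fun x t => pdx (s.b i) x t * pdt (pdx (s.b i)) x t))
    (g := fun t => 6 * SI (sqx s.u) t) (h := fun t => 3 / 2 * SI (sqx (s.w i)) t)
    (d := fun t => 1 / 2 * SI (sqx (pdx (s.b i))) t) (K := 0) (Y0 := A ^ 2 / 2) (Γ := 6 * D)
    (H := 3 / 2 * D) (c2.si_cont hT0)
    (fun t ht => c1.ftc hT0 c2 (fun x hx t ht =>
      ((hd_sq ((s.sm_b i).pdx.ht x t)).div_const 2).congr_deriv (by ring)) ht)
    (cu.const_mul _) (cw.const_mul _) (cbb.const_mul _)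
    (fun t _ => by have := sqx_nn s.u t; positivity)
    (fun t _ => by have := sqx_nn (s.w i) t; positivity)
    (fun t _ => by have := sqx_nn (pdx (s.b i)) t; positivity)
    (fun t _ => by rw [e]; have := sqx_nn (s.b i) t; positivity)
    (fun t ht => by
      have := b_ineq s hT i ht
      rw [e]
      linarith)
    (by
      rw [e]
      have := (init_one (s.sm_b i) (hI.2.2.2.2.1 i)).1
      unfold SI sqx
      linarith)
    (by rw [intervalIntegral.integral_const_mul]; linarith)
    (by rw [intervalIntegral.integral_const_mul]; linarith)
  obtain ⟨g1, g2⟩ := hG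
  have hb : ∀ t ∈ Icc (0:ℝ) T, SI (sqx (s.b i)) t ≤ Y := fun t ht => by
    have := g1 t ht
    rw [e] at this
    rw [hY]; linarith
  have hbb : (∫ t in (0:ℝ)..T, SI (sqx (pdx (s.b i))) t) ≤ Z := by
    rw [intervalIntegral.integral_const_mul] at g2
    rw [hZ, hY]; linarith
  have hbt : (∫ t in (0:ℝ)..T, SI (sqt (s.b i)) t) ≤ 4 * Z + 4 * D + 8 * Y * D := by
    have := tlin3 hT0 4 4 (8 * Y) 0 cbt cbb cw cu (by
      intro t ht
      have h1 := bt_ineq s i ht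
      have h2 := mul_le_mul_of_nonneg_left (hb t ht) (sqx_nn s.u t)
      linarith)
    have h3 := mul_le_mul_of_nonneg_left iu hY0
    linarith
  have : 0 ≤ Y * D := by positivity
  refine ⟨fun t ht => by linarith [hb t ht], by linarith, by linarith⟩

/-! #### The transverse velocity -/

/-- Weighted square of the time derivative. -/
def MHDSol.rsq (s : MHDSol T κ) (f : ℝ → ℝ → ℝ) (x t : ℝ) : ℝ := s.ρ x t * pdt f x t ^ 2

theorem MHDSol.rsq_cq (s : MHDSol T κ) {f : ℝ → ℝ → ℝ} (hf : Sm f) : CQ T (s.rsq f) :=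
  (s.sm_ρ.cq T).mul ((hf.pdt.cq T).pow 2)

theorem MHDSol.rsq_nn (s : MHDSol T κ) (f : ℝ → ℝ → ℝ) {t : ℝ} (ht : t ∈ Icc (0:ℝ) T) :
    0 ≤ SI (s.rsq f) t :=
  int_nonneg (fun x hx => by have := s.ρ_pos x hx t ht; unfold MHDSol.rsq; positivity)

/-- Time derivative of the functional. -/
def MHDSol.wf' (s : MHDSol T κ) (i : Fin 2) (x t : ℝ) : ℝ :=
  pdx (s.w i) x t * pdt (pdx (s.w i)) x t + pdt (s.b i) x t * pdx (s.w i) x t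
    + s.b i x t * pdt (pdx (s.w i)) x t

theorem w_ineq (s : MHDSol T κ) (hT : 0 < T) {R : ℝ}
    (hR : ∀ x ∈ Icc (0:ℝ) 1, ∀ t ∈ Icc (0:ℝ) T, s.ρ x t ≤ R) (i : Fin 2) {t : ℝ}
    (ht : t ∈ Icc (0:ℝ) T) :
    SI (s.wf' i) t + 1 / 2 * SI (s.rsq (s.w i)) t
      ≤ (1 / 2 * R * SI (sqx s.u) t + 1 / 2) * SI (sqx (s.w i)) t + 1 / 2 * SI (sqt (s.b i)) t := by
  have cw := (sqx_cq (T := T) (s.sm_w i)).slice ht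
  have cr := (s.rsq_cq (s.sm_w i)).slice ht
  have ct := (sqt_cq (T := T) (s.sm_b i)).slice ht
  have h1 := flux_eq (f' := fun x => s.wf' i x t)
    (e := fun x => - (s.ρ x t * pdt (s.w i) x t ^ 2)
      - s.ρ x t * s.u x t * pdx (s.w i) x t * pdt (s.w i) x t + pdt (s.b i) x t * pdx (s.w i) x t)
    (G := fun x => pdx (s.w i) x t * pdt (s.w i) x t + s.b i x t * pdt (s.w i) x t)
    (by unfold MHDSol.wf'; fun_prop) (by fun_prop) (by
    intro x hx
    refine (((((s.sm_w i).pdx.hx x t)).fun_mul ((s.sm_w i).pdt.hx x t)).fun_add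
      ((((s.sm_b i).hx x t)).fun_mul ((s.sm_w i).pdt.hx x t))).congr_deriv ?_
    unfold MHDSol.wf'
    rw [(s.sm_w i).comm]
    linear_combination -pdt (s.w i) x t * s.e_w i hx ht)
    (by rw [bdry_t (s.sm_w i) hT (fun t ht => (s.bc_w i t ht).1) t ht]; simp)
    (by rw [bdry_t (s.sm_w i) hT (fun t ht => (s.bc_w i t ht).2) t ht]; simp)
  obtain ⟨a, ha⟩ : ∃ a, a = SI (sqx s.u) t := ⟨_, rfl⟩
  have h2 := int_lin3 (f := fun x => - (s.ρ x t * pdt (s.w i) x t ^ 2)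
      - s.ρ x t * s.u x t * pdx (s.w i) x t * pdt (s.w i) x t + pdt (s.b i) x t * pdx (s.w i) x t)
    (-1 / 2) (1 / 2 * R * a + 1 / 2) (1 / 2) 0 (by fun_prop) cr cw ct (by
    intro x hx
    have p := s.ρ_pos x hx t ht
    have e0 := hR x hx t ht
    have e1 : s.u x t ^ 2 ≤ a := by rw [ha]; exact sqx_sup s.sm_u (s.bc_u t ht).1 hx
    have e2 := mul_le_mul e0 e1 (sq_nonneg _) (by linarith)
    have e3 := mul_le_mul_of_nonneg_right e2 (sq_nonneg (pdx (s.w i) x t))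
    have e4 := mul_nonneg p.le (sq_nonneg (pdt (s.w i) x t + s.u x t * pdx (s.w i) x t))
    unfold MHDSol.rsq sqx sqt
    nlinarith [sq_nonneg (pdt (s.b i) x t - pdx (s.w i) x t)])
  rw [← ha]
  unfold SI at *
  rw [h1]
  linarith

theorem w_bd (T q C₀ : ℝ) (hT : 0 < T) (hq : 0 < q) (hC : 1 ≤ C₀)
    (κ : ℝ → ℝ) (hκ : KappaHyp q C₀ κ) (A M : ℝ) (hM : 0 < M) :
    ∃ C : ℝ, 0 ≤ C ∧ ∀ (s : MHDSol T κ) (B : ℝ), InitBounds s A B M → ∀ i,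
      (∀ t ∈ Icc (0:ℝ) T, SI (sqx (s.w i)) t ≤ C) ∧
      (∫ t in (0:ℝ)..T, SI (s.rsq (s.w i)) t) ≤ C := by
  by_cases hA : 0 ≤ A
  swap
  · exact ⟨0, le_rfl, fun s B hI => absurd (init_all s hI hT).1 hA⟩
  obtain ⟨D, hD0, hD⟩ := diss_bd T q C₀ hT hq hC κ hκ A M hM
  obtain ⟨b, hb0, hb⟩ := b_bd T q C₀ hT hq hC κ hκ A M hM
  have hT0 := hT.le
  have h00 : (0:ℝ) ∈ Icc (0:ℝ) T := ⟨le_rfl, hT0⟩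
  have hR1 := RR_one hT hA
  obtain ⟨R, hR⟩ : ∃ R, R = RR T A := ⟨_, rfl⟩
  rw [← hR] at hR1
  obtain ⟨Γ, hΓ⟩ : ∃ Y, Y = 2 * R * D + 2 * T := ⟨_, rfl⟩
  have hΓ0 : 0 ≤ Γ := by rw [hΓ]; positivity
  obtain ⟨Y, hY⟩ : ∃ Y, Y = (A ^ 2 + 2 * b + 1 / 2 * b) * exp Γ := ⟨_, rfl⟩
  have hY0 : 0 ≤ Y := by rw [hY]; positivity
  refine ⟨4 * Y + 2 * (A ^ 2 + 2 * b + 1 / 2 * b + Γ * Y), by positivity, fun s B hI i => ?_⟩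
  obtain ⟨-, hQ⟩ := hD s B hI
  obtain ⟨hb1, -, hb3⟩ := hb s B hI i
  have cu := (sqx_cq (T := T) s.sm_u).si_cont hT0
  have cw := (sqx_cq (T := T) (s.sm_w i)).si_cont hT0
  have cr := (s.rsq_cq (s.sm_w i)).si_cont hT0
  have cbt := (sqt_cq (T := T) (s.sm_b i)).si_cont hT0
  have cQ := s.Q_cq.si_cont hT0
  have c1 : CQ T (fun x t => pdx (s.w i) x t ^ 2 / 2 + s.b i x t * pdx (s.w i) x t) := by
    unfold CQ; fun_prop
  have c2 : CQ T (s.wf' i) := by unfold CQ MHDSol.wf'; fun_prop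
  have hlow : ∀ t ∈ Icc (0:ℝ) T, SI (sqx (s.w i)) t ≤
      4 * (SI (fun x t => pdx (s.w i) x t ^ 2 / 2 + s.b i x t * pdx (s.w i) x t) t + b) := by
    intro t ht
    have := int_lin1 4 (4 * b) ((sqx_cq (T := T) (s.sm_w i)).slice ht) (c1.slice ht) (by
      intro x hx
      have e2 : s.b i x t ^ 2 ≤ b :=
        (sqx_sup (s.sm_b i) (s.bc_b i t ht).1 hx).trans (hb1 t ht)
      unfold sqx
      nlinarith [sq_nonneg (pdx (s.w i) x t + 2 * s.b i x t)])
    unfold SI at *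
    linarith
  obtain ⟨g1, g2⟩ := gronwall hT
    (y := SI (fun x t => pdx (s.w i) x t ^ 2 / 2 + s.b i x t * pdx (s.w i) x t))
    (y' := SI (s.wf' i))
    (g := fun t => 2 * R * SI (sqx s.u) t + 2) (h := fun t => 1 / 2 * SI (sqt (s.b i)) t)
    (d := fun t => 1 / 2 * SI (s.rsq (s.w i)) t) (K := b) (Y0 := A ^ 2 + 2 * b) (Γ := Γ)
    (H := 1 / 2 * b) (c2.si_cont hT0)
    (fun t ht => c1.ftc hT0 c2 (fun x hx t ht => by
      refine (((hd_sq ((s.sm_w i).pdx.ht x t)).div_const 2).fun_add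
        (((s.sm_b i).ht x t).fun_mul ((s.sm_w i).pdx.ht x t))).congr_deriv ?_
      unfold MHDSol.wf'
      ring) ht)
    ((cu.const_mul _).add continuousOn_const) (cbt.const_mul _) (cr.const_mul _)
    (fun t _ => by have := sqx_nn s.u t; positivity)
    (fun t _ => by have := sqt_nn (s.b i) t; positivity)
    (fun t ht => by have := s.rsq_nn (s.w i) ht; positivity)
    (fun t ht => by have := hlow t ht; have := sqx_nn (s.w i) t; linarith)
    (fun t ht => by
      have h1 := w_ineq s hT (R := R)
        (fun x hx t ht => by rw [hR]; exact dens_bd s hT hκ hI hx ht) i ht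
      have h2 := hlow t ht
      have h3 := sqx_nn s.u t
      have h4 : 0 ≤ 1 / 2 * R * SI (sqx s.u) t + 1 / 2 := by positivity
      have h5 := mul_le_mul_of_nonneg_left h2 h4
      linarith)
    (by
      have h1 := (init_one (s.sm_w i) (hI.2.2.2.1 i)).1
      have h2 := int_lin1 1 (b / 2) (c1.slice h00) ((sqx_cq (T := T) (s.sm_w i)).slice h00) (by
        intro x hx
        have e2 : s.b i x 0 ^ 2 ≤ b :=
          (sqx_sup (s.sm_b i) (s.bc_b i 0 h00).1 hx).trans (hb1 0 h00)
        unfold sqx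
        nlinarith [sq_nonneg (pdx (s.w i) x 0 - s.b i x 0)])
      unfold SI sqx at *
      linarith)
    (by
      have := tlin1 hT0 (2 * R) 2 ((cu.const_mul (2 * R)).add continuousOn_const) cQ (by
        intro t ht
        have h1 := (sqx_le_Q s ht).1
        have h2 := mul_le_mul_of_nonneg_left h1 (by linarith : 0 ≤ 2 * R)
        exact add_le_add_left h2 _)
      have h2 := mul_le_mul_of_nonneg_left hQ (by linarith : 0 ≤ 2 * R)
      refine le_trans this ?_
      linarith)
    (by rw [intervalIntegral.integral_const_mul]; linarith)
  rw [← hY] at g1 g2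
  rw [intervalIntegral.integral_const_mul] at g2
  have : 0 ≤ Γ * Y := by positivity
  have : 0 ≤ A ^ 2 := by positivity
  exact ⟨fun t ht => by linarith [hlow t ht, g1 t ht], by linarith⟩

end est


/-! ### The main estimate -/

section mainest
variable {T : ℝ} {κ : ℝ → ℝ}

/-- Effective viscous flux. -/
def MHDSol.F (s : MHDSol T κ) (x t : ℝ) : ℝ :=
  pdx s.u x t - s.ρ x t * s.θ x t - (s.b 0 x t ^ 2 + s.b 1 x t ^ 2) / 2

/-- Its spatial derivative. -/
def MHDSol.z (s : MHDSol T κ) (x t : ℝ) : ℝ :=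
  s.ρ x t * (pdt s.u x t + s.u x t * pdx s.u x t)

/-- Temperature multiplier. -/
def MHDSol.KK (s : MHDSol T κ) (q x t : ℝ) : ℝ := s.θ x t + s.θ x t ^ (q + 1)

/-- Its derivative with respect to the temperature. -/
def MHDSol.KK' (s : MHDSol T κ) (q x t : ℝ) : ℝ := 1 + (q + 1) * s.θ x t ^ q

/-- Its primitive with respect to the temperature. -/
def MHDSol.Ph (s : MHDSol T κ) (q x t : ℝ) : ℝ := s.θ x t ^ 2 / 2 + s.θ x t ^ (q + 2) / (q + 2)

/-- The functional. -/
def MHDSol.fm (s : MHDSol T κ) (q N x t : ℝ) : ℝ :=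
  s.F x t ^ 2 / 2 + N * (s.ρ x t * s.Ph q x t)

/-- Its time derivative. -/
def MHDSol.fm' (s : MHDSol T κ) (q N x t : ℝ) : ℝ :=
  s.F x t * (pdt (pdx s.u) x t - (pdt s.ρ x t * s.θ x t + s.ρ x t * pdt s.θ x t)
    - (s.b 0 x t * pdt (s.b 0) x t + s.b 1 x t * pdt (s.b 1) x t))
  + N * (pdt s.ρ x t * s.Ph q x t + s.ρ x t * (s.KK q x t * pdt s.θ x t))

/-- The functional, after integration by parts. -/
def MHDSol.em (s : MHDSol T κ) (q N x t : ℝ) : ℝ :=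
  - s.z x t * pdt s.u x t - s.z x t * s.u x t * (s.ρ x t * s.θ x t) + s.z x t * s.J x t
  - s.F x t * s.Q x t + s.F x t * (s.ρ x t * s.θ x t) * pdx s.u x t
  - s.F x t * (s.b 0 x t * pdt (s.b 0) x t + s.b 1 x t * pdt (s.b 1) x t)
  + N * (s.KK q x t * (s.Q x t - s.ρ x t * s.θ x t * pdx s.u x t)
    - s.KK' q x t * pdx s.θ x t * s.J x t)

theorem MHDSol.F_cq (s : MHDSol T κ) : CQ T s.F := by unfold CQ MHDSol.F; fun_prop
theorem MHDSol.z_cq (s : MHDSol T κ) : CQ T s.z := by unfold CQ MHDSol.z; fun_prop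
theorem MHDSol.KK_cq (s : MHDSol T κ) (q : ℝ) : CQ T (s.KK q) := by
  have k1 := s.th_cq (q + 1)
  unfold CQ MHDSol.KK at *; fun_prop
theorem MHDSol.KK'_cq (s : MHDSol T κ) (q : ℝ) : CQ T (s.KK' q) := by
  have k1 := s.th_cq q
  unfold CQ MHDSol.KK' at *; fun_prop
theorem MHDSol.Ph_cq (s : MHDSol T κ) (q : ℝ) : CQ T (s.Ph q) := by
  have k1 := s.th_cq (q + 2)
  unfold CQ MHDSol.Ph at *; fun_prop
theorem MHDSol.fm_cq (s : MHDSol T κ) (q N : ℝ) : CQ T (s.fm q N) := by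
  have k1 := s.Ph_cq q
  have k2 := s.F_cq
  unfold CQ MHDSol.fm at *; fun_prop
theorem MHDSol.fm'_cq (s : MHDSol T κ) (q N : ℝ) : CQ T (s.fm' q N) := by
  have k1 := s.Ph_cq q
  have k2 := s.F_cq
  have k3 := s.KK_cq q
  unfold CQ MHDSol.fm' at *; fun_prop
theorem MHDSol.em_cq {q C₀ : ℝ} (s : MHDSol T κ) (hκ : KappaHyp q C₀ κ) (N : ℝ) :
    CQ T (s.em q N) := by
  have k1 := s.J_cq hκ
  have k2 := s.F_cq
  have k3 := s.KK_cq q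
  have k4 := s.KK'_cq q
  have k5 := s.z_cq
  have k6 := s.Q_cq
  unfold CQ MHDSol.em at *; fun_prop

theorem MHDSol.F_hx (s : MHDSol T κ) {x t : ℝ} (hx : x ∈ Icc (0:ℝ) 1) (ht : t ∈ Icc (0:ℝ) T) :
    HasDerivAt (fun y => s.F y t) (s.z x t) x := by
  unfold MHDSol.F MHDSol.z
  refine (((s.sm_u.pdx.hx x t).fun_sub ((s.sm_ρ.hx x t).fun_mul (s.sm_θ.hx x t))).fun_sub
    (((hd_sq ((s.sm_b 0).hx x t)).fun_add (hd_sq ((s.sm_b 1).hx x t))).div_const 2)).congr_deriv ?_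
  linear_combination -(s.e_u hx ht)

theorem MHDSol.F_ht (s : MHDSol T κ) (x t : ℝ) :
    HasDerivAt (fun r => s.F x r)
      (pdt (pdx s.u) x t - (pdt s.ρ x t * s.θ x t + s.ρ x t * pdt s.θ x t)
    - (s.b 0 x t * pdt (s.b 0) x t + s.b 1 x t * pdt (s.b 1) x t)) t := by
  unfold MHDSol.F
  refine (((s.sm_u.pdx.ht x t).fun_sub ((s.sm_ρ.ht x t).fun_mul (s.sm_θ.ht x t))).fun_sub
    (((hd_sq ((s.sm_b 0).ht x t)).fun_add (hd_sq ((s.sm_b 1).ht x t))).div_const 2)).congr_deriv ?_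
  ring

theorem hd_Ph {g : ℝ → ℝ} {g' y q : ℝ} (hq : 0 < q) (h : HasDerivAt g g' y) (hp : 0 < g y) :
    HasDerivAt (fun y => g y ^ 2 / 2 + g y ^ (q + 2) / (q + 2))
      ((g y + g y ^ (q + 1)) * g') y := by
  refine (((hd_sq h).div_const 2).fun_add
    ((hd_rpow (r := q + 2) (r' := q + 1) h hp (by ring)).div_const (q + 2))).congr_deriv ?_
  field_simp

theorem MHDSol.fm_ht (s : MHDSol T κ) {q : ℝ} (hq : 0 < q) (N : ℝ) {x t : ℝ}
    (hx : x ∈ Icc (0:ℝ) 1) (ht : t ∈ Icc (0:ℝ) T) :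
    HasDerivAt (fun r => s.fm q N x r) (s.fm' q N x t) t := by
  have h1 := hd_Ph hq (s.sm_θ.ht x t) (s.θ_pos x hx t ht)
  unfold MHDSol.fm MHDSol.fm' MHDSol.Ph MHDSol.KK
  refine (((hd_sq (s.F_ht x t)).div_const 2).fun_add
    (((s.sm_ρ.ht x t).fun_mul h1).const_mul N)).congr_deriv ?_
  ring

theorem MHDSol.KK_hx (s : MHDSol T κ) (q : ℝ) {x t : ℝ}
    (hx : x ∈ Icc (0:ℝ) 1) (ht : t ∈ Icc (0:ℝ) T) :
    HasDerivAt (fun y => s.KK q y t) (s.KK' q x t * pdx s.θ x t) x := by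
  unfold MHDSol.KK MHDSol.KK'
  refine ((s.sm_θ.hx x t).fun_add (hd_rpow (r := q + 1) (r' := q) (s.sm_θ.hx x t)
    (s.θ_pos x hx t ht) (by ring))).congr_deriv ?_
  ring

theorem main_flux (s : MHDSol T κ) (hT : 0 < T) {q C₀ : ℝ} (hq : 0 < q) (hκ : KappaHyp q C₀ κ)
    (N : ℝ) {t : ℝ} (ht : t ∈ Icc (0:ℝ) T) : SI (s.fm' q N) t = SI (s.em q N) t := by
  refine flux_eq (G := fun x => s.F x t * pdt s.u x t + s.F x t * (s.u x t * (s.ρ x t * s.θ x t))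
    - s.F x t * s.J x t + N * (-(s.ρ x t * s.u x t * s.Ph q x t) + s.KK q x t * s.J x t))
    ((s.fm'_cq q N).slice ht) ((s.em_cq hκ N).slice ht) (fun x hx => ?_) ?_ ?_
  · have hF := s.F_hx hx ht
    have hJ := s.J_hx hκ hx ht
    have hP : HasDerivAt (fun y => s.Ph q y t) (s.KK q x t * pdx s.θ x t) x :=
      hd_Ph hq (s.sm_θ.hx x t) (s.θ_pos x hx t ht)
    refine ((((hF.fun_mul (s.sm_u.pdt.hx x t)).fun_add (hF.fun_mul ((s.sm_u.hx x t).fun_mul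
      ((s.sm_ρ.hx x t).fun_mul (s.sm_θ.hx x t))))).fun_sub (hF.fun_mul hJ)).fun_add
      (((((s.sm_ρ.hx x t).fun_mul (s.sm_u.hx x t)).fun_mul hP).fun_neg.fun_add
        ((s.KK_hx q hx ht).fun_mul hJ)).const_mul N)).congr_deriv ?_
    unfold MHDSol.fm' MHDSol.em MHDSol.Jx
    rw [s.sm_u.comm]
    linear_combination (s.F x t * s.θ x t - N * s.Ph q x t) * s.e_ρ hx ht
  · have := bdry_t s.sm_u hT (fun t ht => (s.bc_u t ht).1) t ht
    simp [(s.bc_u t ht).1, (s.J_bc ht).1, this]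
  · have := bdry_t s.sm_u hT (fun t ht => (s.bc_u t ht).2) t ht
    simp [(s.bc_u t ht).2, (s.J_bc ht).2, this]

end mainest


section mainest2
variable {T : ℝ} {κ : ℝ → ℝ}

/-- Squared heat flux. -/
def MHDSol.J2 (s : MHDSol T κ) (x t : ℝ) : ℝ := s.J x t ^ 2

theorem MHDSol.J2_cq {q C₀ : ℝ} (s : MHDSol T κ) (hκ : KappaHyp q C₀ κ) : CQ T s.J2 :=
  (s.J_cq hκ).pow 2

/-- Squared effective flux. -/
def MHDSol.F2 (s : MHDSol T κ) (x t : ℝ) : ℝ := s.F x t ^ 2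

theorem MHDSol.F2_cq (s : MHDSol T κ) : CQ T s.F2 := (s.F_cq).pow 2

theorem MHDSol.ux_le_Q (s : MHDSol T κ) (x t : ℝ) : pdx s.u x t ^ 2 ≤ s.Q x t := by
  unfold MHDSol.Q
  nlinarith [sq_nonneg (pdx (s.w 0) x t), sq_nonneg (pdx (s.w 1) x t),
        sq_nonneg (pdx (s.b 0) x t), sq_nonneg (pdx (s.b 1) x t)]

theorem alg1 {r R u ux ut P J a : ℝ} (hr : 0 < r) (hR : r ≤ R) (hu : u ^ 2 ≤ a) :
    -(r * (ut + u * ux)) * ut - r * (ut + u * ux) * u * P + r * (ut + u * ux) * J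
      ≤ -1 / 2 * (r * ut ^ 2) + 3 * R * a * (ux ^ 2 + P ^ 2) + 3 * R * J ^ 2 := by
  have h1 : -(r * (ut + u * ux)) * ut - r * (ut + u * ux) * u * P + r * (ut + u * ux) * J
      ≤ -1 / 2 * (r * ut ^ 2) + r * (3 * u ^ 2 * (ux ^ 2 + P ^ 2) + 3 * J ^ 2) := by
    have : -((ut + u * ux)) * ut - (ut + u * ux) * u * P + (ut + u * ux) * J
      ≤ -1 / 2 * (ut ^ 2) + (3 * u ^ 2 * (ux ^ 2 + P ^ 2) + 3 * J ^ 2) := by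
      obtain ⟨X, hX⟩ : ∃ X, X = u * ux := ⟨_, rfl⟩
      obtain ⟨Y, hY⟩ : ∃ X, X = u * P := ⟨_, rfl⟩
      have e : 3 * u ^ 2 * (ux ^ 2 + P ^ 2) = 3 * (X ^ 2 + Y ^ 2) := by rw [hX, hY]; ring
      rw [e, mul_assoc _ u P, ← hX, ← hY]
      nlinarith [sq_nonneg (ut + 3 * X), sq_nonneg (ut + 3 * Y), sq_nonneg (ut - 3 * J),
        sq_nonneg (X + Y), sq_nonneg (X - J)]
    have := mul_le_mul_of_nonneg_left this hr.le
    linarith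
  have ha : 0 ≤ a := (sq_nonneg u).trans hu
  have h2 : 3 * u ^ 2 * (ux ^ 2 + P ^ 2) + 3 * J ^ 2 ≤ 3 * a * (ux ^ 2 + P ^ 2) + 3 * J ^ 2 := by
    have := mul_le_mul_of_nonneg_right hu (by positivity : 0 ≤ ux ^ 2 + P ^ 2)
    linarith
  have h3 := mul_le_mul hR h2 (by positivity) (by linarith)
  linarith

theorem alg2 {F m Q P ux : ℝ} (h1 : F ≤ m) (h2 : -m ≤ F) (hQ : ux ^ 2 ≤ Q) :
    -F * Q + F * P * ux ≤ 2 * m * (Q + P ^ 2) := by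
  have hm : 0 ≤ m := by linarith
  have hQ0 : 0 ≤ Q := (sq_nonneg ux).trans hQ
  have e1 : -F * Q ≤ m * Q := by nlinarith
  have e2 : F * (P * ux) ≤ m * (Q + P ^ 2) := by
    have k : |P * ux| ≤ Q + P ^ 2 := abs_le.2 ⟨by nlinarith [sq_nonneg (P + ux)],
      by nlinarith [sq_nonneg (P - ux)]⟩
    have k2 : |F| ≤ m := abs_le.2 ⟨h2, h1⟩
    calc F * (P * ux) ≤ |F * (P * ux)| := le_abs_self _
      _ = |F| * |P * ux| := abs_mul _ _
      _ ≤ _ := mul_le_mul k2 k (abs_nonneg _) hm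
  nlinarith [mul_nonneg hm (sq_nonneg P)]

theorem alg3 {F b c β : ℝ} (hb : b ^ 2 ≤ β) :
    -F * (b * c) ≤ 1 / 2 * F ^ 2 + β / 2 * c ^ 2 := by
  nlinarith [sq_nonneg (F + b * c), mul_le_mul_of_nonneg_right hb (sq_nonneg c)]

theorem alg4 {K k Q P ux : ℝ} (h0 : 0 ≤ K) (h : K ≤ k) (hQ : ux ^ 2 ≤ Q) :
    K * (Q - P * ux) ≤ 2 * k * (Q + P ^ 2) := by
  have := alg2 (F := -K) (m := k) (P := P) (ux := ux) (by linarith) (by linarith) hQ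
  linarith

theorem main_ineq1 (s : MHDSol T κ) {q C₀ : ℝ} (hq : 0 < q) (hC : 1 ≤ C₀) (hκ : KappaHyp q C₀ κ)
    {R a β m k N' : ℝ} {t : ℝ} (ht : t ∈ Icc (0:ℝ) T) (hN' : 0 ≤ N')
    (hR : ∀ x ∈ Icc (0:ℝ) 1, s.ρ x t ≤ R)
    (ha : ∀ x ∈ Icc (0:ℝ) 1, s.u x t ^ 2 ≤ a)
    (hb : ∀ i, ∀ x ∈ Icc (0:ℝ) 1, s.b i x t ^ 2 ≤ β)
    (hm : ∀ x ∈ Icc (0:ℝ) 1, s.F x t ^ 2 ≤ m ^ 2) (hm0 : 0 ≤ m)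
    (hk : ∀ x ∈ Icc (0:ℝ) 1, s.KK q x t ≤ k) :
    SI (s.em q (C₀ * N')) t ≤ -1 / 2 * SI (s.rsq s.u) t
      + (3 * R * a + 2 * m + 2 * (C₀ * N') * k) * (SI s.Q t + SI s.P2 t)
      + (3 * R - N') * SI s.J2 t + SI s.F2 t
      + β / 2 * (SI (sqt (s.b 0)) t + SI (sqt (s.b 1)) t) := by
  have h := int_lin7 (-1 / 2) (3 * R * a + 2 * m + 2 * (C₀ * N') * k)
    (3 * R * a + 2 * m + 2 * (C₀ * N') * k) (3 * R - N') 1 (β / 2) (β / 2) 0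
    ((s.em_cq hκ (C₀ * N')).slice ht)
    ((s.rsq_cq s.sm_u).slice ht) (s.Q_cq.slice ht) (s.P2_cq.slice ht) ((s.J2_cq hκ).slice ht)
    (s.F2_cq.slice ht) ((sqt_cq (T := T) (s.sm_b 0)).slice ht)
    ((sqt_cq (T := T) (s.sm_b 1)).slice ht) (by
    intro x hx
    have pθ := s.θ_pos x hx t ht
    have pρ := s.ρ_pos x hx t ht
    have hQ := s.ux_le_Q x t
    have hF := abs_le.1 (sq_le_sq.1 (hm x hx))
    rw [abs_of_nonneg hm0] at hF
    have hK0 : 0 ≤ s.KK q x t := by unfold MHDSol.KK; positivity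
    have g1 := alg1 (ux := pdx s.u x t) (ut := pdt s.u x t) (P := s.ρ x t * s.θ x t)
      (J := s.J x t) pρ (hR x hx) (ha x hx)
    have g2 := alg2 (P := s.ρ x t * s.θ x t) hF.2 hF.1 hQ
    have g3 := alg3 (F := s.F x t) (c := pdt (s.b 0) x t) (hb 0 x hx)
    have g4 := alg3 (F := s.F x t) (c := pdt (s.b 1) x t) (hb 1 x hx)
    have g5 := alg4 (P := s.ρ x t * s.θ x t) hK0 (hk x hx) hQ
    have hN : 0 ≤ C₀ * N' := by positivity
    have g6 := mul_le_mul_of_nonneg_left g5 hN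
    have hR0 : 0 ≤ R := pρ.le.trans (hR x hx)
    have ha0 : 0 ≤ a := (sq_nonneg _).trans (ha x hx)
    have g7 : 3 * R * a * (pdx s.u x t ^ 2 + (s.ρ x t * s.θ x t) ^ 2)
        ≤ 3 * R * a * (s.Q x t + (s.ρ x t * s.θ x t) ^ 2) := by
      apply mul_le_mul_of_nonneg_left _ (by positivity)
      linarith
    have g8 : s.J x t ^ 2 ≤ C₀ * (s.KK' q x t * pdx s.θ x t * s.J x t) := by
      have k1 := hκ.2.2 _ pθ.le
      have k2 := hκ.pos hC pθ.le
      have k3 : κ (s.θ x t) ≤ C₀ * s.KK' q x t := by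
        refine k1.trans (mul_le_mul_of_nonneg_left ?_ (by linarith))
        unfold MHDSol.KK'
        have : 0 ≤ q * s.θ x t ^ q := by positivity
        linarith
      have k4 := mul_le_mul_of_nonneg_right k3 (by positivity : 0 ≤ κ (s.θ x t) * pdx s.θ x t ^ 2)
      unfold MHDSol.J
      linarith
    have g9 := mul_le_mul_of_nonneg_left g8 hN'
    unfold MHDSol.em MHDSol.z MHDSol.rsq MHDSol.P2 MHDSol.J2 MHDSol.F2 sqt
    linarith)
  unfold SI
  linarith

theorem z_int (s : MHDSol T κ) {R a : ℝ} {t : ℝ} (ht : t ∈ Icc (0:ℝ) T)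
    (hR : ∀ x ∈ Icc (0:ℝ) 1, s.ρ x t ≤ R)
    (ha : ∀ x ∈ Icc (0:ℝ) 1, s.u x t ^ 2 ≤ a) :
    (∫ x in (0:ℝ)..1, s.z x t ^ 2) ≤ 2 * R * SI (s.rsq s.u) t + 2 * R ^ 2 * a * SI (sqx s.u) t := by
  have h := int_lin2 (f := fun x => s.z x t ^ 2) (2 * R) (2 * R ^ 2 * a) 0 ((s.z_cq.slice ht).pow 2)
    ((s.rsq_cq s.sm_u).slice ht) ((sqx_cq (T := T) s.sm_u).slice ht) (by
    intro x hx
    have pρ := s.ρ_pos x hx t ht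
    have h1 := hR x hx
    have h2 := ha x hx
    have ha0 : 0 ≤ a := (sq_nonneg _).trans h2
    unfold MHDSol.z MHDSol.rsq sqx
    have e1 : (s.ρ x t * (pdt s.u x t + s.u x t * pdx s.u x t)) ^ 2
      ≤ s.ρ x t ^ 2 * (2 * pdt s.u x t ^ 2 + 2 * (s.u x t ^ 2 * pdx s.u x t ^ 2)) := by
      rw [mul_pow]
      apply mul_le_mul_of_nonneg_left _ (sq_nonneg _)
      nlinarith [sq_nonneg (pdt s.u x t - s.u x t * pdx s.u x t)]
    have e2 : s.ρ x t ^ 2 * pdt s.u x t ^ 2 ≤ R * (s.ρ x t * pdt s.u x t ^ 2) := by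
      have := mul_le_mul_of_nonneg_right h1 (by positivity : 0 ≤ s.ρ x t * pdt s.u x t ^ 2)
      linarith
    have e3 : s.ρ x t ^ 2 * (s.u x t ^ 2 * pdx s.u x t ^ 2) ≤ R ^ 2 * (a * pdx s.u x t ^ 2) := by
      apply mul_le_mul (pow_le_pow_left₀ pρ.le h1 2) _ (by positivity) (by positivity)
      exact mul_le_mul_of_nonneg_right h2 (sq_nonneg _)
    linarith)
  unfold SI
  linarith

theorem KK_sup (s : MHDSol T κ) (hT : 0 < T) {q C₀ : ℝ} (hq : 0 < q) (hC : 1 ≤ C₀)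
    (hκ : KappaHyp q C₀ κ) {A B M : ℝ} (hM : 0 < M) (hI : InitBounds s A B M) {t : ℝ}
    (ht : t ∈ Icc (0:ℝ) T) {x : ℝ} (hx : x ∈ Icc (0:ℝ) 1) :
    s.KK q x t ≤ EE A / M + (EE A / M) ^ (q + 1) + (q + 1) * C₀ * √(SI s.J2 t) := by
  obtain ⟨y, hy, hyN⟩ := exists_cold s hT hκ hM hI ht
  have cf : ContinuousOn (fun z => s.KK' q z t * pdx s.θ z t) (Icc 0 1) :=
    ((s.KK'_cq q).slice ht).mul ((s.sm_θ.pdx.cq T).slice ht)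
  have h1 := sob_sub (f := fun z => s.KK q z t) cf (fun z hz => s.KK_hx q hz ht) hx hy
  have h2 := int_lin1 (f := fun z => (s.KK' q z t * pdx s.θ z t) ^ 2) (((q + 1) * C₀) ^ 2) 0 (cf.pow 2) ((s.J2_cq hκ).slice ht) (by
    intro z hz
    have pz := s.θ_pos z hz t ht
    have e2 := hκ.lb hC pz.le
    have e3 : s.KK' q z t ≤ (q + 1) * C₀ * κ (s.θ z t) := by
      have : s.KK' q z t ≤ (q + 1) * (1 + s.θ z t ^ q) := by
        unfold MHDSol.KK'; linarith
      have := mul_le_mul_of_nonneg_left e2 (by linarith : 0 ≤ q + 1)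
      linarith
    have e4 : 0 ≤ s.KK' q z t := by unfold MHDSol.KK'; positivity
    have e5 := pow_le_pow_left₀ e4 e3 2
    have e6 := mul_le_mul_of_nonneg_right e5 (sq_nonneg (pdx s.θ z t))
    unfold MHDSol.J2 MHDSol.J
    linarith)
  have h3 : s.KK q y t ≤ EE A / M + (EE A / M) ^ (q + 1) := by
    have p := s.θ_pos y hy t ht
    unfold MHDSol.KK
    have := rpow_le_rpow p.le hyN (by linarith : 0 ≤ q + 1)
    linarith
  have h0 : 0 ≤ SI s.J2 t := int_nonneg (fun x _ => sq_nonneg _)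
  have h4 : (s.KK q x t - s.KK q y t) ^ 2 ≤ ((q + 1) * C₀ * √(SI s.J2 t)) ^ 2 := by
    rw [mul_pow, sq_sqrt h0]
    unfold SI
    linarith
  have h5 := abs_le_of_sq_le_sq' h4 (by positivity)
  linarith [h5.2]

theorem alg5 {R f m S D : ℝ} (hR : 1 ≤ R) (hf : 0 ≤ f)
    (k1 : m ^ 2 ≤ 2 * f + 4 * R * D + 4 * R ^ 2 * S ^ 2) :
    2 * m * S ≤ f + D / 4 + R * S ^ 2 + 16 * R * S ^ 2 := by
  have k2 : 2 * m * S * (16 * R) ≤ m ^ 2 + (16 * R * S) ^ 2 := by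
    linarith [sq_nonneg (m - 16 * R * S)]
  have k3 : 1 * f ≤ R * f := mul_le_mul_of_nonneg_right hR hf
  have k4 : 2 * m * S * (16 * R) ≤ (f + D / 4 + R * S ^ 2 + 16 * R * S ^ 2) * (16 * R) := by
    linarith [mul_nonneg (sq_nonneg R) (sq_nonneg S)]
  exact le_of_mul_le_mul_right k4 (by linarith)

theorem main_ineq2 (s : MHDSol T κ) (hT : 0 < T) {q C₀ : ℝ} (hq : 0 < q) (hC : 1 ≤ C₀)
    (hκ : KappaHyp q C₀ κ) {A B M : ℝ} (hM : 0 < M) (hI : InitBounds s A B M)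
    {R β K0 : ℝ} {t : ℝ} (ht : t ∈ Icc (0:ℝ) T) (hR1 : 1 ≤ R)
    (hR : ∀ x ∈ Icc (0:ℝ) 1, s.ρ x t ≤ R)
    (hb : ∀ i, ∀ x ∈ Icc (0:ℝ) 1, s.b i x t ^ 2 ≤ β)
    (hK0 : K0 = EE A / M + (EE A / M) ^ (q + 1)) {N c S : ℝ} (hN : N = C₀ * (3 * R + 2))
    (hc : c = (q + 1) * C₀) (hS : S = SI s.Q t + SI s.P2 t) :
    SI (s.fm' q N) t + (1 / 4 * SI (s.rsq s.u) t + SI s.J2 t)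
      ≤ (20 * R + N ^ 2 * c ^ 2) * S ^ 2 + 2 * SI s.F2 t
        + β / 2 * (SI (sqt (s.b 0)) t + SI (sqt (s.b 1)) t) + 2 * N * K0 * S := by
  rw [main_flux s hT hq hκ N ht, hN]
  have ha : ∀ x ∈ Icc (0:ℝ) 1, s.u x t ^ 2 ≤ SI (sqx s.u) t := fun x hx =>
    sqx_sup s.sm_u (s.bc_u t ht).1 hx
  have hj0 : 0 ≤ SI s.J2 t := int_nonneg (fun x _ => sq_nonneg _)
  have hF0 : 0 ≤ SI s.F2 t := int_nonneg (fun x _ => sq_nonneg _)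
  have hP0 : 0 ≤ SI s.P2 t := int_nonneg (fun x _ => sq_nonneg _)
  have hz0 : 0 ≤ ∫ x in (0:ℝ)..1, s.z x t ^ 2 := int_nonneg (fun x _ => sq_nonneg _)
  have hD0 := s.rsq_nn s.u ht
  have ha0 := sqx_nn s.u t
  have haS : SI (sqx s.u) t ≤ S := by rw [hS]; linarith [(sqx_le_Q s ht).1]
  obtain ⟨m, hm⟩ : ∃ m, m = √(2 * SI s.F2 t + 2 * ∫ x in (0:ℝ)..1, s.z x t ^ 2) := ⟨_, rfl⟩
  have hm2 : m ^ 2 = 2 * SI s.F2 t + 2 * ∫ x in (0:ℝ)..1, s.z x t ^ 2 := by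
    rw [hm, sq_sqrt (by positivity)]
  have hm0 : 0 ≤ m := by rw [hm]; positivity
  have h := main_ineq1 s hq hC hκ ht (N' := 3 * R + 2) (by linarith) hR ha hb (m := m) (by
    intro x hx
    rw [hm2]
    exact sob (s.z_cq.slice ht) (fun x hx => s.F_hx hx ht) hx) hm0
    (fun x hx => KK_sup s hT hq hC hκ hM hI ht hx)
  rw [← hN, ← hS, ← hK0, ← hc] at h
  have hz := z_int s ht hR ha
  rw [← hN]
  obtain ⟨j, hj⟩ : ∃ j, j = √(SI s.J2 t) := ⟨_, rfl⟩
  have hj2 : SI s.J2 t = j ^ 2 := by rw [hj, sq_sqrt hj0]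
  rw [← hj] at h
  rw [hj2] at h ⊢
  obtain ⟨a, haa⟩ : ∃ a, a = SI (sqx s.u) t := ⟨_, rfl⟩
  obtain ⟨D, hD⟩ : ∃ a, a = SI (s.rsq s.u) t := ⟨_, rfl⟩
  obtain ⟨f, hf⟩ : ∃ a, a = SI s.F2 t := ⟨_, rfl⟩
  obtain ⟨bb, hbb⟩ : ∃ a, a = SI (sqt (s.b 0)) t + SI (sqt (s.b 1)) t := ⟨_, rfl⟩
  rw [← haa] at h hz haS ha0
  rw [← hD] at h hz hD0 ⊢
  rw [← hf] at h hm2 hF0 ⊢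
  rw [← hbb] at h ⊢
  have hS0 : 0 ≤ S := ha0.trans haS
  have e1 : a * S ≤ S ^ 2 := by rw [sq]; exact mul_le_mul_of_nonneg_right haS hS0
  have e2 : a ^ 2 ≤ S ^ 2 := pow_le_pow_left₀ ha0 haS 2
  have e3 := alg5 hR1 hF0 (m := m) (D := D) (S := S) (by
    have := mul_le_mul_of_nonneg_left e2 (by positivity : 0 ≤ 4 * R ^ 2)
    linarith)
  have e4 : 2 * N * (c * j) * S ≤ j ^ 2 + N ^ 2 * c ^ 2 * S ^ 2 := by
    linarith [sq_nonneg (j - N * c * S)]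
  have e5 := mul_le_mul_of_nonneg_left e1 (by linarith : 0 ≤ 3 * R)
  linarith

end mainest2


section mainest3
variable {T : ℝ} {κ : ℝ → ℝ}

/-- Weighted power of the temperature. -/
def MHDSol.hp (s : MHDSol T κ) (q x t : ℝ) : ℝ := s.ρ x t * s.θ x t ^ (q + 2)

theorem MHDSol.hp_cq (s : MHDSol T κ) (q : ℝ) : CQ T (s.hp q) :=
  (s.sm_ρ.cq T).mul (s.th_cq _)

theorem low_bds (s : MHDSol T κ) {q : ℝ} (hq : 0 < q) {R β N : ℝ} {t : ℝ} (ht : t ∈ Icc (0:ℝ) T)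
    (hN : 1 ≤ N) (hR : ∀ x ∈ Icc (0:ℝ) 1, s.ρ x t ≤ R)
    (hb : ∀ i, ∀ x ∈ Icc (0:ℝ) 1, s.b i x t ^ 2 ≤ β) :
    0 ≤ SI (s.fm q N) t ∧ SI s.F2 t ≤ 2 * SI (s.fm q N) t ∧ SI s.P2 t ≤ 2 * R * SI (s.fm q N) t ∧
    SI (s.hp q) t ≤ (q + 2) * SI (s.fm q N) t ∧
    SI (sqx s.u) t ≤ 3 * SI s.F2 t + 3 * SI s.P2 t + 3 * β ^ 2 := by
  have cf := (s.fm_cq q N).slice ht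
  have cF := s.F2_cq.slice ht
  have cP := s.P2_cq.slice ht
  have key : ∀ x ∈ Icc (0:ℝ) 1, 0 ≤ s.ρ x t * s.Ph q x t ∧
      s.ρ x t * s.Ph q x t ≤ N * (s.ρ x t * s.Ph q x t) := by
    intro x hx
    have p1 := s.ρ_pos x hx t ht
    have p2 := s.θ_pos x hx t ht
    have : 0 ≤ s.ρ x t * s.Ph q x t := by unfold MHDSol.Ph; positivity
    exact ⟨this, le_mul_of_one_le_left this hN⟩
  refine ⟨int_nonneg (fun x hx => ?_), ?_, ?_, ?_, ?_⟩
  · have := key x hx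
    unfold MHDSol.fm
    linarith [sq_nonneg (s.F x t)]
  · have := int_lin1 2 0 cF cf (by
      intro x hx
      have := key x hx
      unfold MHDSol.fm MHDSol.F2
      linarith)
    unfold SI; linarith
  · have := int_lin1 (2 * R) 0 cP cf (by
      intro x hx
      have p1 := s.ρ_pos x hx t ht
      have p2 := s.θ_pos x hx t ht
      have h := hR x hx
      have e1 : s.ρ x t * s.θ x t ^ 2 ≤ 2 * s.fm q N x t := by
        have k := key x hx
        have : s.ρ x t * s.θ x t ^ 2 ≤ 2 * (s.ρ x t * s.Ph q x t) := by
          unfold MHDSol.Ph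
          have : 0 ≤ s.ρ x t * (s.θ x t ^ (q + 2) / (q + 2)) := by positivity
          linarith
        unfold MHDSol.fm
        linarith [sq_nonneg (s.F x t)]
      have e2 := mul_le_mul h e1 (by positivity) (by linarith)
      unfold MHDSol.P2
      linarith)
    unfold SI; linarith
  · have := int_lin1 (q + 2) 0 ((s.hp_cq q).slice ht) cf (by
      intro x hx
      have p1 := s.ρ_pos x hx t ht
      have p2 := s.θ_pos x hx t ht
      have k := key x hx
      have e1 : s.ρ x t * s.θ x t ^ (q + 2) ≤ (q + 2) * (s.ρ x t * s.Ph q x t) := by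
        have e : (q + 2) * (s.ρ x t * s.Ph q x t)
          = (q + 2) * (s.ρ x t * (s.θ x t ^ 2 / 2)) + s.ρ x t * s.θ x t ^ (q + 2) := by
          unfold MHDSol.Ph
          field_simp
        rw [e]
        have : 0 ≤ (q + 2) * (s.ρ x t * (s.θ x t ^ 2 / 2)) := by positivity
        linarith
      have e2 : s.ρ x t * s.Ph q x t ≤ s.fm q N x t := by
        unfold MHDSol.fm
        linarith [sq_nonneg (s.F x t)]
      have e3 := mul_le_mul_of_nonneg_left e2 (by linarith : 0 ≤ q + 2)
      unfold MHDSol.hp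
      linarith)
    unfold SI; linarith
  · have := int_lin2 3 3 (3 * β ^ 2) ((sqx_cq (T := T) s.sm_u).slice ht) cF cP (by
      intro x hx
      have h0 := hb 0 x hx
      have h1 := hb 1 x hx
      unfold sqx MHDSol.F2 MHDSol.P2
      have e : pdx s.u x t = s.F x t + s.ρ x t * s.θ x t + (s.b 0 x t ^ 2 + s.b 1 x t ^ 2) / 2 := by
        unfold MHDSol.F; ring
      have h2 : ((s.b 0 x t ^ 2 + s.b 1 x t ^ 2) / 2) ^ 2 ≤ β ^ 2 :=
        pow_le_pow_left₀ (by positivity) (by linarith) 2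
      rw [e]
      generalize s.F x t = F at *
      generalize s.ρ x t * s.θ x t = P at *
      generalize (s.b 0 x t ^ 2 + s.b 1 x t ^ 2) / 2 = b at *
      linarith [sq_nonneg (F - P), sq_nonneg (F - b), sq_nonneg (P - b)])
    unfold SI; linarith

theorem init_fm (s : MHDSol T κ) (hT : 0 < T) {q : ℝ} (hq : 0 < q) {N A B M : ℝ} (hN : 1 ≤ N)
    (hI : InitBounds s A B M) :
    SI (s.fm q N) 0 ≤ 3 / 2 * A ^ 2 + (48 * A ^ 4
      + N * (2 * A * ((2 * A) ^ 2 / 2 + (2 * A) ^ (q + 2) / (q + 2)))) := by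
  have h00 : (0:ℝ) ∈ Icc (0:ℝ) T := ⟨le_rfl, hT.le⟩
  obtain ⟨hA, hall⟩ := init_all s hI hT
  have h := int_lin1 (3 / 2) (48 * A ^ 4
      + N * (2 * A * ((2 * A) ^ 2 / 2 + (2 * A) ^ (q + 2) / (q + 2)))) ((s.fm_cq q N).slice h00)
    ((sqx_cq (T := T) s.sm_u).slice h00) (by
    intro x hx
    obtain ⟨h1, h2, -, -, h5⟩ := hall x hx
    have p1 := s.ρ_pos x hx 0 h00
    have p2 := s.θ_pos x hx 0 h00
    have e1 : s.Ph q x 0 ≤ (2 * A) ^ 2 / 2 + (2 * A) ^ (q + 2) / (q + 2) := by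
      unfold MHDSol.Ph
      have k1 := pow_le_pow_left₀ p2.le h2 2
      have k2 := rpow_le_rpow p2.le h2 (by linarith : 0 ≤ q + 2)
      gcongr
    have e0 : 0 ≤ s.Ph q x 0 := by unfold MHDSol.Ph; positivity
    have e2 := mul_le_mul h1 e1 e0 (by linarith)
    have e3 := mul_le_mul_of_nonneg_left e2 (by linarith : 0 ≤ N)
    have e4 : (s.ρ x 0 * s.θ x 0) ^ 2 ≤ (2 * A * (2 * A)) ^ 2 :=
      pow_le_pow_left₀ (by positivity) (mul_le_mul h1 h2 p2.le (by linarith)) 2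
    have e5 : ((s.b 0 x 0 ^ 2 + s.b 1 x 0 ^ 2) / 2) ^ 2 ≤ (4 * A ^ 2) ^ 2 :=
      pow_le_pow_left₀ (by positivity) (by linarith [h5 0, h5 1]) 2
    have e6 : s.F x 0 ^ 2 ≤ 3 * pdx s.u x 0 ^ 2 + 3 * (2 * A * (2 * A)) ^ 2
        + 3 * (4 * A ^ 2) ^ 2 := by
      unfold MHDSol.F
      generalize pdx s.u x 0 = a at *
      generalize s.ρ x 0 * s.θ x 0 = P at *
      generalize (s.b 0 x 0 ^ 2 + s.b 1 x 0 ^ 2) / 2 = b at *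
      linarith [sq_nonneg (a + P), sq_nonneg (a + b), sq_nonneg (P - b)]
    unfold MHDSol.fm sqx
    linarith)
  have h3 := (init_one s.sm_u hI.2.1).1
  unfold SI
  unfold sqx at h
  linarith

theorem main_bd (T q C₀ : ℝ) (hT : 0 < T) (hq : 0 < q) (hC : 1 ≤ C₀)
    (κ : ℝ → ℝ) (hκ : KappaHyp q C₀ κ) (A M : ℝ) (hM : 0 < M) :
    ∃ C : ℝ, 0 ≤ C ∧ ∀ (s : MHDSol T κ) (B : ℝ), InitBounds s A B M →
      (∀ t ∈ Icc (0:ℝ) T, SI (sqx s.u) t ≤ C ∧ SI s.P2 t ≤ C ∧ SI (s.hp q) t ≤ C) ∧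
      (∫ t in (0:ℝ)..T, SI (s.rsq s.u) t) ≤ C ∧ (∫ t in (0:ℝ)..T, SI s.J2 t) ≤ C := by
  by_cases hA : 0 ≤ A
  swap
  · exact ⟨0, le_rfl, fun s B hI => absurd (init_all s hI hT).1 hA⟩
  obtain ⟨D, hD0, hD⟩ := diss_bd T q C₀ hT hq hC κ hκ A M hM
  obtain ⟨b, hb0, hb⟩ := b_bd T q C₀ hT hq hC κ hκ A M hM
  obtain ⟨W, hW0, hW⟩ := w_bd T q C₀ hT hq hC κ hκ A M hM
  have hT0 := hT.le
  have h00 : (0:ℝ) ∈ Icc (0:ℝ) T := ⟨le_rfl, hT0⟩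
  have hR1 := RR_one hT hA
  obtain ⟨R, hR⟩ : ∃ R, R = RR T A := ⟨_, rfl⟩
  rw [← hR] at hR1
  have hE := EE_pos hA
  obtain ⟨K0, hK0⟩ : ∃ K0, K0 = EE A / M + (EE A / M) ^ (q + 1) := ⟨_, rfl⟩
  have hK00 : 0 ≤ K0 := by rw [hK0]; positivity
  obtain ⟨N, hN⟩ : ∃ N, N = C₀ * (3 * R + 2) := ⟨_, rfl⟩
  have hN1 : 1 ≤ N := by
    rw [hN]
    exact one_le_mul_of_one_le_of_one_le hC (by linarith)
  obtain ⟨c, hc⟩ : ∃ c, c = (q + 1) * C₀ := ⟨_, rfl⟩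
  obtain ⟨Y0, hY0⟩ : ∃ Y0, Y0 = 3 / 2 * A ^ 2 + (48 * A ^ 4
      + N * (2 * A * ((2 * A) ^ 2 / 2 + (2 * A) ^ (q + 2) / (q + 2)))) + 1 := ⟨_, rfl⟩
  have hY00 : 0 ≤ Y0 := by rw [hY0]; positivity
  obtain ⟨Cs, hCs⟩ : ∃ Y, Y = 6 + 8 * R + 3 * b ^ 2 + 2 * W + 2 * b := ⟨_, rfl⟩
  have hCs0 : 0 ≤ Cs := by rw [hCs]; positivity
  obtain ⟨L, hL⟩ : ∃ L, L = (20 * R + N ^ 2 * c ^ 2) * Cs := ⟨_, rfl⟩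
  have hL0 : 0 ≤ L := by rw [hL]; positivity
  obtain ⟨Γ, hΓ⟩ : ∃ Y, Y = L * (2 * D) + 4 * T := ⟨_, rfl⟩
  have hΓ0 : 0 ≤ Γ := by rw [hΓ]; positivity
  obtain ⟨H, hH⟩ : ∃ Y, Y = b * b + 2 * N * K0 * (2 * D) := ⟨_, rfl⟩
  have hH0 : 0 ≤ H := by rw [hH]; positivity
  obtain ⟨Y, hY⟩ : ∃ Y, Y = (Y0 + H) * exp Γ := ⟨_, rfl⟩
  have hYY : 0 ≤ Y := by rw [hY]; positivity
  obtain ⟨Z, hZ⟩ : ∃ Z, Z = Y0 + H + Γ * Y := ⟨_, rfl⟩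
  have hZ0 : 0 ≤ Z := by rw [hZ]; positivity
  refine ⟨Cs * Y + 2 * R * Y + (q + 2) * Y + 4 * Z, by positivity, fun s B hI => ?_⟩
  obtain ⟨hP2, hQ⟩ := hD s B hI
  have hbb := hb s B hI
  have hww := hW s B hI
  have cb0 := (sqt_cq (T := T) (s.sm_b 0)).si_cont hT0
  have cb1 := (sqt_cq (T := T) (s.sm_b 1)).si_cont hT0
  have cr := (s.rsq_cq s.sm_u).si_cont hT0
  have cj := (s.J2_cq hκ).si_cont hT0
  have cQ := s.Q_cq.si_cont hT0
  have cP := s.P2_cq.si_cont hT0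
  have hRx : ∀ t ∈ Icc (0:ℝ) T, ∀ x ∈ Icc (0:ℝ) 1, s.ρ x t ≤ R := fun t ht x hx => by
    rw [hR]; exact dens_bd s hT hκ hI hx ht
  have hbx : ∀ t ∈ Icc (0:ℝ) T, ∀ i, ∀ x ∈ Icc (0:ℝ) 1, s.b i x t ^ 2 ≤ b := fun t ht i x hx =>
    (sqx_sup (s.sm_b i) (s.bc_b i t ht).1 hx).trans ((hbb i).1 t ht)
  have low := fun t ht => low_bds s hq (N := N) (t := t) ht hN1 (hRx t ht) (hbx t ht)
  have hQ0 : ∀ t ∈ Icc (0:ℝ) T, 0 ≤ SI s.Q t := fun t ht => int_nonneg (fun x _ => s.Q_nn x t)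
  have hP0 : ∀ t ∈ Icc (0:ℝ) T, 0 ≤ SI s.P2 t := fun t ht => int_nonneg (fun x _ => sq_nonneg _)
  have hj0 : ∀ t ∈ Icc (0:ℝ) T, 0 ≤ SI s.J2 t := fun t ht => int_nonneg (fun x _ => sq_nonneg _)
  have hr0 : ∀ t ∈ Icc (0:ℝ) T, 0 ≤ SI (s.rsq s.u) t := fun t ht => s.rsq_nn s.u ht
  have hS : ∀ t ∈ Icc (0:ℝ) T, SI s.Q t + SI s.P2 t ≤ Cs * (SI (s.fm q N) t + 1) := by
    intro t ht
    obtain ⟨l0, l1, l2, l3, l4⟩ := low t ht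
    have e1 := int_lin5 1 1 1 1 1 0 (s.Q_cq.slice ht) ((sqx_cq (T := T) s.sm_u).slice ht)
      ((sqx_cq (T := T) (s.sm_w 0)).slice ht) ((sqx_cq (T := T) (s.sm_w 1)).slice ht)
      ((sqx_cq (T := T) (s.sm_b 0)).slice ht) ((sqx_cq (T := T) (s.sm_b 1)).slice ht) (by
      intro x hx
      unfold MHDSol.Q sqx
      linarith)
    have e2 := (hww 0).1 t ht
    have e3 := (hww 1).1 t ht
    have e4 := (hbb 0).1 t ht
    have e5 := (hbb 1).1 t ht
    have e6 : SI s.Q t ≤ SI (sqx s.u) t + W + W + b + b := by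
      unfold SI at *; linarith
    have e7 : 0 ≤ (3 * b ^ 2 + 2 * W + 2 * b) * SI (s.fm q N) t := by positivity
    rw [hCs]
    linarith
  have hG := gronwall hT (y := SI (s.fm q N)) (y' := SI (s.fm' q N))
    (g := fun t => L * (SI s.Q t + SI s.P2 t) + 4)
    (h := fun t => b / 2 * (SI (sqt (s.b 0)) t + SI (sqt (s.b 1)) t)
      + 2 * N * K0 * (SI s.Q t + SI s.P2 t))
    (d := fun t => 1 / 4 * SI (s.rsq s.u) t + SI s.J2 t) (K := 1) (Y0 := Y0) (Γ := Γ)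
    (H := H) ((s.fm'_cq q N).si_cont hT0)
    (fun t ht => (s.fm_cq q N).ftc hT0 (s.fm'_cq q N) (fun x hx t ht => s.fm_ht hq N hx ht) ht)
    (by fun_prop) (by fun_prop) (by fun_prop)
    (fun t ht => by have := hQ0 t ht; have := hP0 t ht; positivity)
    (fun t ht => by
      have := hQ0 t ht; have := hP0 t ht; have := sqt_nn (s.b 0) t; have := sqt_nn (s.b 1) t
      positivity)
    (fun t ht => by have := hj0 t ht; have := hr0 t ht; positivity)
    (fun t ht => by linarith [(low t ht).1])
    (fun t ht => by
      have h1 := main_ineq2 s hT hq hC hκ hM hI ht hR1 (hRx t ht) (hbx t ht) hK0 hN hc rfl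
      obtain ⟨l0, l1, l2, l3, l4⟩ := low t ht
      have h2 := hS t ht
      have h3 : 0 ≤ SI s.Q t + SI s.P2 t := add_nonneg (hQ0 t ht) (hP0 t ht)
      have h4 := mul_le_mul_of_nonneg_left h2 h3
      have h5 := mul_le_mul_of_nonneg_left h4 (by positivity : 0 ≤ 20 * R + N ^ 2 * c ^ 2)
      rw [hL]
      generalize SI s.Q t + SI s.P2 t = S at *
      linarith)
    (by rw [hY0]; linarith [init_fm s hT hq hN1 hI])
    (by
      have := tlin3 hT0 L L 0 4 (f := fun t => L * (SI s.Q t + SI s.P2 t) + 4) (by fun_prop)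
        cQ cP cP (fun t ht => by linarith)
      have k1 := mul_le_mul_of_nonneg_left hQ hL0
      have k2 := mul_le_mul_of_nonneg_left hP2 hL0
      rw [hΓ]; linarith)
    (by
      have k1 := tlin3 hT0 (b / 2) (b / 2) (2 * N * K0) 0
        (f := fun t => b / 2 * (SI (sqt (s.b 0)) t + SI (sqt (s.b 1)) t)
          + 2 * N * K0 * (SI s.Q t + SI s.P2 t)) (g3 := fun t => SI s.Q t + SI s.P2 t) (by fun_prop)
        cb0 cb1 (by fun_prop) (fun t ht => by linarith)
      have k2 := tlin3 hT0 1 1 0 0 (f := fun t => SI s.Q t + SI s.P2 t) (by fun_prop) cQ cP cP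
        (fun t ht => by linarith)
      have k3 := mul_le_mul_of_nonneg_left (hbb 0).2.2 (by linarith : 0 ≤ b / 2)
      have k4 := mul_le_mul_of_nonneg_left (hbb 1).2.2 (by linarith : 0 ≤ b / 2)
      have k5 := mul_le_mul_of_nonneg_left (k2.trans (by linarith :
        _ ≤ 2 * D)) (by positivity : 0 ≤ 2 * N * K0)
      rw [hH]; linarith)
  rw [← hY, ← hZ] at hG
  obtain ⟨g1, g2⟩ := hG
  have n1 : 0 ≤ Cs * Y := by positivity
  have n2 : 0 ≤ R * Y := by positivity
  have n3 : 0 ≤ (q + 2) * Y := by positivity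
  refine ⟨fun t ht => ?_, ?_, ?_⟩
  · obtain ⟨l0, l1, l2, l3, l4⟩ := low t ht
    have h2 := hS t ht
    have h3 := (sqx_le_Q s ht).1
    have h4 := g1 t ht
    have h5 := hP0 t ht
    have h6 := mul_le_mul_of_nonneg_left h4 hCs0
    have h7 : SI (s.fm q N) t ≤ Y := by linarith
    have h8 := mul_le_mul_of_nonneg_left h7 (by linarith : 0 ≤ R)
    have h9 := mul_le_mul_of_nonneg_left h7 (by linarith : 0 ≤ q + 2)
    refine ⟨by linarith, by linarith, by linarith⟩
  · have := tlin1 hT0 4 0 cr (g1 := fun t => 1 / 4 * SI (s.rsq s.u) t + SI s.J2 t) (by fun_prop)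
      (fun t ht => by linarith [hj0 t ht])
    linarith
  · have := tlin1 hT0 1 0 cj (g1 := fun t => 1 / 4 * SI (s.rsq s.u) t + SI s.J2 t) (by fun_prop)
      (fun t ht => by linarith [hr0 t ht])
    linarith

end mainest3

/-- Lemma 2.5: there is a constant `C` depending only on `T, q, C₀`
and on the initial data (upper bound `A` for the `H²` norms, upper bound `B` for
`∫₀¹ ρ₀(|ln ρ₀| + |ln θ₀|) dx`, positive lower bound `M` for `∫₀¹ ρ₀ dx`), but not on
the pointwise lower bounds of `ρ₀` and `θ₀`, such that every smooth solution satisfies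
`sup_{t∈[0,T]} ∫₀¹ (u_x² + |w_x|² + |b_x|² + (ρθ)² + ρθ^{q+2}) dx
 + ∬_{Q_T} (ρu_t² + ρ|w_t|² + |b_t|² + |b_{xx}|² + κ(θ)²θ_x²) dx dt ≤ C`. -/
theorem stmt12 (T q C₀ : ℝ) (hT : 0 < T) (hq : 0 < q) (hC₀ : 1 ≤ C₀)
    (κ : ℝ → ℝ) (hκ : KappaHyp q C₀ κ) (A B M : ℝ) (hM : 0 < M) :
    ∃ C : ℝ, 0 < C ∧ ∀ sol : MHDSol T κ, InitBounds sol A B M →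
      ∀ t ∈ Set.Icc (0:ℝ) T,
        (∫ x in (0:ℝ)..1,
            (pdx sol.u x t) ^ 2 + (∑ i, (pdx (sol.w i) x t) ^ 2)
            + (∑ i, (pdx (sol.b i) x t) ^ 2) + (sol.ρ x t * sol.θ x t) ^ 2
            + sol.ρ x t * (sol.θ x t) ^ (q + 2))
        + (∫ s in (0:ℝ)..T, ∫ y in (0:ℝ)..1,
            sol.ρ y s * (pdt sol.u y s) ^ 2
            + sol.ρ y s * (∑ i, (pdt (sol.w i) y s) ^ 2)
            + (∑ i, (pdt (sol.b i) y s) ^ 2)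
            + (∑ i, (pdx (pdx (sol.b i)) y s) ^ 2)
            + (κ (sol.θ y s)) ^ 2 * (pdx sol.θ y s) ^ 2) ≤ C := by
  obtain ⟨D, hD0, hD⟩ := main_bd T q C₀ hT hq hC₀ κ hκ A M hM
  obtain ⟨b, hb0, hb⟩ := b_bd T q C₀ hT hq hC₀ κ hκ A M hM
  obtain ⟨W, hW0, hW⟩ := w_bd T q C₀ hT hq hC₀ κ hκ A M hM
  have hT0 := hT.le
  refine ⟨5 * D + 4 * W + 6 * b + 1, by positivity, fun s hI t ht => ?_⟩
  obtain ⟨hd1, hd2, hd3⟩ := hD s B hI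
  obtain ⟨hb01, hb02, hb03⟩ := hb s B hI 0
  obtain ⟨hb11, hb12, hb13⟩ := hb s B hI 1
  obtain ⟨hw01, hw02⟩ := hW s B hI 0
  obtain ⟨hw11, hw12⟩ := hW s B hI 1
  have cth := s.th_cq (q + 2)
  have cκ := s.k_cq hκ
  simp only [Fin.sum_univ_two]
  have h1 := int_lin7 (f := fun x => (pdx s.u x t) ^ 2
      + ((pdx (s.w 0) x t) ^ 2 + (pdx (s.w 1) x t) ^ 2)
      + ((pdx (s.b 0) x t) ^ 2 + (pdx (s.b 1) x t) ^ 2) + (s.ρ x t * s.θ x t) ^ 2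
      + s.ρ x t * (s.θ x t) ^ (q + 2)) 1 1 1 1 1 1 1 0
    (by have := cth.slice ht; fun_prop)
    ((sqx_cq (T := T) s.sm_u).slice ht)
    ((sqx_cq (T := T) (s.sm_w 0)).slice ht) ((sqx_cq (T := T) (s.sm_w 1)).slice ht)
    ((sqx_cq (T := T) (s.sm_b 0)).slice ht) ((sqx_cq (T := T) (s.sm_b 1)).slice ht)
    (s.P2_cq.slice ht) ((s.hp_cq q).slice ht) (by
    intro x hx
    unfold sqx MHDSol.P2 MHDSol.hp
    linarith)
  have cfull : CQ T (fun y s' => s.ρ y s' * (pdt s.u y s') ^ 2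
            + s.ρ y s' * ((pdt (s.w 0) y s') ^ 2 + (pdt (s.w 1) y s') ^ 2)
            + ((pdt (s.b 0) y s') ^ 2 + (pdt (s.b 1) y s') ^ 2)
            + ((pdx (pdx (s.b 0)) y s') ^ 2 + (pdx (pdx (s.b 1)) y s') ^ 2)
            + (κ (s.θ y s')) ^ 2 * (pdx s.θ y s') ^ 2) := by
    refine CQ.add ?_ ((cκ.pow 2).mul ((s.sm_θ.pdx.cq T).pow 2))
    clear cκ cth
    unfold CQ
    fun_prop
  have c1 := (s.rsq_cq s.sm_u).si_cont hT0
  have c2 := (s.rsq_cq (s.sm_w 0)).si_cont hT0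
  have c3 := (s.rsq_cq (s.sm_w 1)).si_cont hT0
  have c4 := (sqt_cq (T := T) (s.sm_b 0)).si_cont hT0
  have c5 := (sqt_cq (T := T) (s.sm_b 1)).si_cont hT0
  have c6 := (sqx_cq (T := T) (s.sm_b 0).pdx).si_cont hT0
  have c7 := (sqx_cq (T := T) (s.sm_b 1).pdx).si_cont hT0
  have c8 := (s.J2_cq hκ).si_cont hT0
  have h2 := tlin3 hT0 1 1 1 0 (cfull.si_cont hT0)
    (g1 := fun t => SI (s.rsq s.u) t + SI (s.rsq (s.w 0)) t + SI (s.rsq (s.w 1)) t)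
    (g2 := fun t => SI (sqt (s.b 0)) t + SI (sqt (s.b 1)) t + SI (sqx (pdx (s.b 0))) t)
    (g3 := fun t => SI (sqx (pdx (s.b 1))) t + SI s.J2 t)
    (by fun_prop) (by fun_prop) (by fun_prop) (by
    intro r hr
    have c67 : ContinuousOn (fun x => sqx (pdx (s.b 0)) x r + sqx (pdx (s.b 1)) x r) (Icc 0 1) :=
      ((sqx_cq (T := T) (s.sm_b 0).pdx).slice hr).add ((sqx_cq (T := T) (s.sm_b 1).pdx).slice hr)
    have e := int_lin7 1 1 1 1 1 1 1 0 (cfull.slice hr) ((s.rsq_cq s.sm_u).slice hr)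
      ((s.rsq_cq (s.sm_w 0)).slice hr) ((s.rsq_cq (s.sm_w 1)).slice hr)
      ((sqt_cq (T := T) (s.sm_b 0)).slice hr) ((sqt_cq (T := T) (s.sm_b 1)).slice hr)
      c67 ((s.J2_cq hκ).slice hr) (by
      intro x hx
      unfold sqx sqt MHDSol.rsq MHDSol.J2 MHDSol.J
      linarith)
    rw [intervalIntegral.integral_add (ii01 ((sqx_cq (T := T) (s.sm_b 0).pdx).slice hr))
      (ii01 ((sqx_cq (T := T) (s.sm_b 1).pdx).slice hr))] at e
    unfold SI
    linarith)
  have k1 := tlin3 hT0 1 1 1 0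
    (f := fun t => SI (s.rsq s.u) t + SI (s.rsq (s.w 0)) t + SI (s.rsq (s.w 1)) t)
    (by fun_prop) c1 c2 c3 (fun t ht => by linarith)
  have k2 := tlin3 hT0 1 1 1 0
    (f := fun t => SI (sqt (s.b 0)) t + SI (sqt (s.b 1)) t + SI (sqx (pdx (s.b 0))) t)
    (by fun_prop) c4 c5 c6 (fun t ht => by linarith)
  have k3 := tlin3 hT0 1 1 0 0
    (f := fun t => SI (sqx (pdx (s.b 1))) t + SI s.J2 t)
    (by fun_prop) c7 c8 c8 (fun t ht => by linarith)
  obtain ⟨d1, d2, d3⟩ := hd1 t ht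
  have w0 := hw01 t ht
  have w1 := hw11 t ht
  have b0 := hb01 t ht
  have b1 := hb11 t ht
  have h3 := h2.trans (by linarith : _ ≤ 2 * D + 2 * W + 4 * b)
  unfold SI at d1 d2 d3 w0 w1 b0 b1 h3
  linarith
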